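/- arXiv:2110.03891 — 3 statements merged into one kernel-verified Lean document; each statement's English description precedes it below -/
import Mathlib

section
/- Under the stated conditions (linearly separable dataset, exponential-tailed loss, locally smooth loss, and learning rate η < 2N/(σ_max²·H₀)), the GDM iterates converge in direction to the L² max-margin solution: ‖w(t)‖ → ∞ as t → ∞ and lim_{t→∞} w(t)/‖w(t)‖ = ŵ/‖ŵ‖. -/
open Filter Topology RealInnerProductSpace MeasureTheory

set_option linter.unusedVariables false

section ScalarLoss

variable {ℓ ℓ' : ℝ → ℝ} {s₀ H : ℝ}

/-- Quadratic upper bound for a function whose derivative is Lipschitz on a half-line. -/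
lemma le_quadratic_of_lipschitz_deriv (hdiff : ∀ s, HasDerivAt ℓ (ℓ' s) s)
    (hH : ∀ a b, s₀ ≤ a → s₀ ≤ b → |ℓ' a - ℓ' b| ≤ H * |a - b|)
    {a b : ℝ} (ha : s₀ ≤ a) (hb : s₀ ≤ b) :
    ℓ b ≤ ℓ a + ℓ' a * (b - a) + H / 2 * (b - a) ^ 2 := by
  set φ : ℝ → ℝ := fun s => ℓ s - ℓ' a * (s - a) - H / 2 * (s - a) ^ 2 with hφ
  have hφd : ∀ s, HasDerivAt φ (ℓ' s - ℓ' a - H * (s - a)) s := by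
    intro s
    have h1 : HasDerivAt (fun s : ℝ => s - a) 1 s := (hasDerivAt_id s).sub_const a
    have := ((hdiff s).sub (h1.const_mul (ℓ' a))).sub ((h1.pow 2).const_mul (H / 2))
    refine HasDerivAt.congr_deriv this ?_
    push_cast
    ring
  have hφc : Continuous φ := continuous_iff_continuousAt.2 fun s => (hφd s).continuousAt
  suffices φ b ≤ φ a by
    simp only [hφ, sub_self] at this
    linarith
  rcases le_total a b with hab | hab
  · refine antitoneOn_of_deriv_nonpos (convex_Icc a b) hφc.continuousOn
      (fun s _ => (hφd s).differentiableAt.differentiableWithinAt) ?_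
      (Set.left_mem_Icc.2 hab) (Set.right_mem_Icc.2 hab) hab
    intro s hs
    rw [interior_Icc] at hs
    have h := (le_abs_self _).trans (hH s a (ha.trans hs.1.le) ha)
    rw [abs_of_pos (sub_pos.2 hs.1)] at h
    rw [(hφd s).deriv]
    linarith
  · refine monotoneOn_of_deriv_nonneg (convex_Icc b a) hφc.continuousOn
      (fun s _ => (hφd s).differentiableAt.differentiableWithinAt) ?_
      (Set.left_mem_Icc.2 hab) (Set.right_mem_Icc.2 hab) hab
    intro s hs
    rw [interior_Icc] at hs
    have h := (neg_abs_le _).trans' (neg_le_neg (hH s a (hb.trans hs.1.le) ha))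
    rw [abs_of_neg (sub_neg.2 hs.2)] at h
    rw [(hφd s).deriv]
    linarith

/-- The function `ℓ`, continued below `s₀` by its tangent at `s₀`. -/
noncomputable def tangentExtension (ℓ ℓ' : ℝ → ℝ) (s₀ s : ℝ) : ℝ :=
  if s₀ ≤ s then ℓ s else ℓ s₀ + ℓ' s₀ * (s - s₀)

lemma tangentExtension_of_le {s : ℝ} (hs : s₀ ≤ s) : tangentExtension ℓ ℓ' s₀ s = ℓ s :=
  if_pos hs

lemma lt_tangentExtension_of_lt (hneg : ℓ' s₀ < 0) {s : ℝ} (hs : s < s₀) :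
    ℓ s₀ < tangentExtension ℓ ℓ' s₀ s := by
  rw [tangentExtension, if_neg hs.not_ge]
  nlinarith

lemma tangentExtension_pos (hpos : ∀ s, 0 < ℓ s) (hneg : ℓ' s₀ < 0) (s : ℝ) :
    0 < tangentExtension ℓ ℓ' s₀ s := by
  rcases le_or_gt s₀ s with hs | hs
  · rw [tangentExtension_of_le hs]
    exact hpos s
  · exact (hpos s₀).trans (lt_tangentExtension_of_lt hneg hs)

lemma tangentExtension_le_quadratic (hdiff : ∀ s, HasDerivAt ℓ (ℓ' s) s)
    (hH : ∀ a b, s₀ ≤ a → s₀ ≤ b → |ℓ' a - ℓ' b| ≤ H * |a - b|) (hH0 : 0 ≤ H)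
    {a : ℝ} (ha : s₀ ≤ a) (b : ℝ) :
    tangentExtension ℓ ℓ' s₀ b ≤ ℓ a + ℓ' a * (b - a) + H / 2 * (b - a) ^ 2 := by
  rcases le_or_gt s₀ b with hb | hb
  · rw [tangentExtension_of_le hb]
    exact le_quadratic_of_lipschitz_deriv hdiff hH ha hb
  · rw [tangentExtension, if_neg hb.not_ge]
    have h1 := le_quadratic_of_lipschitz_deriv hdiff hH ha le_rfl
    have h2 := (le_abs_self _).trans (hH a s₀ ha le_rfl)
    rw [abs_of_nonneg (sub_nonneg.2 ha)] at h2
    have h3 := mul_le_mul_of_nonneg_right h2 (sub_nonneg.2 hb.le)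
    nlinarith [mul_nonneg hH0 (sq_nonneg (b - s₀))]

end ScalarLoss

section MaxMargin

variable {E ι : Type*} [NormedAddCommGroup E] [InnerProductSpace ℝ E] {x : ι → E}

lemma sq_norm_le_inner_of_minimal {v : E} (hv : ∀ i, 1 ≤ ⟪v, x i⟫)
    (hmin : ∀ v' : E, (∀ i, 1 ≤ ⟪v', x i⟫) → ‖v‖ ≤ ‖v'‖) {y : E} (hy : ∀ i, 1 ≤ ⟪y, x i⟫) :
    ‖v‖ ^ 2 ≤ ⟪y, v⟫ := by
  set K : Set E := {y | ∀ i, 1 ≤ ⟪y, x i⟫} with hK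
  have hconv : Convex ℝ K := by
    intro a ha b hb s t hs ht hst i
    rw [inner_add_left, real_inner_smul_left, real_inner_smul_left]
    nlinarith [ha i, hb i]
  have hvK : v ∈ K := hv
  have : Nonempty K := ⟨⟨v, hvK⟩⟩
  have hinf : ‖(0 : E) - v‖ = ⨅ z : K, ‖(0 : E) - z‖ := by
    refine le_antisymm (le_ciInf fun z => ?_) (ciInf_le ⟨0, ?_⟩ (⟨v, hvK⟩ : K))
    · simpa using hmin z z.2
    · rintro _ ⟨z, rfl⟩
      exact norm_nonneg _
  have := (norm_eq_iInf_iff_real_inner_le_zero hconv hvK).1 hinf y hy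
  rw [zero_sub, inner_neg_left, inner_sub_right, real_inner_self_eq_norm_sq,
    real_inner_comm] at this
  linarith

/-- A sequence whose normalized margin is asymptotically maximal converges in direction to the
max-margin vector. -/
lemma tendsto_direction_of_margin {v : E} (hv : ∀ i, 1 ≤ ⟪v, x i⟫) (hv0 : 0 < ‖v‖)
    (hmin : ∀ v' : E, (∀ i, 1 ≤ ⟪v', x i⟫) → ‖v‖ ≤ ‖v'‖) {w : ℕ → E}
    (hw : ∀ᶠ n in atTop, 0 < ‖w n‖)
    (hmargin : ∀ ε, 0 < ε → ε < ‖v‖⁻¹ →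
      ∀ᶠ n in atTop, ∀ i, (‖v‖⁻¹ - ε) * ‖w n‖ ≤ ⟪w n, x i⟫) :
    Tendsto (fun n => ‖w n‖⁻¹ • w n) atTop (𝓝 (‖v‖⁻¹ • v)) := by
  have hvv : ‖‖v‖⁻¹ • v‖ = 1 := by
    rw [norm_smul, norm_inv, norm_norm, inv_mul_cancel₀ hv0.ne']
  refine Metric.tendsto_nhds.2 fun τ hτ => ?_
  obtain ⟨ε, hε, hεv, hετ⟩ : ∃ ε, 0 < ε ∧ ε < ‖v‖⁻¹ ∧ 2 * (ε * ‖v‖) < τ ^ 2 := by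
    refine ⟨min (‖v‖⁻¹ / 2) (τ ^ 2 / 4 * ‖v‖⁻¹), by positivity,
      (min_le_left _ _).trans_lt (half_lt_self (by positivity)), ?_⟩
    have h := mul_le_mul_of_nonneg_right (min_le_right (‖v‖⁻¹ / 2) (τ ^ 2 / 4 * ‖v‖⁻¹)) hv0.le
    rw [inv_mul_cancel_right₀ hv0.ne'] at h
    nlinarith [pow_pos hτ 2]
  filter_upwards [hw, hmargin ε hε hεv] with n hn hmn
  have hww : ‖‖w n‖⁻¹ • w n‖ = 1 := by
    rw [norm_smul, norm_inv, norm_norm, inv_mul_cancel₀ hn.ne']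
  have hk : 0 < (‖v‖⁻¹ - ε) * ‖w n‖ := mul_pos (sub_pos.2 hεv) hn
  have hfeas := sq_norm_le_inner_of_minimal hv hmin (y := ((‖v‖⁻¹ - ε) * ‖w n‖)⁻¹ • w n)
    fun i => by
      rw [real_inner_smul_left, inv_mul_eq_div, one_le_div hk]
      exact hmn i
  rw [real_inner_smul_left, inv_mul_eq_div, le_div_iff₀ hk] at hfeas
  have hcos : 1 - ε * ‖v‖ ≤ ⟪‖w n‖⁻¹ • w n, ‖v‖⁻¹ • v⟫ := by
    rw [real_inner_smul_left, real_inner_smul_right]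
    have h := mul_le_mul_of_nonneg_left hfeas (by positivity : 0 ≤ ‖w n‖⁻¹ * ‖v‖⁻¹)
    have h' : ‖w n‖⁻¹ * ‖v‖⁻¹ * (‖v‖ ^ 2 * ((‖v‖⁻¹ - ε) * ‖w n‖)) = 1 - ε * ‖v‖ := by
      field_simp
    linarith
  have hsq := norm_sub_sq_real (‖w n‖⁻¹ • w n) (‖v‖⁻¹ • v)
  rw [hww, hvv] at hsq
  rw [dist_eq_norm]
  refine lt_of_pow_lt_pow_left₀ 2 hτ.le ?_
  linarith

end MaxMargin

section Separable

variable {E ι : Type*} [NormedAddCommGroup E] [InnerProductSpace ℝ E] [Fintype ι] {x : ι → E}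

lemma sum_inner_sq_le_of_norm_sum_smul_le {σ : ℝ} (hσ0 : 0 ≤ σ)
    (hσ : ∀ c : ι → ℝ, ‖∑ i, c i • x i‖ ≤ σ * Real.sqrt (∑ i, (c i) ^ 2)) (v : E) :
    ∑ i, ⟪v, x i⟫ ^ 2 ≤ σ ^ 2 * ‖v‖ ^ 2 := by
  set S := ∑ i, ⟪v, x i⟫ ^ 2 with hS
  have hS0 : 0 ≤ S := Finset.sum_nonneg fun i _ => sq_nonneg _
  have h1 : S = ⟪v, ∑ i, ⟪v, x i⟫ • x i⟫ := by
    simp [inner_sum, real_inner_smul_right, hS, sq]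
  have h2 : S ≤ ‖v‖ * (σ * Real.sqrt S) :=
    h1.le.trans ((real_inner_le_norm _ _).trans (by gcongr; exact hσ _))
  have h3 := Real.sq_sqrt hS0
  have h4 := Real.sqrt_nonneg S
  have h5 : Real.sqrt S ≤ σ * ‖v‖ := by
    rcases h4.eq_or_lt with h | h
    · rw [← h]
      positivity
    · refine le_of_mul_le_mul_right ?_ h
      nlinarith
  calc S = Real.sqrt S ^ 2 := h3.symm
    _ ≤ (σ * ‖v‖) ^ 2 := by gcongr
    _ = σ ^ 2 * ‖v‖ ^ 2 := by ring

/-- Energy estimate for the heavy-ball iteration: the iterates stay in the region where all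
margins are at least `s₀`, and the squared increments have bounded sums. -/
lemma heavyBall_energy_le {ℓ ℓ' : ℝ → ℝ} {s₀ H σ c β : ℝ} {w : ℕ → E}
    (hdiff : ∀ s, HasDerivAt ℓ (ℓ' s) s) (hpos : ∀ s, 0 < ℓ s) (hneg : ∀ s, ℓ' s < 0)
    (hH0 : 0 ≤ H) (hH : ∀ a b, s₀ ≤ a → s₀ ≤ b → |ℓ' a - ℓ' b| ≤ H * |a - b|)
    (hσ0 : 0 ≤ σ) (hσ : ∀ c : ι → ℝ, ‖∑ i, c i • x i‖ ≤ σ * Real.sqrt (∑ i, (c i) ^ 2))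
    (hc : 0 < c) (hβ : 0 ≤ β) (hcH : c * (H * σ ^ 2 / 2) ≤ 1 - β)
    (hs₀ : ∑ i, ℓ ⟪w 1, x i⟫ = ℓ s₀) (hw0 : w 0 = w 1)
    (hw : ∀ n, w (n + 2) - w (n + 1) =
      β • (w (n + 1) - w n) - c • ∑ i, ℓ' ⟪w (n + 1), x i⟫ • x i) (n : ℕ) :
    (∀ i, s₀ ≤ ⟪w (n + 1), x i⟫) ∧
    c * ∑ i, ℓ ⟪w (n + 1), x i⟫ + β / 2 * ‖w (n + 1) - w n‖ ^ 2 +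
      (1 - β - c * (H * σ ^ 2 / 2)) * ∑ k ∈ Finset.range (n + 1), ‖w (k + 1) - w k‖ ^ 2
      ≤ c * ℓ s₀ := by
  induction n with
  | zero =>
    refine ⟨fun i => ?_, by simp [hw0, hs₀]⟩
    have hanti : StrictAnti ℓ := strictAnti_of_deriv_neg fun s => by
      rw [(hdiff s).deriv]
      exact hneg s
    refine hanti.le_iff_ge.1 ?_
    rw [← hs₀]
    exact Finset.single_le_sum (f := fun i => ℓ ⟪w 1, x i⟫) (fun i _ => (hpos _).le)
      (Finset.mem_univ i)
  | succ n ih =>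
    obtain ⟨hm, hE⟩ := ih
    set D := w (n + 1) - w n with hD
    set D' := w (n + 2) - w (n + 1) with hD'
    set G := ∑ i, ℓ' ⟪w (n + 1), x i⟫ • x i with hG
    have hz : ∀ i, ⟪w (n + 2), x i⟫ - ⟪w (n + 1), x i⟫ = ⟪D', x i⟫ := fun i => by
      rw [hD', inner_sub_left]
    have hGi : ⟪D', G⟫ = ∑ i, ℓ' ⟪w (n + 1), x i⟫ * ⟪D', x i⟫ := by
      simp [hG, inner_sum, real_inner_smul_right]
    have hdesc : ∑ i, tangentExtension ℓ ℓ' s₀ ⟪w (n + 2), x i⟫ ≤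
        ∑ i, ℓ ⟪w (n + 1), x i⟫ + ⟪D', G⟫ + H * σ ^ 2 / 2 * ‖D'‖ ^ 2 := by
      calc ∑ i, tangentExtension ℓ ℓ' s₀ ⟪w (n + 2), x i⟫
          ≤ ∑ i, (ℓ ⟪w (n + 1), x i⟫ + ℓ' ⟪w (n + 1), x i⟫ * ⟪D', x i⟫ +
              H / 2 * ⟪D', x i⟫ ^ 2) := Finset.sum_le_sum fun i _ => by
            rw [← hz i]
            exact tangentExtension_le_quadratic hdiff hH hH0 (hm i) _
        _ = ∑ i, ℓ ⟪w (n + 1), x i⟫ + ⟪D', G⟫ + H / 2 * ∑ i, ⟪D', x i⟫ ^ 2 := by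
            rw [Finset.sum_add_distrib, Finset.sum_add_distrib, ← hGi, Finset.mul_sum]
        _ ≤ _ := by
            have := mul_le_mul_of_nonneg_left (sum_inner_sq_le_of_norm_sum_smul_le hσ0 hσ D')
              (div_nonneg hH0 zero_le_two)
            linarith
    have hcG : c * ⟪D', G⟫ = β * ⟪D', D⟫ - ‖D'‖ ^ 2 := by
      have h := congrArg (fun v => ⟪D', v⟫) (hw n)
      simp only [inner_sub_right, real_inner_smul_right] at h
      rw [← inner_sub_right, ← hD', ← inner_sub_right, ← hD, real_inner_self_eq_norm_sq] at h
      linarith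
    have hDD : ⟪D', D⟫ ≤ (‖D'‖ ^ 2 + ‖D‖ ^ 2) / 2 := by
      have := real_inner_le_norm D' D
      nlinarith [sq_nonneg (‖D'‖ - ‖D‖)]
    have hE_next : c * ∑ i, tangentExtension ℓ ℓ' s₀ ⟪w (n + 2), x i⟫ + β / 2 * ‖D'‖ ^ 2 +
        (1 - β - c * (H * σ ^ 2 / 2)) *
          ∑ k ∈ Finset.range (n + 1 + 1), ‖w (k + 1) - w k‖ ^ 2 ≤ c * ℓ s₀ := by
      rw [Finset.sum_range_succ]
      have h1 := mul_le_mul_of_nonneg_left hdesc hc.le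
      have h2 := mul_le_mul_of_nonneg_left hDD hβ
      linarith
    have hm' : ∀ i, s₀ ≤ ⟪w (n + 2), x i⟫ := by
      intro i
      by_contra! hi
      have h1 := lt_tangentExtension_of_lt (ℓ := ℓ) (hneg s₀) hi
      have h2 := Finset.single_le_sum (f := fun i => tangentExtension ℓ ℓ' s₀ ⟪w (n + 2), x i⟫)
        (fun i _ => (tangentExtension_pos hpos (hneg s₀) _).le) (Finset.mem_univ i)
      have h3 := mul_lt_mul_of_pos_left (h1.trans_le h2) hc
      have h4 : 0 ≤ β / 2 * ‖D'‖ ^ 2 := by positivity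
      have h5 : 0 ≤ (1 - β - c * (H * σ ^ 2 / 2)) *
          ∑ k ∈ Finset.range (n + 1 + 1), ‖w (k + 1) - w k‖ ^ 2 :=
        mul_nonneg (by linarith) (Finset.sum_nonneg fun _ _ => sq_nonneg _)
      linarith
    refine ⟨hm', ?_⟩
    rwa [Finset.sum_congr rfl fun i _ => tangentExtension_of_le (ℓ := ℓ) (ℓ' := ℓ') (hm' i)] at hE_next

/-- If the gradients tend to zero and all margins stay above `s₀`, then the margins diverge. -/
lemma tendsto_margin_atTop {ℓ' : ℝ → ℝ} {s₀ : ℝ} {v : E} {w : ℕ → E}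
    (hv : ∀ i, 1 ≤ ⟪v, x i⟫) (hneg : ∀ s, ℓ' s < 0) (hcont : ContinuousOn ℓ' (Set.Ici s₀))
    (hm : ∀ n i, s₀ ≤ ⟪w n, x i⟫)
    (hG : Tendsto (fun n => ∑ i, ℓ' ⟪w n, x i⟫ • x i) atTop (𝓝 0)) (i : ι) :
    Tendsto (fun n => ⟪w n, x i⟫) atTop atTop := by
  have hGv : Tendsto (fun n => ⟪v, ∑ j, ℓ' ⟪w n, x j⟫ • x j⟫) atTop (𝓝 0) := by
    simpa using (tendsto_const_nhds (x := v)).inner (𝕜 := ℝ) hG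
  refine tendsto_atTop.2 fun M => ?_
  rcases lt_or_ge M s₀ with hM | hM
  · exact .of_forall fun n => hM.le.trans (hm n i)
  obtain ⟨s, -, hs⟩ := isCompact_Icc.exists_isMaxOn (Set.nonempty_Icc.2 hM)
    (hcont.mono Set.Icc_subset_Ici_self)
  filter_upwards [hGv.eventually_const_lt (hneg s)] with n hn
  by_contra! hlt
  have h1 : ℓ' ⟪w n, x i⟫ ≤ ℓ' s := hs ⟨hm n i, hlt.le⟩
  have h2 : ⟪v, ∑ j, ℓ' ⟪w n, x j⟫ • x j⟫ ≤ ℓ' ⟪w n, x i⟫ := by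
    simp only [inner_sum, real_inner_smul_right]
    calc ∑ j, ℓ' ⟪w n, x j⟫ * ⟪v, x j⟫ ≤ ∑ j, ℓ' ⟪w n, x j⟫ :=
          Finset.sum_le_sum fun j _ => by nlinarith [hneg ⟪w n, x j⟫, hv j]
      _ ≤ ℓ' ⟪w n, x i⟫ := by
          have := Finset.single_le_sum (f := fun j => -ℓ' ⟪w n, x j⟫)
            (fun j _ => (neg_pos.2 (hneg _)).le) (Finset.mem_univ i)
          simp only [Finset.sum_neg_distrib] at this
          linarith
  linarith

/-- The weights `p` need only approximate the exponential weights up to relative error `ε`. -/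
lemma sum_exp_step_le {v u : E} {p : ι → ℝ} {R ε c : ℝ}
    (hv : ∀ i, 1 ≤ ⟪v, x i⟫) (hR : ∀ i, ‖x i‖ ≤ R) (hc : 0 ≤ c) (hv0 : 0 < ‖v‖)
    (hp0 : ∀ i, 0 ≤ p i)
    (hp : ∀ i, |p i - Real.exp (-⟪u, x i⟫)| ≤ ε * Real.exp (-⟪u, x i⟫))
    (hsmall : R * ‖c • ∑ i, p i • x i‖ ≤ 1) :
    ∑ i, Real.exp (-⟪u + c • ∑ j, p j • x j, x i⟫) ≤
      (∑ i, Real.exp (-⟪u, x i⟫)) *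
        Real.exp (-((1 - ε) * ‖v‖⁻¹ - ε * R - R ^ 2 * ‖c • ∑ i, p i • x i‖) *
          ‖c • ∑ i, p i • x i‖) := by
  set g := ∑ i, p i • x i with hg
  set δ := c • g with hδ
  set e : ι → ℝ := fun i => Real.exp (-⟪u, x i⟫) with he
  set F := ∑ i, e i with hF
  have he0 : ∀ i, 0 < e i := fun i => Real.exp_pos _
  have hF0 : 0 ≤ F := Finset.sum_nonneg fun i _ => (he0 i).le
  have hδx : ∀ i, |⟪δ, x i⟫| ≤ R * ‖δ‖ := fun i => by
    rw [mul_comm]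
    exact (abs_real_inner_le_norm _ _).trans (by gcongr; exact hR i)
  have hgv : ∑ i, p i ≤ ‖v‖ * ‖g‖ := by
    refine le_trans ?_ (real_inner_le_norm v g)
    simp only [hg, inner_sum, real_inner_smul_right]
    exact Finset.sum_le_sum fun i _ => le_mul_of_one_le_right (hp0 i) (hv i)
  have hpF : (1 - ε) * F ≤ ∑ i, p i := by
    rw [hF, Finset.mul_sum]
    refine Finset.sum_le_sum fun i _ => ?_
    have := (abs_le.1 (hp i)).1
    linarith
  have hδg : ‖δ‖ * ‖g‖ = ⟪δ, g⟫ := by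
    rw [hδ, norm_smul, Real.norm_of_nonneg hc, real_inner_smul_left, real_inner_self_eq_norm_sq]
    ring
  have hg_lower : (1 - ε) * ‖v‖⁻¹ * F ≤ ‖g‖ := by
    have h := mul_le_mul_of_nonneg_left (hpF.trans hgv) (inv_nonneg.2 hv0.le)
    rw [inv_mul_cancel_left₀ hv0.ne'] at h
    linarith
  have hperturb : ⟪δ, g⟫ - ε * R * ‖δ‖ * F ≤ ∑ i, e i * ⟪δ, x i⟫ := by
    rw [hg, inner_sum, hF, Finset.mul_sum, ← Finset.sum_sub_distrib]
    refine Finset.sum_le_sum fun i _ => ?_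
    rw [real_inner_smul_right]
    have h1 : (p i - e i) * ⟪δ, x i⟫ ≤ ε * e i * (R * ‖δ‖) := by
      refine (le_abs_self _).trans ?_
      rw [abs_mul]
      exact mul_le_mul (hp i) (hδx i) (abs_nonneg _) ((abs_nonneg _).trans (hp i))
    linarith
  have hexp : ∑ i, Real.exp (-⟪u + δ, x i⟫) ≤
      F - ∑ i, e i * ⟪δ, x i⟫ + R ^ 2 * ‖δ‖ ^ 2 * F := by
    rw [hF, Finset.mul_sum, ← Finset.sum_sub_distrib, ← Finset.sum_add_distrib]
    refine Finset.sum_le_sum fun i _ => ?_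
    have h1 : Real.exp (-⟪u + δ, x i⟫) = e i * Real.exp (-⟪δ, x i⟫) := by
      rw [inner_add_left, neg_add, Real.exp_add]
    have h2 : Real.exp (-⟪δ, x i⟫) ≤ 1 - ⟪δ, x i⟫ + ⟪δ, x i⟫ ^ 2 := by
      have h := Real.abs_exp_sub_one_sub_id_le (x := -⟪δ, x i⟫)
        (by rw [abs_neg]; exact (hδx i).trans hsmall)
      have := (le_abs_self _).trans h
      rw [neg_sq] at this
      linarith
    have h3 : ⟪δ, x i⟫ ^ 2 ≤ R ^ 2 * ‖δ‖ ^ 2 := by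
      rw [← mul_pow]
      exact sq_le_sq' (abs_le.1 (hδx i)).1 (abs_le.1 (hδx i)).2
    rw [h1]
    calc e i * Real.exp (-⟪δ, x i⟫) ≤ e i * (1 - ⟪δ, x i⟫ + R ^ 2 * ‖δ‖ ^ 2) := by
          have := (he0 i).le
          gcongr
          linarith
      _ = _ := by ring
  have hmain := mul_le_mul_of_nonneg_left hg_lower (norm_nonneg δ)
  calc ∑ i, Real.exp (-⟪u + δ, x i⟫)
      ≤ F * (-((1 - ε) * ‖v‖⁻¹ - ε * R - R ^ 2 * ‖δ‖) * ‖δ‖ + 1) := by linarith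
    _ ≤ _ := by
      gcongr
      exact Real.add_one_le_exp _

/-- Along a perturbed gradient iteration for the exponential loss, the smallest margin grows at
least like the maximal margin times the norm. -/
lemma exists_margin_ge_norm_sub {v : E} (hv : ∀ i, 1 ≤ ⟪v, x i⟫) (hv0 : 0 < ‖v‖)
    {u : ℕ → E} {p : ℕ → ι → ℝ} {c : ℝ} (hc : 0 ≤ c)
    (hu : ∀ n, u (n + 1) = u n + c • ∑ i, p n i • x i) (hp0 : ∀ n i, 0 ≤ p n i)
    (hδ : Tendsto (fun n => ‖c • ∑ i, p n i • x i‖) atTop (𝓝 0))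
    (hp : ∀ i, Tendsto (fun n => p n i * Real.exp ⟪u n, x i⟫) atTop (𝓝 1))
    {ε : ℝ} (hε : 0 < ε) (hεv : ε < ‖v‖⁻¹) :
    ∃ C, ∀ᶠ n in atTop, ∀ i, (‖v‖⁻¹ - ε) * ‖u n‖ - C ≤ ⟪u n, x i⟫ := by
  set a := ‖v‖⁻¹ with ha
  have ha0 : 0 < a := inv_pos.2 hv0
  set R := ∑ i, ‖x i‖ with hRdef
  have hR0 : 0 ≤ R := Finset.sum_nonneg fun i _ => norm_nonneg _
  have hR : ∀ i, ‖x i‖ ≤ R := fun i =>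
    Finset.single_le_sum (f := fun i => ‖x i‖) (fun i _ => norm_nonneg _) (Finset.mem_univ i)
  set F : ℕ → ℝ := fun n => ∑ i, Real.exp (-⟪u n, x i⟫) with hF
  obtain ⟨ε₁, hε₁0, hε₁⟩ : ∃ ε₁, 0 < ε₁ ∧ ε₁ * (a + R) ≤ ε / 2 := by
    refine ⟨ε / 2 / (a + R), by positivity, ?_⟩
    rw [div_mul_cancel₀ _ (by positivity)]
  have hstep : ∀ᶠ n in atTop, F (n + 1) ≤ F n * Real.exp (-(a - ε) * ‖u (n + 1) - u n‖) := by
    have hclose : ∀ᶠ n in atTop, ∀ i, |p n i * Real.exp ⟪u n, x i⟫ - 1| < ε₁ :=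
      eventually_all.2 fun i => by
        simpa [Real.dist_eq] using Metric.tendsto_nhds.1 (hp i) ε₁ hε₁0
    have h1 : ∀ᶠ n in atTop, R * ‖c • ∑ i, p n i • x i‖ < 1 :=
      (by simpa using hδ.const_mul R : Tendsto _ _ (𝓝 (0 : ℝ))).eventually_lt_const one_pos
    have h2 : ∀ᶠ n in atTop, R ^ 2 * ‖c • ∑ i, p n i • x i‖ < ε / 2 :=
      (by simpa using hδ.const_mul (R ^ 2) : Tendsto _ _ (𝓝 (0 : ℝ))).eventually_lt_const
        (half_pos hε)
    filter_upwards [hclose, h1, h2] with n hn h1 h2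
    have hrel : ∀ i, |p n i - Real.exp (-⟪u n, x i⟫)| ≤ ε₁ * Real.exp (-⟪u n, x i⟫) := fun i => by
      have he := Real.exp_pos (-⟪u n, x i⟫)
      have : p n i - Real.exp (-⟪u n, x i⟫) =
          (p n i * Real.exp ⟪u n, x i⟫ - 1) * Real.exp (-⟪u n, x i⟫) := by
        rw [sub_mul, mul_assoc, ← Real.exp_add]
        simp
      rw [this, abs_mul, abs_of_pos he]
      exact mul_le_mul_of_nonneg_right (hn i).le he.le
    have hmain := sum_exp_step_le hv hR hc hv0 (hp0 n) hrel h1.le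
    rw [← hu n] at hmain
    refine hmain.trans ?_
    have hd : u (n + 1) - u n = c • ∑ i, p n i • x i := by rw [hu n, add_sub_cancel_left]
    rw [hd]
    refine mul_le_mul_of_nonneg_left (Real.exp_le_exp.2 ?_)
      (Finset.sum_nonneg fun i _ => (Real.exp_pos _).le)
    refine mul_le_mul_of_nonneg_right ?_ (norm_nonneg _)
    linarith
  obtain ⟨T, hT⟩ := eventually_atTop.1 hstep
  have hdecay : ∀ n ≥ T, F n ≤ F T * Real.exp (-(a - ε) * ‖u n - u T‖) := by
    intro n hn
    induction n, hn using Nat.le_induction with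
    | base => simp
    | succ n hn ih =>
      calc F (n + 1) ≤ F n * Real.exp (-(a - ε) * ‖u (n + 1) - u n‖) := hT n hn
        _ ≤ F T * Real.exp (-(a - ε) * ‖u n - u T‖) *
            Real.exp (-(a - ε) * ‖u (n + 1) - u n‖) := by gcongr
        _ = F T * Real.exp (-(a - ε) * (‖u (n + 1) - u n‖ + ‖u n - u T‖)) := by
          rw [mul_assoc, ← Real.exp_add]
          ring_nf
        _ ≤ _ := by
          refine mul_le_mul_of_nonneg_left (Real.exp_le_exp.2 ?_)
            (Finset.sum_nonneg fun i _ => (Real.exp_pos _).le)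
          refine mul_le_mul_of_nonpos_left (norm_sub_le_norm_sub_add_norm_sub _ _ _) (by linarith)
  refine ⟨Real.log (F T) + (a - ε) * ‖u T‖, eventually_atTop.2 ⟨T, fun n hn i => ?_⟩⟩
  have hFT : 0 < F T := Finset.sum_pos (fun i _ => Real.exp_pos _) ⟨i, Finset.mem_univ i⟩
  have h1 : Real.exp (-⟪u n, x i⟫) ≤
      Real.exp (Real.log (F T) + -(a - ε) * ‖u n - u T‖) := by
    rw [Real.exp_add, Real.exp_log hFT]
    exact (Finset.single_le_sum (f := fun i => Real.exp (-⟪u n, x i⟫))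
      (fun i _ => (Real.exp_pos _).le) (Finset.mem_univ i)).trans (hdecay n hn)
  have h2 := Real.exp_le_exp.1 h1
  have h3 := mul_le_mul_of_nonneg_left (norm_sub_norm_le (u n) (u T)) (sub_nonneg.2 hεv.le)
  linarith

/-- Heavy-ball iterations with vanishing increments and diverging margins, for a loss with
`-ℓ' s ∼ exp (-s)`, converge in direction to the max-margin vector. -/
lemma heavyBall_tendsto_direction [Nonempty ι] {ℓ' : ℝ → ℝ} {c β : ℝ} {v : E} {w : ℕ → E}
    (hv : ∀ i, 1 ≤ ⟪v, x i⟫) (hv0 : 0 < ‖v‖)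
    (hmin : ∀ v' : E, (∀ i, 1 ≤ ⟪v', x i⟫) → ‖v‖ ≤ ‖v'‖)
    (hneg : ∀ s, ℓ' s < 0) (htail : Tendsto (fun s => -ℓ' s * Real.exp s) atTop (𝓝 1))
    (hc : 0 ≤ c) (hβ0 : 0 ≤ β) (hβ1 : β < 1)
    (hw : ∀ n, w (n + 2) - w (n + 1) =
      β • (w (n + 1) - w n) - c • ∑ i, ℓ' ⟪w (n + 1), x i⟫ • x i)
    (hD : Tendsto (fun n => w (n + 1) - w n) atTop (𝓝 0))
    (hz : ∀ i, Tendsto (fun n => ⟪w (n + 1), x i⟫) atTop atTop) :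
    Tendsto (fun n => ‖w (n + 1)‖) atTop atTop ∧
    Tendsto (fun n => ‖w (n + 1)‖⁻¹ • w (n + 1)) atTop (𝓝 (‖v‖⁻¹ • v)) := by
  have hβ' : 0 < 1 - β := sub_pos.2 hβ1
  set b := β / (1 - β) with hb
  have hb0 : 0 ≤ b := div_nonneg hβ0 hβ'.le
  have hnorm : Tendsto (fun n => ‖w (n + 1)‖) atTop atTop := by
    obtain ⟨i⟩ := ‹Nonempty ι›
    have hxi : 0 < ‖x i‖ := by
      refine norm_pos_iff.2 fun h => ?_
      have := hv i
      rw [h, inner_zero_right] at this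
      linarith
    refine tendsto_atTop_mono (fun n => ?_) ((hz i).atTop_div_const hxi)
    rw [div_le_iff₀ hxi]
    exact real_inner_le_norm _ _
  refine ⟨hnorm, tendsto_direction_of_margin hv hv0 hmin (hnorm.eventually_gt_atTop 0) ?_⟩
  intro ε hε hεv
  set u : ℕ → E := fun n => w (n + 1) + b • (w (n + 1) - w n) with hu
  have hurec : ∀ n, u (n + 1) = u n + (c / (1 - β)) • ∑ i, (-ℓ' ⟪w (n + 1), x i⟫) • x i := by
    intro n
    have h1 : c • ∑ i, (-ℓ' ⟪w (n + 1), x i⟫) • x i =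
        (w (n + 2) - w (n + 1)) - β • (w (n + 1) - w n) := by
      rw [hw n]
      simp
    rw [div_eq_inv_mul, mul_smul, h1]
    simp only [hu, hb]
    match_scalars <;> field_simp <;> ring
  have hDx : ∀ i, Tendsto (fun n => b * ⟪w (n + 1) - w n, x i⟫) atTop (𝓝 0) := fun i => by
    simpa using (hD.inner (𝕜 := ℝ) (tendsto_const_nhds (x := x i))).const_mul b
  have hδ : Tendsto (fun n => ‖(c / (1 - β)) • ∑ i, (-ℓ' ⟪w (n + 1), x i⟫) • x i‖)
      atTop (𝓝 0) := by
    have h1 : Tendsto (fun n => u (n + 1) - u n) atTop (𝓝 0) := by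
      have hD1 := hD.comp (tendsto_add_atTop_nat 1)
      have := hD1.add ((hD1.sub hD).const_smul b)
      simp only [sub_zero, smul_zero, add_zero] at this
      refine this.congr fun n => ?_
      simp only [hu, Function.comp_apply]
      match_scalars <;> ring
    simpa [hurec] using h1.norm
  have hp : ∀ i, Tendsto (fun n => -ℓ' ⟪w (n + 1), x i⟫ * Real.exp ⟪u n, x i⟫)
      atTop (𝓝 1) := fun i => by
    have h1 := (htail.comp (hz i)).mul ((Real.continuous_exp.tendsto 0).comp (hDx i))
    rw [Real.exp_zero, mul_one] at h1
    refine h1.congr fun n => ?_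
    simp only [hu, Function.comp_apply]
    rw [inner_add_left, real_inner_smul_left, Real.exp_add]
    ring
  obtain ⟨C, hC⟩ := exists_margin_ge_norm_sub hv hv0 (div_nonneg hc hβ'.le) hurec
    (fun n i => (neg_pos.2 (hneg _)).le) hδ hp (half_pos hε) ((half_lt_self hε).trans hεv)
  have hDb : ∀ᶠ n in atTop, b * ‖w (n + 1) - w n‖ < 1 :=
    (by simpa using hD.norm.const_mul b : Tendsto _ _ (𝓝 (0 : ℝ))).eventually_lt_const one_pos
  have hDxb : ∀ᶠ n in atTop, ∀ i, b * ⟪w (n + 1) - w n, x i⟫ < 1 :=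
    eventually_all.2 fun i => (hDx i).eventually_lt_const one_pos
  filter_upwards [hC, hDb, hDxb,
    (hnorm.const_mul_atTop (half_pos hε)).eventually_ge_atTop (C + 1 + ‖v‖⁻¹)]
    with n h1 h2 h3 h4 i
  have h5 : ⟪u n, x i⟫ = ⟪w (n + 1), x i⟫ + b * ⟪w (n + 1) - w n, x i⟫ := by
    rw [hu, inner_add_left, real_inner_smul_left]
  have h6 : ‖w (n + 1)‖ - 1 ≤ ‖u n‖ := by
    have h := norm_sub_le_norm_add (w (n + 1)) (b • (w (n + 1) - w n))
    rw [norm_smul, Real.norm_of_nonneg hb0] at h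
    linarith
  have h7 := mul_le_mul_of_nonneg_left h6 (by linarith : 0 ≤ ‖v‖⁻¹ - ε / 2)
  linarith [h1 i, h3 i]

end Separable

lemma tendsto_mul_exp_of_exp_tail {g : ℝ → ℝ} {μp μm xp xm : ℝ} (hμp : 0 < μp) (hμm : 0 < μm)
    (hp : ∀ s, xp < s → g s ≤ (1 + Real.exp (-μp * s)) * Real.exp (-s))
    (hm : ∀ s, xm < s → (1 - Real.exp (-μm * s)) * Real.exp (-s) ≤ g s) :
    Tendsto (fun s => g s * Real.exp s) atTop (𝓝 1) := by
  have hexp : ∀ {μ : ℝ}, 0 < μ → Tendsto (fun s => Real.exp (-μ * s)) atTop (𝓝 0) := fun hμ =>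
    Real.tendsto_exp_atBot.comp (tendsto_id.const_mul_atTop_of_neg (neg_lt_zero.2 hμ))
  have hcancel : ∀ s y : ℝ, y * Real.exp (-s) * Real.exp s = y := fun s y => by
    rw [mul_assoc, ← Real.exp_add, neg_add_cancel, Real.exp_zero, mul_one]
  refine tendsto_of_tendsto_of_tendsto_of_le_of_le'
    (sub_zero (1 : ℝ) ▸ tendsto_const_nhds.sub (hexp hμm))
    (add_zero (1 : ℝ) ▸ tendsto_const_nhds.add (hexp hμp)) ?_ ?_
  · filter_upwards [eventually_gt_atTop xm] with s hs
    rw [← hcancel s (1 - _)]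
    exact mul_le_mul_of_nonneg_right (hm s hs) (Real.exp_pos _).le
  · filter_upwards [eventually_gt_atTop xp] with s hs
    rw [← hcancel s (1 + _)]
    exact mul_le_mul_of_nonneg_right (hp s hs) (Real.exp_pos _).le


theorem stmt0
    {d N : ℕ} (hN : 1 ≤ N)
    (x : Fin N → EuclideanSpace ℝ (Fin d))
    (ℓ ℓ' : ℝ → ℝ)
    (hdiff : ∀ s : ℝ, HasDerivAt ℓ (ℓ' s) s)
    (L : EuclideanSpace ℝ (Fin d) → ℝ)
    (hLdef : ∀ w : EuclideanSpace ℝ (Fin d), L w = (1 / (N : ℝ)) * ∑ i, ℓ ⟪w, x i⟫)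
    (gradL : EuclideanSpace ℝ (Fin d) → EuclideanSpace ℝ (Fin d))
    (hgraddef : ∀ w : EuclideanSpace ℝ (Fin d),
      gradL w = (1 / (N : ℝ)) • ∑ i, ℓ' ⟪w, x i⟫ • x i)
    (hsep : ∃ u : EuclideanSpace ℝ (Fin d), ∀ i, 0 < ⟪u, x i⟫)
    (σmax : ℝ) (hσpos : 0 < σmax)
    (hσ : ∀ c : Fin N → ℝ, ‖∑ i, c i • x i‖ ≤ σmax * Real.sqrt (∑ i, (c i) ^ 2))
    (wmax : EuclideanSpace ℝ (Fin d))
    (hwmax : ∀ i, 1 ≤ ⟪wmax, x i⟫)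
    (hwmaxmin : ∀ v : EuclideanSpace ℝ (Fin d), (∀ i, 1 ≤ ⟪v, x i⟫) → ‖wmax‖ ≤ ‖v‖)
    (hℓpos : ∀ s : ℝ, 0 < ℓ s) (hℓ'neg : ∀ s : ℝ, ℓ' s < 0)
    (hℓtop : Tendsto ℓ atTop (𝓝 0))
    (hℓ'top : Tendsto ℓ' atTop (𝓝 0))
    (hℓ'bot : Filter.limsup ℓ' atBot < 0)
    (μp μm xp xm : ℝ) (hμp : 0 < μp) (hμm : 0 < μm)
    (htailp : ∀ s : ℝ, xp < s → -ℓ' s ≤ (1 + Real.exp (-μp * s)) * Real.exp (-s))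
    (htailm : ∀ s : ℝ, xm < s → (1 - Real.exp (-μm * s)) * Real.exp (-s) ≤ -ℓ' s)
    (hloc : ∀ s : ℝ, ∃ H : ℝ, 0 < H ∧
      ∀ a b : ℝ, s ≤ a → s ≤ b → |ℓ' a - ℓ' b| ≤ H * |a - b|)
    (η β : ℝ) (hη : 0 < η) (hβ0 : 0 ≤ β) (hβ1 : β < 1)
    (w m : ℕ → EuclideanSpace ℝ (Fin d))
    (hm0 : m 0 = 0) (hw0 : w 0 = w 1)
    (hmrec : ∀ t : ℕ, 1 ≤ t → m t = β • m (t - 1) + (1 - β) • gradL (w t))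
    (hwrec : ∀ t : ℕ, 1 ≤ t → w (t + 1) = w t - η • m t)
    (s₀ H₀ : ℝ) (hs₀ : ℓ s₀ = N * L (w 1)) (hH₀pos : 0 < H₀)
    (hH₀ : ∀ a b : ℝ, s₀ ≤ a → s₀ ≤ b → |ℓ' a - ℓ' b| ≤ H₀ * |a - b|)
    (hηlt : η < 2 * N / (σmax ^ 2 * H₀))
    :
    Tendsto (fun t : ℕ => ‖w t‖) atTop atTop ∧
    Tendsto (fun t : ℕ => ‖w t‖⁻¹ • w t) atTop (𝓝 (‖wmax‖⁻¹ • wmax)) := by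
  have hN0 : (0 : ℝ) < N := by exact_mod_cast hN
  have : Nonempty (Fin N) := ⟨⟨0, hN⟩⟩
  have hβ' : 0 < 1 - β := sub_pos.2 hβ1
  set c := η * (1 - β) / N with hc
  have hc0 : 0 < c := by positivity
  have hrec : ∀ n, w (n + 2) - w (n + 1) =
      β • (w (n + 1) - w n) - c • ∑ i, ℓ' ⟪w (n + 1), x i⟫ • x i := by
    intro n
    have hmn : w (n + 1) - w n = -(η • m n) := by
      cases n with
      | zero => simp [hm0, hw0]
      | succ n =>
        rw [hwrec (n + 1) (by omega)]
        abel
    rw [hwrec (n + 1) (by omega), hmrec (n + 1) (by omega), Nat.add_sub_cancel, hgraddef, hmn, hc]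
    match_scalars <;> field_simp
    norm_num
  have hcH : c * (H₀ * σmax ^ 2 / 2) < 1 - β := by
    rw [lt_div_iff₀ (by positivity)] at hηlt
    rw [hc, div_mul_eq_mul_div, div_lt_iff₀ hN0]
    nlinarith
  have hs₀' : ∑ i, ℓ ⟪w 1, x i⟫ = ℓ s₀ := by
    rw [hs₀, hLdef]
    field_simp
  have henergy := heavyBall_energy_le hdiff hℓpos hℓ'neg hH₀pos.le hH₀ hσpos.le hσ hc0 hβ0 hcH.le
    hs₀' hw0 hrec
  have hD : Tendsto (fun n => w (n + 1) - w n) atTop (𝓝 0) := by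
    have hsum : Summable fun n => ‖w (n + 1) - w n‖ ^ 2 := by
      refine summable_of_sum_range_le (c := c * ℓ s₀ / (1 - β - c * (H₀ * σmax ^ 2 / 2)))
        (fun n => sq_nonneg _) fun n => ?_
      rw [le_div_iff₀ (sub_pos.2 hcH)]
      have h1 := (henergy n).2
      rw [Finset.sum_range_succ] at h1
      have h2 : 0 ≤ c * ∑ i, ℓ ⟪w (n + 1), x i⟫ :=
        mul_nonneg hc0.le (Finset.sum_nonneg fun i _ => (hℓpos _).le)
      have h3 : 0 ≤ β / 2 * ‖w (n + 1) - w n‖ ^ 2 := by positivity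
      nlinarith [mul_nonneg (sub_pos.2 hcH).le (sq_nonneg ‖w (n + 1) - w n‖)]
    refine tendsto_zero_iff_norm_tendsto_zero.2 ?_
    simpa using hsum.tendsto_atTop_zero.sqrt
  have hG : Tendsto (fun n => ∑ i, ℓ' ⟪w (n + 1), x i⟫ • x i) atTop (𝓝 0) := by
    have h := ((hD.const_smul β).sub (hD.comp (tendsto_add_atTop_nat 1))).const_smul c⁻¹
    simp only [smul_zero, sub_zero] at h
    refine h.congr fun n => ?_
    rw [Function.comp_apply, hrec n, sub_sub_cancel, inv_smul_smul₀ hc0.ne']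
  have hlip : LipschitzOnWith ⟨H₀, hH₀pos.le⟩ ℓ' (Set.Ici s₀) :=
    LipschitzOnWith.of_dist_le_mul fun a ha b hb => hH₀ a b ha hb
  have hwmax0 : 0 < ‖wmax‖ := by
    refine norm_pos_iff.2 fun h => ?_
    have := hwmax ⟨0, hN⟩
    rw [h, inner_zero_left] at this
    linarith
  have hmargin := tendsto_margin_atTop (w := fun n => w (n + 1)) hwmax hℓ'neg hlip.continuousOn
    (fun n => (henergy n).1) hG
  obtain ⟨h1, h2⟩ := heavyBall_tendsto_direction hwmax hwmax0 hwmaxmin hℓ'neg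
    (tendsto_mul_exp_of_exp_tail hμp hμm htailp htailm) hc0.le hβ0 hβ1 hrec hD hmargin
  exact ⟨(tendsto_add_atTop_iff_nat (f := fun n => ‖w n‖) 1).1 h1,
    (tendsto_add_atTop_iff_nat (f := fun n => ‖w n‖⁻¹ • w n) 1).1 h2⟩
end

section
/- For Lebesgue-almost every dataset x ∈ (EuclideanSpace ℝ (Fin d))^{Fin N} the following holds: if the dataset x is linearly separable, ŵ is its L² max-margin solution, ℓ is exponential-tailed and locally smooth, and the GDM iterates are run with momentum β ∈ [0,1) and a learning rate satisfying η < 2N/(σ_max²·H₀), then for every initialization w(1) there exists C > 0 such that ‖w(t) − (ln t)·ŵ‖ ≤ C for all t ≥ 1. -/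
open Filter Topology RealInnerProductSpace MeasureTheory

set_option linter.unusedVariables false

section Geometry

variable {E : Type*} [NormedAddCommGroup E] [InnerProductSpace ℝ E]

theorem sum_smul_unique_of_inner_eq_one {ι : Type*} {T : Finset ι} {x : ι → E} {a b : ι → ℝ}
    (ha : ∀ i ∈ T, ⟪∑ k ∈ T, a k • x k, x i⟫ = 1)
    (hb : ∀ i ∈ T, ⟪∑ k ∈ T, b k • x k, x i⟫ = 1) :
    ∑ k ∈ T, a k • x k = ∑ k ∈ T, b k • x k := by
  set u := ∑ k ∈ T, a k • x k with hu
  set v := ∑ k ∈ T, b k • x k with hv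
  have h : ∀ i ∈ T, ⟪u - v, x i⟫ = 0 := fun i hi => by
    rw [inner_sub_left, ha i hi, hb i hi, sub_self]
  have hs : u - v = ∑ k ∈ T, (a k - b k) • x k := by
    simp only [hu, hv, sub_smul, Finset.sum_sub_distrib]
  have h0 : ⟪u - v, u - v⟫ = 0 := by
    nth_rewrite 2 [hs]
    rw [inner_sum]
    refine Finset.sum_eq_zero fun i hi => ?_
    rw [inner_smul_right, h i hi, mul_zero]
  exact sub_eq_zero.1 (inner_self_eq_zero.1 h0)

theorem measurableSet_exists_sum_smul_inner_eq_one {ι : Type*} [Fintype ι]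
    [FiniteDimensional ℝ E] [MeasurableSpace E] [BorelSpace E] (T : Finset ι) (j : ι) :
    MeasurableSet {x : ι → E | ∃ a : ι → ℝ,
      (∀ i ∈ T, ⟪∑ k ∈ T, a k • x k, x i⟫ = 1) ∧ ⟪∑ k ∈ T, a k • x k, x j⟫ = 1} := by
  have : ProperSpace E := FiniteDimensional.proper ℝ E
  have hcl : IsClosed {p : (ι → ℝ) × (ι → E) |
      (∀ i ∈ T, ⟪∑ k ∈ T, p.1 k • p.2 k, p.2 i⟫ = 1) ∧
        ⟪∑ k ∈ T, p.1 k • p.2 k, p.2 j⟫ = 1} := by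
    have hc : ∀ i, IsClosed {p : (ι → ℝ) × (ι → E) |
        ⟪∑ k ∈ T, p.1 k • p.2 k, p.2 i⟫ = 1} := fun i =>
      isClosed_eq (by fun_prop) continuous_const
    simp only [Set.ofPred_and, Set.ofPred_forall]
    exact (isClosed_iInter fun i => isClosed_iInter fun _ => hc i).inter (hc j)
  have hσ := (isSigmaCompact_univ.of_isClosed_subset hcl (Set.subset_univ _)).image
    (continuous_snd (X := ι → ℝ) (Y := ι → E))
  obtain ⟨K, hK, hU⟩ := hσ
  have hm : MeasurableSet (⋃ n, K n) := MeasurableSet.iUnion fun n => (hK n).measurableSet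
  rw [hU] at hm
  convert hm using 1
  ext x
  simp

theorem volume_inner_eq_one [FiniteDimensional ℝ E] [MeasurableSpace E] [BorelSpace E]
    {v : E} (hv : v ≠ 0) : volume {a : E | ⟪v, a⟫ = 1} = 0 := by
  have hne : ⟪v, v⟫ ≠ 0 := inner_self_ne_zero.2 hv
  set a₀ : E := (⟪v, v⟫)⁻¹ • v
  have h₀ : ⟪v, a₀⟫ = 1 := by rw [inner_smul_right, inv_mul_cancel₀ hne]
  have hker : LinearMap.ker (innerₛₗ ℝ v) ≠ ⊤ := fun h => by
    have : v ∈ LinearMap.ker (innerₛₗ ℝ v) := h ▸ Submodule.mem_top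
    exact hne (by simpa using this)
  have key := Measure.addHaar_affineSubspace (volume : Measure E)
    (AffineSubspace.mk' a₀ (LinearMap.ker (innerₛₗ ℝ v))) (fun h => hker (by
      rw [← AffineSubspace.direction_mk' a₀ (LinearMap.ker (innerₛₗ ℝ v)), h,
        AffineSubspace.direction_top]))
  refine measure_mono_null (fun a ha => ?_) key
  rw [SetLike.mem_coe, AffineSubspace.mem_mk', LinearMap.mem_ker, vsub_eq_sub, map_sub]
  simp only [innerₛₗ_apply_apply]
  rw [h₀, ha.out, sub_self]

theorem volume_exists_sum_smul_inner_eq_one [FiniteDimensional ℝ E] [MeasurableSpace E]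
    [BorelSpace E] {N : ℕ} (T : Finset (Fin N)) {j : Fin N} (hj : j ∉ T) :
    volume {x : Fin N → E | ∃ a : Fin N → ℝ,
      (∀ i ∈ T, ⟪∑ k ∈ T, a k • x k, x i⟫ = 1) ∧ ⟪∑ k ∈ T, a k • x k, x j⟫ = 1} = 0 := by
  obtain _ | n := N
  · exact j.elim0
  set A := {x : Fin (n + 1) → E | ∃ a : Fin (n + 1) → ℝ,
      (∀ i ∈ T, ⟪∑ k ∈ T, a k • x k, x i⟫ = 1) ∧ ⟪∑ k ∈ T, a k • x k, x j⟫ = 1} with hA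
  have hAm : MeasurableSet A := measurableSet_exists_sum_smul_inner_eq_one T j
  have hmp := (volume_preserving_piFinSuccAbove (fun _ : Fin (n + 1) => E) j).symm
  rw [← hmp.measure_preimage hAm.nullMeasurableSet]
  rw [Measure.volume_eq_prod, Measure.prod_apply_symm (hmp.measurable hAm)]
  refine (lintegral_congr fun y => ?_).trans lintegral_zero
  set S := (fun a : E => (a, y)) ⁻¹' ((MeasurableEquiv.piFinSuccAbove
    (fun _ : Fin (n + 1) => E) j).symm ⁻¹' A) with hS
  obtain hemp | ⟨a₀, b, hb, hbj⟩ := S.eq_empty_or_nonempty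
  · rw [hemp, measure_empty]
  have hz : ∀ i ∈ T, ∀ a : E, (MeasurableEquiv.piFinSuccAbove (fun _ : Fin (n + 1) => E) j).symm
      (a, y) i = (MeasurableEquiv.piFinSuccAbove (fun _ : Fin (n + 1) => E) j).symm (a₀, y) i := by
    intro i hi a
    obtain ⟨k, rfl⟩ := Fin.exists_succAbove_eq (ne_of_mem_of_not_mem hi hj)
    change Fin.insertNth (α := fun _ => E) j a y _ = Fin.insertNth (α := fun _ => E) j a₀ y _
    rw [Fin.insertNth_apply_succAbove, Fin.insertNth_apply_succAbove]
  have hzj : ∀ a : E, (MeasurableEquiv.piFinSuccAbove (fun _ : Fin (n + 1) => E) j).symm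
      (a, y) j = a := fun a => Fin.insertNth_apply_same (α := fun _ => E) j a y
  set z := (MeasurableEquiv.piFinSuccAbove (fun _ : Fin (n + 1) => E) j).symm (a₀, y) with hzdef
  have hv : ∑ k ∈ T, b k • z k ≠ 0 := fun h => by
    rw [h, inner_zero_left] at hbj
    exact zero_ne_one hbj
  refine measure_mono_null (fun a ha => ?_) (volume_inner_eq_one hv)
  obtain ⟨c, hc, hcj⟩ := ha
  have hsum : ∑ k ∈ T, c k • (MeasurableEquiv.piFinSuccAbove
      (fun _ : Fin (n + 1) => E) j).symm (a, y) k = ∑ k ∈ T, c k • z k :=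
    Finset.sum_congr rfl fun k hk => by rw [hz k hk]
  rw [hsum, hzj] at hcj
  rw [Set.mem_ofPred_eq, ← hcj]
  rw [sum_smul_unique_of_inner_eq_one hb fun i hi => ?_]
  have := hc i hi
  rwa [hsum, hz i hi] at this

/-- The max-margin vector is a positive combination of a linearly independent
family of points lying on the margin. -/
theorem exists_pos_sum_smul_of_max_margin [FiniteDimensional ℝ E] {N : ℕ} (hN : 1 ≤ N)
    {x : Fin N → E} {v : E} (hv : ∀ i, 1 ≤ ⟪v, x i⟫)
    (hmin : ∀ u : E, (∀ i, 1 ≤ ⟪u, x i⟫) → ‖v‖ ≤ ‖u‖) :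
    ∃ (T : Finset (Fin N)) (a : Fin N → ℝ), (∀ i ∈ T, 0 < a i) ∧ (∀ i ∉ T, a i = 0) ∧
      (∀ i ∈ T, ⟪v, x i⟫ = 1) ∧ v = ∑ i ∈ T, a i • x i ∧
      LinearIndependent ℝ (fun i : T => x i) := by
  have : ProperSpace E := FiniteDimensional.proper ℝ E
  have : Nonempty (Fin N) := ⟨⟨0, hN⟩⟩
  set K := convexHull ℝ (Set.range x) with hK
  have hKx : ∀ i, x i ∈ K := fun i => subset_convexHull ℝ _ ⟨i, rfl⟩
  have hKv : ∀ y ∈ K, 1 ≤ ⟪v, y⟫ := by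
    have hconv : Convex ℝ {y | 1 ≤ ⟪v, y⟫} :=
      convex_halfSpace_ge (IsLinearMap.mk (fun _ _ => inner_add_right _ _ _)
        (fun _ _ => inner_smul_right _ _ _)) 1
    exact convexHull_min (by rintro _ ⟨i, rfl⟩; exact hv i) hconv
  have hKne : K.Nonempty := ⟨_, hKx (Classical.arbitrary _)⟩
  have hKc : IsCompact K := (Set.finite_range x).isCompact_convexHull ℝ
  obtain ⟨p, hpK, hp⟩ := exists_norm_eq_iInf_of_complete_convex hKne hKc.isComplete
    (convex_convexHull ℝ _) 0
  rw [norm_eq_iInf_iff_real_inner_le_zero (convex_convexHull ℝ _) hpK] at hp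
  have hp' : ∀ y ∈ K, ‖p‖ ^ 2 ≤ ⟪p, y⟫ := fun y hy => by
    have := hp y hy
    rw [zero_sub, inner_neg_left, inner_sub_right, real_inner_self_eq_norm_sq] at this
    linarith
  have hp0 : p ≠ 0 := fun h => by
    have := hKv p hpK
    rw [h, inner_zero_right] at this
    linarith
  have hpn : 0 < ‖p‖ := norm_pos_iff.2 hp0
  have hle : ‖v‖ ≤ ‖p‖⁻¹ := by
    refine (hmin ((‖p‖ ^ 2)⁻¹ • p) fun i => ?_).trans (le_of_eq ?_)
    · rw [real_inner_smul_left, ← div_eq_inv_mul, le_div_iff₀ (by positivity), one_mul]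
      exact hp' _ (hKx i)
    · rw [norm_smul, norm_inv, norm_pow, norm_norm]
      field_simp
  have hle' : ‖v‖ * ‖p‖ ≤ 1 := by
    calc ‖v‖ * ‖p‖ ≤ ‖p‖⁻¹ * ‖p‖ := by gcongr
      _ = 1 := inv_mul_cancel₀ hpn.ne'
  have h1 := hKv p hpK
  have h2 := real_inner_le_norm v p
  have hvp : ⟪v, p⟫ = 1 := by linarith
  have hmul : ‖v‖ * ‖p‖ = 1 := by linarith
  have hvn : ‖v‖ = ‖p‖⁻¹ := eq_inv_of_mul_eq_one_left hmul
  have heq : ‖p‖ • v = ‖v‖ • p := inner_eq_norm_mul_iff_real.1 (by rw [hvp, hmul])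
  have hveq : v = (‖p‖ ^ 2)⁻¹ • p := by
    rw [hvn] at heq
    rw [pow_two, mul_inv, mul_smul, ← heq, smul_smul, inv_mul_cancel₀ hpn.ne', one_smul]
  obtain ⟨ι, hι, z, c, hz, hind, hc, hc1, hcz⟩ := eq_pos_convex_span_of_mem_convexHull hpK
  choose g hg using fun k => hz ⟨k, rfl⟩
  have hginj : Function.Injective g := fun k l h => hind.injective (by rw [← hg k, ← hg l, h])
  have hz1 : ∀ k, ⟪v, z k⟫ = 1 := by
    have hnn : ∀ k ∈ Finset.univ, 0 ≤ c k * (⟪v, z k⟫ - 1) := fun k _ =>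
      mul_nonneg (hc k).le (sub_nonneg.2 (by rw [← hg k]; exact hv _))
    have hs : ∑ k, c k * (⟪v, z k⟫ - 1) = 0 := by
      have : ∑ k, c k * ⟪v, z k⟫ = 1 := by
        rw [← hvp, ← hcz, inner_sum]
        simp only [inner_smul_right]
      simp only [mul_sub, Finset.sum_sub_distrib, mul_one, this, hc1, sub_self]
    intro k
    have := (Finset.sum_eq_zero_iff_of_nonneg hnn).1 hs k (Finset.mem_univ k)
    rcases mul_eq_zero.1 this with h | h
    · exact absurd h (hc k).ne'
    · linarith
  classical
  refine ⟨Finset.univ.image g,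
    fun i => ∑ k, if g k = i then (‖p‖ ^ 2)⁻¹ * c k else 0, ?_, ?_, ?_, ?_, ?_⟩
  · intro i hi
    obtain ⟨k, -, rfl⟩ := Finset.mem_image.1 hi
    simp only [hginj.eq_iff, Finset.sum_ite_eq', Finset.mem_univ, if_true]
    have := hc k
    positivity
  · intro i hi
    refine Finset.sum_eq_zero fun k _ => if_neg fun h => hi ?_
    exact Finset.mem_image.2 ⟨k, Finset.mem_univ k, h⟩
  · intro i hi
    obtain ⟨k, -, rfl⟩ := Finset.mem_image.1 hi
    rw [hg k]
    exact hz1 k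
  · rw [Finset.sum_image fun k _ l _ h => hginj h]
    simp only [hginj.eq_iff, Finset.sum_ite_eq', Finset.mem_univ, if_true]
    simp only [mul_smul, hg, ← Finset.smul_sum]
    rw [hcz, ← hveq]
  · have hzind : LinearIndependent ℝ z := by
      rw [Fintype.linearIndependent_iff]
      intro q hq
      have hq0 : ∑ k, q k = 0 := by
        have := congrArg (fun y => ⟪v, y⟫) hq
        simpa only [inner_sum, inner_smul_right, hz1, mul_one, inner_zero_right] using this
      intro k
      exact affineIndependent_iff.1 hind Finset.univ q hq0 hq k (Finset.mem_univ k)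
    have hmem : ∀ i : (Finset.univ.image g : Finset (Fin N)), ∃ k, g k = i := fun i => by
      obtain ⟨k, -, hk⟩ := Finset.mem_image.1 i.2
      exact ⟨k, hk⟩
    choose h hh using hmem
    have hhinj : Function.Injective h := fun i j hij => Subtype.ext (by rw [← hh i, ← hh j, hij])
    have := hzind.comp h hhinj
    convert this using 1
    ext1 i
    rw [Function.comp_apply, ← hg, hh]

theorem LinearIndependent.exists_inner_eq [FiniteDimensional ℝ E] {ι : Type*} {x : ι → E}
    (h : LinearIndependent ℝ x) (b : ι → ℝ) : ∃ v : E, ∀ i, ⟪v, x i⟫ = b i := by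
  have : CompleteSpace E := FiniteDimensional.complete ℝ E
  obtain ⟨f, hf⟩ := LinearMap.exists_extend ((Module.Basis.span h).constr ℝ b)
  refine ⟨(InnerProductSpace.toDual ℝ E).symm (LinearMap.toContinuousLinearMap f), fun i => ?_⟩
  rw [InnerProductSpace.toDual_symm_apply, LinearMap.coe_toContinuousLinearMap']
  have := congrArg (fun φ => φ (Module.Basis.span h i)) hf
  rw [Module.Basis.constr_basis] at this
  simpa [Module.Basis.span_apply] using this

/-- For almost every dataset, the max-margin vector has strictly positive dual
coefficients on its support vectors, and inner products with the support vectors can be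
prescribed arbitrarily. -/
theorem ae_max_margin_nondegenerate [FiniteDimensional ℝ E] [MeasurableSpace E]
    [BorelSpace E] {N : ℕ} (hN : 1 ≤ N) :
    ∀ᵐ x : Fin N → E ∂volume, ∀ v : E, (∀ i, 1 ≤ ⟪v, x i⟫) →
      (∀ u : E, (∀ i, 1 ≤ ⟪u, x i⟫) → ‖v‖ ≤ ‖u‖) →
      ∃ a : Fin N → ℝ, v = ∑ i, a i • x i ∧
        (∀ i, (0 < a i ∧ ⟪v, x i⟫ = 1) ∨ (a i = 0 ∧ 1 < ⟪v, x i⟫)) ∧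
        ∀ b : Fin N → ℝ, ∃ u : E, ∀ i, 0 < a i → ⟪u, x i⟫ = b i := by
  have hae : ∀ᵐ x : Fin N → E ∂volume, ∀ (T : Finset (Fin N)) (j : Fin N), j ∉ T →
      ¬ ∃ a : Fin N → ℝ, (∀ i ∈ T, ⟪∑ k ∈ T, a k • x k, x i⟫ = 1) ∧
        ⟪∑ k ∈ T, a k • x k, x j⟫ = 1 := by
    rw [ae_all_iff]; intro T
    rw [ae_all_iff]; intro j
    by_cases hj : j ∈ T
    · exact Eventually.of_forall fun x h => absurd hj h
    · filter_upwards [measure_eq_zero_iff_ae_notMem.1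
        (volume_exists_sum_smul_inner_eq_one (E := E) T hj)] with x hx _
      exact hx
  filter_upwards [hae] with x hx v hv hmin
  obtain ⟨T, a, hpos, hzero, hT, hsum, hind⟩ := exists_pos_sum_smul_of_max_margin hN hv hmin
  refine ⟨a, ?_, fun i => ?_, fun b => ?_⟩
  · rw [hsum]
    exact Finset.sum_subset (Finset.subset_univ T) fun i _ hi => by rw [hzero i hi, zero_smul]
  · by_cases hi : i ∈ T
    · exact Or.inl ⟨hpos i hi, hT i hi⟩
    · refine Or.inr ⟨hzero i hi, lt_of_le_of_ne (hv i) fun h => hx T i hi ⟨a, ?_, ?_⟩⟩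
      · rw [← hsum]; exact hT
      · rw [← hsum]; exact h.symm
  · obtain ⟨u, hu⟩ := hind.exists_inner_eq (fun i : T => b i)
    refine ⟨u, fun i hi => hu ⟨i, ?_⟩⟩
    by_contra h
    exact hi.ne' (hzero i h)

end Geometry

section Scalar

/-- Uniform comparison of an exponentially tailed positive function with `exp (-s)`. -/
theorem exists_exp_tail_bounds {φ : ℝ → ℝ} (hc : Continuous φ) (hpos : ∀ s, 0 < φ s)
    {μp μm xp xm : ℝ} (hμp : 0 < μp) (hμm : 0 < μm)
    (hp : ∀ s, xp < s → φ s ≤ (1 + Real.exp (-μp * s)) * Real.exp (-s))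
    (hm : ∀ s, xm < s → (1 - Real.exp (-μm * s)) * Real.exp (-s) ≤ φ s) (s₀ : ℝ) :
    ∃ κ K μ : ℝ, 0 < κ ∧ 0 < K ∧ 0 < μ ∧ ∀ s, s₀ ≤ s →
      κ ≤ φ s * Real.exp s ∧ φ s * Real.exp s ≤ K ∧
        |φ s * Real.exp s - 1| ≤ K * Real.exp (-μ * s) := by
  set μ := min μp μm with hμ
  have hμ0 : 0 < μ := lt_min hμp hμm
  set B := max 0 (max xp xm) + 1 / μ + 1 with hB
  have hB0 : 0 ≤ max 0 (max xp xm) := le_max_left _ _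
  have hμi : 0 < 1 / μ := by positivity
  have hBp : xp < B := by
    have := (le_max_left xp xm).trans (le_max_right 0 (max xp xm))
    linarith
  have hBm : xm < B := by
    have := (le_max_right xp xm).trans (le_max_right 0 (max xp xm))
    linarith
  have hψpos : ∀ s, 0 < φ s * Real.exp s := fun s => mul_pos (hpos s) (Real.exp_pos s)
  have hψc : Continuous fun s => φ s * Real.exp s := hc.mul Real.continuous_exp
  obtain ⟨C₁, hC₁⟩ := (isCompact_Icc (a := s₀) (b := B)).exists_bound_of_continuousOn
    (f := fun s => (φ s * Real.exp s)⁻¹)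
    (hψc.inv₀ fun s => (hψpos s).ne').continuousOn
  obtain ⟨C₂, hC₂⟩ := (isCompact_Icc (a := s₀) (b := B)).exists_bound_of_continuousOn
    (f := fun s => φ s * Real.exp s) hψc.continuousOn
  obtain ⟨C₃, hC₃⟩ := (isCompact_Icc (a := s₀) (b := B)).exists_bound_of_continuousOn
    (f := fun s => (φ s * Real.exp s - 1) * Real.exp (μ * s))
    (by fun_prop : Continuous fun s => (φ s * Real.exp s - 1) * Real.exp (μ * s)).continuousOn
  refine ⟨min (1 / 2) (max C₁ 1)⁻¹, max 2 (max C₂ C₃), μ, by positivity, by positivity, hμ0,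
    fun s hs => ?_⟩
  rcases le_or_gt s B with hsB | hsB
  · have h₁ := hC₁ s ⟨hs, hsB⟩
    have h₂ := hC₂ s ⟨hs, hsB⟩
    have h₃ := hC₃ s ⟨hs, hsB⟩
    rw [Real.norm_of_nonneg (inv_pos.2 (hψpos s)).le] at h₁
    rw [Real.norm_of_nonneg (hψpos s).le] at h₂
    rw [Real.norm_eq_abs, abs_mul, abs_of_pos (Real.exp_pos _)] at h₃
    refine ⟨(min_le_right _ _).trans ?_, h₂.trans ((le_max_left _ _).trans (le_max_right _ _)), ?_⟩
    · exact inv_le_of_inv_le₀ (hψpos s) (h₁.trans (le_max_left _ _))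
    · have : |φ s * Real.exp s - 1| =
          |φ s * Real.exp s - 1| * Real.exp (μ * s) * Real.exp (-μ * s) := by
        rw [mul_assoc, ← Real.exp_add, show μ * s + -μ * s = 0 by ring, Real.exp_zero, mul_one]
      rw [this]
      gcongr
      exact h₃.trans ((le_max_right _ _).trans (le_max_right _ _))
  · have hs0 : 0 ≤ s := by linarith
    have hμs : 1 ≤ μ * s := by
      have : μ * (1 / μ) ≤ μ * s := by
        apply mul_le_mul_of_nonneg_left _ hμ0.le
        linarith
      rwa [mul_one_div_cancel hμ0.ne'] at this
    have hcancel : Real.exp (-s) * Real.exp s = 1 := by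
      rw [← Real.exp_add, neg_add_cancel, Real.exp_zero]
    have hup : φ s * Real.exp s ≤ 1 + Real.exp (-μp * s) := by
      have := mul_le_mul_of_nonneg_right (hp s (by linarith)) (Real.exp_pos s).le
      rwa [mul_assoc, hcancel, mul_one] at this
    have hlo : 1 - Real.exp (-μm * s) ≤ φ s * Real.exp s := by
      have := mul_le_mul_of_nonneg_right (hm s (by linarith)) (Real.exp_pos s).le
      rwa [mul_assoc, hcancel, mul_one] at this
    have hep : Real.exp (-μp * s) ≤ Real.exp (-μ * s) := by
      have := min_le_left μp μm
      gcongr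
    have hem : Real.exp (-μm * s) ≤ Real.exp (-μ * s) := by
      have := min_le_right μp μm
      gcongr
    have hhalf : Real.exp (-μ * s) ≤ 1 / 2 := by
      have h2 : (2 : ℝ) ≤ Real.exp (μ * s) := by
        have := Real.add_one_le_exp (μ * s)
        linarith
      rw [neg_mul, Real.exp_neg, one_div]
      gcongr
    have h2K : (2 : ℝ) ≤ max 2 (max C₂ C₃) := le_max_left _ _
    have hepos := Real.exp_pos (-μ * s)
    refine ⟨(min_le_left _ _).trans (by linarith), by linarith, ?_⟩
    rw [abs_le]
    constructor <;> nlinarith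

theorem exp_neg_add_sub_one_mul_le (ρ ε : ℝ) :
    (Real.exp (-(ρ + ε)) - 1) * ρ ≤ ε ^ 2 * Real.exp |ε| := by
  have hR : 0 ≤ ε ^ 2 * Real.exp |ε| := by positivity
  have hone : 1 ≤ Real.exp |ε| := Real.one_le_exp (abs_nonneg ε)
  rcases le_total 0 ρ with hρ | hρ <;> rcases le_total 0 (ρ + ε) with h | h
  · refine (mul_nonpos_of_nonpos_of_nonneg ?_ hρ).trans hR
    rw [sub_nonpos, Real.exp_le_one_iff]
    linarith
  · have hε : |ε| = -ε := abs_of_nonpos (by linarith)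
    have h1 : Real.exp (-(ρ + ε)) ≤ Real.exp |ε| := by
      rw [hε]; gcongr; linarith
    have h2 : Real.exp |ε| - 1 ≤ |ε| * Real.exp |ε| := by
      have := Real.one_sub_le_exp_neg |ε|
      have h3 := mul_le_mul_of_nonneg_right this (Real.exp_pos |ε|).le
      rw [← Real.exp_add, neg_add_cancel, Real.exp_zero] at h3
      linarith
    calc (Real.exp (-(ρ + ε)) - 1) * ρ ≤ (|ε| * Real.exp |ε|) * ρ := by
          gcongr; linarith
      _ ≤ (|ε| * Real.exp |ε|) * |ε| := by
          gcongr; linarith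
      _ = ε ^ 2 * Real.exp |ε| := by rw [← sq_abs ε]; ring
  · have h1 := Real.one_sub_le_exp_neg (ρ + ε)
    have h4 : (Real.exp (-(ρ + ε)) - 1) * ρ ≤ (-(ρ + ε)) * ρ :=
      mul_le_mul_of_nonpos_right (by linarith) hρ
    nlinarith [sq_nonneg ε]
  · refine (mul_nonpos_of_nonneg_of_nonpos ?_ hρ).trans hR
    rw [sub_nonneg]
    exact Real.one_le_exp (by linarith)

theorem exists_margin_term_le {φ : ℝ → ℝ} {s₀ κ K μ : ℝ} (hκ : 0 < κ) (hK : 0 < K)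
    (h : ∀ s, s₀ ≤ s → κ ≤ φ s * Real.exp s ∧ φ s * Real.exp s ≤ K ∧
        |φ s * Real.exp s - 1| ≤ K * Real.exp (-μ * s)) (hμ : 0 < μ) (c D : ℝ) :
    ∃ C : ℝ, 0 ≤ C ∧ ∀ τ ρ ε : ℝ, 1 ≤ τ → |ε| ≤ D → s₀ ≤ ρ + Real.log τ + c + ε →
      (φ (ρ + Real.log τ + c + ε) * Real.exp c - 1 / τ) * ρ ≤
        C * (ε ^ 2 + τ ^ (-(1 + μ))) := by
  set M := max (Real.log K) (max (-Real.log κ) 0) + D with hM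
  have hMK : Real.log K ≤ M - D := by rw [hM, add_sub_cancel_right]; exact le_max_left _ _
  have hMκ : -Real.log κ ≤ M - D := by
    rw [hM, add_sub_cancel_right]; exact (le_max_left _ _).trans (le_max_right _ _)
  have hM0 : 0 ≤ M - D := by
    rw [hM, add_sub_cancel_right]; exact (le_max_right _ _).trans (le_max_right _ _)
  set C₁ := K * Real.exp (-μ * (c - M - D)) * Real.exp (M + D) * |M| with hC₁
  refine ⟨Real.exp D + C₁, by positivity, fun τ ρ ε hτ hε hs => ?_⟩
  have hτ0 : 0 < τ := by linarith
  set s := ρ + Real.log τ + c + ε with hsdef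
  obtain ⟨hlo, hup, hnear⟩ := h s hs
  set ψ := φ s * Real.exp s with hψ
  have hεD := abs_le.1 hε
  have hrew : φ s * Real.exp c - 1 / τ = 1 / τ * (ψ * Real.exp (-(ρ + ε)) - 1) := by
    have : φ s * Real.exp c = 1 / τ * (ψ * Real.exp (-(ρ + ε))) := by
      have h1 : Real.exp s * Real.exp (-(ρ + ε)) = τ * Real.exp c := by
        rw [← Real.exp_add, show s + -(ρ + ε) = Real.log τ + c by rw [hsdef]; ring, Real.exp_add,
          Real.exp_log hτ0]
      rw [hψ, mul_assoc, h1]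
      field_simp
    rw [this]; ring
  rw [hrew, mul_assoc]
  have hrhs : 0 ≤ (Real.exp D + C₁) * (ε ^ 2 + τ ^ (-(1 + μ))) := by positivity
  have hτi : 0 < 1 / τ := by positivity
  rcases lt_or_ge M |ρ| with hρ | hρ
  · refine (mul_nonpos_of_nonneg_of_nonpos hτi.le ?_).trans hrhs
    rcases le_total 0 ρ with h0 | h0
    · rw [abs_of_nonneg h0] at hρ
      refine mul_nonpos_of_nonpos_of_nonneg ?_ h0
      have : ψ * Real.exp (-(ρ + ε)) ≤ K * Real.exp (-Real.log K) := by
        gcongr; linarith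
      rw [Real.exp_neg (Real.log K), Real.exp_log hK, mul_inv_cancel₀ hK.ne'] at this
      linarith
    · rw [abs_of_nonpos h0] at hρ
      refine mul_nonpos_of_nonneg_of_nonpos ?_ h0
      have : κ * Real.exp (-Real.log κ) ≤ ψ * Real.exp (-(ρ + ε)) :=
        mul_le_mul hlo (Real.exp_le_exp.2 (by linarith)) (Real.exp_pos _).le (hκ.le.trans hlo)
      rw [Real.exp_neg (Real.log κ), Real.exp_log hκ, mul_inv_cancel₀ hκ.ne'] at this
      linarith
  · have hρM := abs_le.1 hρ
    have hsplit : (ψ * Real.exp (-(ρ + ε)) - 1) * ρ =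
        (Real.exp (-(ρ + ε)) - 1) * ρ + (ψ - 1) * Real.exp (-(ρ + ε)) * ρ := by ring
    rw [hsplit, mul_add]
    have hfst : 1 / τ * ((Real.exp (-(ρ + ε)) - 1) * ρ) ≤ Real.exp D * ε ^ 2 := by
      calc 1 / τ * ((Real.exp (-(ρ + ε)) - 1) * ρ) ≤ 1 / τ * (ε ^ 2 * Real.exp |ε|) := by
            exact mul_le_mul_of_nonneg_left (exp_neg_add_sub_one_mul_le ρ ε) hτi.le
        _ ≤ 1 * (ε ^ 2 * Real.exp D) := by
            gcongr
            rw [div_le_one hτ0]; exact hτ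
        _ = Real.exp D * ε ^ 2 := by ring
    have hexp : Real.exp (-μ * s) ≤ Real.exp (-μ * (c - M - D)) * τ ^ (-μ) := by
      rw [Real.rpow_def_of_pos hτ0, ← Real.exp_add]
      gcongr
      nlinarith
    have hsnd : 1 / τ * ((ψ - 1) * Real.exp (-(ρ + ε)) * ρ) ≤ C₁ * τ ^ (-(1 + μ)) := by
      calc 1 / τ * ((ψ - 1) * Real.exp (-(ρ + ε)) * ρ)
          ≤ 1 / τ * (|ψ - 1| * Real.exp (-(ρ + ε)) * |ρ|) := by
            refine mul_le_mul_of_nonneg_left ((le_abs_self _).trans (le_of_eq ?_)) hτi.le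
            rw [abs_mul, abs_mul, abs_of_pos (Real.exp_pos _)]
        _ ≤ 1 / τ * ((K * (Real.exp (-μ * (c - M - D)) * τ ^ (-μ))) * Real.exp (M + D) * |M|) := by
            have h5 : |ψ - 1| ≤ K * (Real.exp (-μ * (c - M - D)) * τ ^ (-μ)) :=
              hnear.trans (by gcongr)
            have h6 : |ρ| ≤ |M| := hρ.trans (le_abs_self M)
            have h7 : -(ρ + ε) ≤ M + D := by linarith
            gcongr
        _ = C₁ * τ ^ (-(1 + μ)) := by
            rw [neg_add, Real.rpow_add hτ0, Real.rpow_neg_one, hC₁]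
            ring
    have e1 : 0 ≤ Real.exp D * τ ^ (-(1 + μ)) := by positivity
    have e2 : 0 ≤ C₁ * ε ^ 2 := by positivity
    linarith

theorem nonmargin_term_le {φ : ℝ → ℝ} {s₀ K : ℝ} (hK : 0 < K) (hpos : ∀ s, 0 < φ s)
    (h : ∀ s, s₀ ≤ s → φ s * Real.exp s ≤ K) {θ c D τ ρ ε : ℝ} (hτ : 1 ≤ τ) (hε : |ε| ≤ D)
    (hs : s₀ ≤ ρ + θ * Real.log τ + c + ε) :
    φ (ρ + θ * Real.log τ + c + ε) * ρ ≤ K * Real.exp (D - c) * τ ^ (-θ) := by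
  have hτ0 : 0 < τ := by linarith
  set s := ρ + θ * Real.log τ + c + ε with hsdef
  have hεD := abs_le.1 hε
  rcases le_total ρ 0 with h0 | h0
  · exact (mul_nonpos_of_nonneg_of_nonpos (hpos s).le h0).trans (by positivity)
  have hφ : φ s ≤ K * Real.exp (-s) := by
    rw [Real.exp_neg, ← div_eq_mul_inv, le_div_iff₀ (Real.exp_pos s)]
    exact h s hs
  have hle : Real.exp (-s) ≤ Real.exp (D - c) * τ ^ (-θ) * Real.exp (-ρ) := by
    rw [Real.rpow_def_of_pos hτ0, ← Real.exp_add, ← Real.exp_add]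
    gcongr
    rw [hsdef]
    nlinarith
  have hρ : Real.exp (-ρ) * ρ ≤ 1 := by
    have := Real.add_one_le_exp ρ
    rw [Real.exp_neg, inv_mul_le_iff₀ (Real.exp_pos ρ)]
    linarith
  calc φ s * ρ ≤ (K * (Real.exp (D - c) * τ ^ (-θ) * Real.exp (-ρ))) * ρ := by
        gcongr
        exact hφ.trans (by gcongr)
    _ = K * Real.exp (D - c) * τ ^ (-θ) * (Real.exp (-ρ) * ρ) := by ring
    _ ≤ K * Real.exp (D - c) * τ ^ (-θ) * 1 := by gcongr
    _ = _ := mul_one _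

theorem bddAbove_of_le_one_add_mul_add {u p q : ℕ → ℝ} (hp : ∀ n, 0 ≤ p n) (hq : ∀ n, 0 ≤ q n)
    (hps : Summable p) (hqs : Summable q) (hu : ∀ n, 0 ≤ u n)
    (h : ∀ n, u (n + 1) ≤ (1 + p n) * u n + q n) : ∃ C, ∀ n, u n ≤ C := by
  have key : ∀ n, u n ≤
      Real.exp (∑ k ∈ Finset.range n, p k) * (u 0 + ∑ k ∈ Finset.range n, q k) := by
    intro n
    induction n with
    | zero => simp
    | succ n ih =>
      rw [Finset.sum_range_succ, Finset.sum_range_succ, Real.exp_add]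
      have h1 : 1 + p n ≤ Real.exp (p n) := by
        have := Real.add_one_le_exp (p n); linarith
      have h2 : 1 ≤ Real.exp (∑ k ∈ Finset.range n, p k) * Real.exp (p n) := by
        rw [← Real.exp_add]
        exact Real.one_le_exp (add_nonneg (Finset.sum_nonneg fun k _ => hp k) (hp n))
      calc u (n + 1) ≤ (1 + p n) * u n + q n := h n
        _ ≤ Real.exp (p n) * (Real.exp (∑ k ∈ Finset.range n, p k) *
              (u 0 + ∑ k ∈ Finset.range n, q k)) +
            (Real.exp (∑ k ∈ Finset.range n, p k) * Real.exp (p n)) * q n := by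
            have := hu n
            refine add_le_add (by gcongr) ?_
            nlinarith [hq n]
        _ = _ := by ring
  refine ⟨Real.exp (∑' k, p k) * (u 0 + ∑' k, q k), fun n => (key n).trans ?_⟩
  have h0 := hu 0
  have h1 : 0 ≤ ∑ k ∈ Finset.range n, q k := Finset.sum_nonneg fun k _ => hq k
  gcongr
  · exact hps.sum_le_tsum _ fun k _ => hp k
  · exact hqs.sum_le_tsum _ fun k _ => hq k

/-- Descent inequality for a function whose derivative is Lipschitz on a half line. -/
theorem le_add_mul_add_sq_of_lipschitz_deriv {f f' : ℝ → ℝ} (hf : ∀ s, HasDerivAt f (f' s) s)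
    {s₀ H : ℝ} (hH : ∀ a b, s₀ ≤ a → s₀ ≤ b → |f' a - f' b| ≤ H * |a - b|) {a b : ℝ}
    (ha : s₀ ≤ a) (hb : s₀ ≤ b) : f b ≤ f a + f' a * (b - a) + H / 2 * (b - a) ^ 2 := by
  set h : ℝ → ℝ := fun r => f r - f' a * (r - a) - H / 2 * (r - a) ^ 2 with hh
  have hd : ∀ r, HasDerivAt h (f' r - f' a - H * (r - a)) r := fun r => by
    have h1 := (hasDerivAt_id r).sub_const a
    have h2 := ((hf r).sub (h1.const_mul (f' a))).sub ((h1.pow 2).const_mul (H / 2))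
    refine HasDerivAt.congr_deriv h2 ?_
    simp only [id]
    push_cast
    ring
  have hcont : Continuous h := continuous_iff_continuousAt.2 fun r => (hd r).continuousAt
  have key : h b ≤ h a := by
    rcases le_total a b with hab | hab
    · refine antitoneOn_of_deriv_nonpos (convex_Ici a) hcont.continuousOn
        (fun r _ => (hd r).differentiableAt.differentiableWithinAt) (fun r hr => ?_)
        (Set.self_mem_Ici) hab hab
      rw [interior_Ici] at hr
      rw [(hd r).deriv]
      have hr' : a < r := hr
      have := (abs_le.1 (hH r a (by linarith) ha)).2
      rw [abs_of_pos (sub_pos.2 hr')] at this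
      linarith
    · refine monotoneOn_of_deriv_nonneg (convex_Icc s₀ a) hcont.continuousOn
        (fun r _ => (hd r).differentiableAt.differentiableWithinAt) (fun r hr => ?_)
        ⟨hb, hab⟩ ⟨ha, le_rfl⟩ hab
      rw [interior_Icc] at hr
      rw [(hd r).deriv]
      have := (abs_le.1 (hH r a hr.1.le ha)).1
      rw [abs_of_neg (sub_neg.2 hr.2)] at this
      linarith
  simp only [hh] at key
  rw [sub_self] at key
  linarith

/-- A decreasing positive function with Lipschitz derivative on `[s₀, ∞)` can be replaced
left of `s₀` so that the descent inequality holds globally. -/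
theorem exists_extension_with_descent {f f' : ℝ → ℝ} (hf : ∀ s, HasDerivAt f (f' s) s)
    (hpos : ∀ s, 0 < f s) (hneg : ∀ s, f' s < 0) {s₀ H : ℝ} (hH0 : 0 ≤ H)
    (hH : ∀ a b, s₀ ≤ a → s₀ ≤ b → |f' a - f' b| ≤ H * |a - b|) :
    ∃ F : ℝ → ℝ, (∀ s, s₀ ≤ s → F s = f s) ∧ (∀ s, s < s₀ → f s₀ < F s) ∧ (∀ s, 0 < F s) ∧
      ∀ a b, s₀ ≤ a → F b ≤ f a + f' a * (b - a) + H / 2 * (b - a) ^ 2 := by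
  refine ⟨fun s => if s < s₀ then f s₀ + f' s₀ * (s - s₀) else f s, fun s hs => ?_,
    fun s hs => ?_, fun s => ?_, fun a b ha => ?_⟩
  · exact if_neg hs.not_gt
  · simp only [if_pos hs]
    nlinarith [hneg s₀]
  · dsimp only
    split_ifs with hs
    · nlinarith [hneg s₀, hpos s₀]
    · exact hpos s
  · dsimp only
    split_ifs with hb
    · have h1 := le_add_mul_add_sq_of_lipschitz_deriv hf hH ha le_rfl
      have h2 := (abs_le.1 (hH s₀ a le_rfl ha)).1
      rw [abs_of_nonpos (sub_nonpos.2 ha)] at h2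
      nlinarith [mul_nonneg hH0 (sq_nonneg (s₀ - b))]
    · exact le_add_mul_add_sq_of_lipschitz_deriv hf hH ha (not_lt.1 hb)

end Scalar

section Dynamics

variable {E : Type*} [NormedAddCommGroup E] [InnerProductSpace ℝ E]

theorem sum_inner_sq_le {ι : Type*} [Fintype ι] {x : ι → E} {σ : ℝ}
    (h : ∀ c : ι → ℝ, ‖∑ i, c i • x i‖ ≤ σ * Real.sqrt (∑ i, (c i) ^ 2)) (v : E) :
    ∑ i, ⟪v, x i⟫ ^ 2 ≤ σ ^ 2 * ‖v‖ ^ 2 := by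
  set S := ∑ i, ⟪v, x i⟫ ^ 2 with hS
  have hS0 : 0 ≤ S := Finset.sum_nonneg fun i _ => sq_nonneg _
  have h1 : S = ⟪v, ∑ i, ⟪v, x i⟫ • x i⟫ := by
    simp only [hS, inner_sum, inner_smul_right, pow_two]
  have h2 : S ≤ ‖v‖ * (σ * Real.sqrt S) := by
    nth_rewrite 1 [h1]
    exact (real_inner_le_norm _ _).trans
      (mul_le_mul_of_nonneg_left (h fun i => ⟪v, x i⟫) (norm_nonneg v))
  have h3 : Real.sqrt S * Real.sqrt S = S := Real.mul_self_sqrt hS0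
  rcases (Real.sqrt_nonneg S).eq_or_lt with h0 | h0
  · rw [← h3, ← h0, zero_mul]
    positivity
  · have h4 : Real.sqrt S ≤ σ * ‖v‖ := by
      refine le_of_mul_le_mul_right ?_ h0
      linarith
    rw [← h3, ← mul_pow, ← pow_two]
    gcongr

/-- Along gradient descent with momentum, the points stay in the region where the loss is
smooth, and the squared increments are summable. -/
theorem momentum_energy {N : ℕ} (hN : 1 ≤ N) {f f' : ℝ → ℝ} (hf : ∀ s, HasDerivAt f (f' s) s)
    (hpos : ∀ s, 0 < f s) (hneg : ∀ s, f' s < 0) {s₀ H : ℝ} (hH0 : 0 < H)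
    (hH : ∀ a b, s₀ ≤ a → s₀ ≤ b → |f' a - f' b| ≤ H * |a - b|) {x : Fin N → E} {σ : ℝ}
    (hσ0 : 0 < σ) (hσ : ∀ c : Fin N → ℝ, ‖∑ i, c i • x i‖ ≤ σ * Real.sqrt (∑ i, (c i) ^ 2))
    {η β : ℝ} (hη : 0 < η) (hβ0 : 0 ≤ β) (hβ1 : β < 1) (hηH : η < 2 * N / (σ ^ 2 * H))
    {w : ℕ → E} (hw : w 0 = w 1)
    (hrec : ∀ n, w (n + 2) - w (n + 1) = β • (w (n + 1) - w n) -
      (η * (1 - β)) • ((1 / (N : ℝ)) • ∑ i, f' ⟪w (n + 1), x i⟫ • x i))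
    (hs₀ : f s₀ = ∑ i, f ⟪w 1, x i⟫) :
    (∀ n i, s₀ ≤ ⟪w (n + 1), x i⟫) ∧ Summable fun n => ‖w (n + 1) - w n‖ ^ 2 := by
  obtain ⟨F, hFeq, hFlt, hFpos, hF⟩ := exists_extension_with_descent hf hpos hneg hH0.le hH
  have hN0 : (0 : ℝ) < N := by exact_mod_cast hN
  have h1β : 0 < 1 - β := sub_pos.2 hβ1
  set δ : ℕ → E := fun n => w (n + 1) - w n with hδ
  set A := H * σ ^ 2 / (2 * N) with hA
  set b := β / (2 * η * (1 - β)) with hb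
  set c := 1 / η - A with hc
  have hb0 : 0 ≤ b := by positivity
  have hc0 : 0 < c := by
    rw [hc, hA, sub_pos, lt_div_iff₀ hη, div_mul_eq_mul_div, div_lt_one (by positivity)]
    rw [lt_div_iff₀ (by positivity)] at hηH
    linarith
  have hanti : StrictAnti f := strictAnti_of_deriv_neg fun s => by rw [(hf s).deriv]; exact hneg s
  have hregion : ∀ v : E, (1 / (N : ℝ)) * ∑ i, F ⟪v, x i⟫ ≤ (1 / (N : ℝ)) * f s₀ →
      ∀ i, s₀ ≤ ⟪v, x i⟫ := by
    intro v hv i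
    have h1 : ∑ i, F ⟪v, x i⟫ ≤ f s₀ := le_of_mul_le_mul_left hv (by positivity)
    have h2 : F ⟪v, x i⟫ ≤ ∑ i, F ⟪v, x i⟫ :=
      Finset.single_le_sum (f := fun i => F ⟪v, x i⟫) (fun i _ => (hFpos _).le)
        (Finset.mem_univ i)
    by_contra! hlt
    exact absurd (hFlt _ hlt) (not_lt.2 (h2.trans h1))
  have hstep : ∀ u v : E, (∀ i, s₀ ≤ ⟪u, x i⟫) →
      (1 / (N : ℝ)) * ∑ i, F ⟪u + v, x i⟫ ≤ (1 / (N : ℝ)) * ∑ i, f ⟪u, x i⟫ +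
        ⟪(1 / (N : ℝ)) • ∑ i, f' ⟪u, x i⟫ • x i, v⟫ + A * ‖v‖ ^ 2 := by
    intro u v hu
    have h1 : ∑ i, F ⟪u + v, x i⟫ ≤ ∑ i, (f ⟪u, x i⟫ + f' ⟪u, x i⟫ * ⟪v, x i⟫ +
        H / 2 * ⟪v, x i⟫ ^ 2) := Finset.sum_le_sum fun i _ => by
      have := hF ⟪u, x i⟫ ⟪u + v, x i⟫ (hu i)
      rwa [inner_add_left, add_sub_cancel_left, ← inner_add_left] at this
    rw [Finset.sum_add_distrib, Finset.sum_add_distrib, ← Finset.mul_sum] at h1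
    have h2 := sum_inner_sq_le hσ v
    have h3 : ⟪(1 / (N : ℝ)) • ∑ i, f' ⟪u, x i⟫ • x i, v⟫ =
        (1 / (N : ℝ)) * ∑ i, f' ⟪u, x i⟫ * ⟪v, x i⟫ := by
      rw [real_inner_smul_left, real_inner_comm v, inner_sum]
      simp only [inner_smul_right]
    have h4 : A * ‖v‖ ^ 2 = (1 / (N : ℝ)) * (H / 2 * (σ ^ 2 * ‖v‖ ^ 2)) := by
      rw [hA]; field_simp
    rw [h3, h4, ← mul_add, ← mul_add]
    gcongr
    refine h1.trans ?_
    gcongr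
  have hinner : ∀ n, ⟪(1 / (N : ℝ)) • ∑ i, f' ⟪w (n + 1), x i⟫ • x i, δ (n + 1)⟫ ≤
      b * ‖δ n‖ ^ 2 - (b + c + A) * ‖δ (n + 1)‖ ^ 2 := by
    intro n
    set g := (1 / (N : ℝ)) • ∑ i, f' ⟪w (n + 1), x i⟫ • x i with hg
    have hr : (η * (1 - β)) • g = β • δ n - δ (n + 1) := by
      rw [hδ]; simp only []; rw [hrec n]; abel
    have h1 : η * (1 - β) * ⟪g, δ (n + 1)⟫ = β * ⟪δ n, δ (n + 1)⟫ - ‖δ (n + 1)‖ ^ 2 := by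
      rw [← real_inner_smul_left, hr, inner_sub_left, real_inner_smul_left,
        real_inner_self_eq_norm_sq]
    have h2 : ⟪δ n, δ (n + 1)⟫ ≤ (‖δ n‖ ^ 2 + ‖δ (n + 1)‖ ^ 2) / 2 := by
      have := real_inner_le_norm (δ n) (δ (n + 1))
      nlinarith [sq_nonneg (‖δ n‖ - ‖δ (n + 1)‖)]
    have hk : 0 < η * (1 - β) := by positivity
    refine le_of_mul_le_mul_left ?_ hk
    rw [h1]
    have h3 : η * (1 - β) * b = β / 2 := by rw [hb]; field_simp
    have h4 : η * (1 - β) * (b + c + A) = β / 2 + (1 - β) := by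
      rw [hc, add_assoc, sub_add_cancel, mul_add, h3]; field_simp
    rw [mul_sub, ← mul_assoc, ← mul_assoc, h3, h4]
    nlinarith
  have key : ∀ n, (∀ i, s₀ ≤ ⟪w (n + 1), x i⟫) ∧
      (1 / (N : ℝ)) * ∑ i, f ⟪w (n + 1), x i⟫ + b * ‖δ n‖ ^ 2 +
        c * ∑ k ∈ Finset.range (n + 1), ‖δ k‖ ^ 2 ≤ (1 / (N : ℝ)) * f s₀ := by
    intro n
    induction n with
    | zero =>
      have hδ0 : δ 0 = 0 := by simp [hδ, hw]
      refine ⟨fun i => ?_, ?_⟩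
      · rw [← hanti.le_iff_ge, hs₀]
        exact Finset.single_le_sum (f := fun i => f ⟪w 1, x i⟫) (fun i _ => (hpos _).le)
          (Finset.mem_univ i)
      · simp [hδ0, hs₀]
    | succ n ih =>
      obtain ⟨hr, he⟩ := ih
      have h1 := hstep (w (n + 1)) (δ (n + 1)) hr
      have hadd : w (n + 1) + δ (n + 1) = w (n + 1 + 1) := by simp [hδ]
      rw [hadd] at h1
      have h2 := hinner n
      have h3 : (1 / (N : ℝ)) * ∑ i, F ⟪w (n + 1 + 1), x i⟫ + b * ‖δ (n + 1)‖ ^ 2 +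
          c * ∑ k ∈ Finset.range (n + 1 + 1), ‖δ k‖ ^ 2 ≤ (1 / (N : ℝ)) * f s₀ := by
        rw [Finset.sum_range_succ]
        linarith
      have hr' : ∀ i, s₀ ≤ ⟪w (n + 1 + 1), x i⟫ := by
        refine hregion _ (le_trans ?_ h3)
        have h5 : 0 ≤ ∑ k ∈ Finset.range (n + 1 + 1), ‖δ k‖ ^ 2 :=
          Finset.sum_nonneg fun k _ => sq_nonneg _
        have h6 : 0 ≤ c * ∑ k ∈ Finset.range (n + 1 + 1), ‖δ k‖ ^ 2 := by positivity
        have h7 : 0 ≤ b * ‖δ (n + 1)‖ ^ 2 := by positivity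
        linarith
      refine ⟨hr', ?_⟩
      have : ∑ i, F ⟪w (n + 1 + 1), x i⟫ = ∑ i, f ⟪w (n + 1 + 1), x i⟫ :=
        Finset.sum_congr rfl fun i _ => hFeq _ (hr' i)
      rwa [this] at h3
  refine ⟨fun n => (key n).1, summable_of_sum_range_le (c := (1 / (N : ℝ)) * f s₀ / c)
    (fun n => sq_nonneg _) fun n => ?_⟩
  rw [le_div_iff₀ hc0, mul_comm]
  have h1 := (key n).2
  have h2 : 0 ≤ ∑ i, f ⟪w (n + 1), x i⟫ := Finset.sum_nonneg fun i _ => (hpos _).le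
  have h3 : 0 ≤ (1 / (N : ℝ)) * ∑ i, f ⟪w (n + 1), x i⟫ := by positivity
  have h4 : 0 ≤ b * ‖δ n‖ ^ 2 := by positivity
  have h5 : 0 ≤ c * ‖δ n‖ ^ 2 := by positivity
  rw [Finset.sum_range_succ, mul_add] at h1
  change c * ∑ k ∈ Finset.range n, ‖δ k‖ ^ 2 ≤ _
  linarith

theorem log_succ_sub_log_bounds (n : ℕ) :
    0 ≤ Real.log (n + 2) - Real.log (n + 1) ∧
      Real.log (n + 2) - Real.log (n + 1) ≤ 1 / (n + 1) ∧
      1 / ((n : ℝ) + 1) - (Real.log (n + 2) - Real.log (n + 1)) ≤ 1 / ((n : ℝ) + 1) ^ 2 := by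
  have h1 : (0 : ℝ) < n + 1 := by positivity
  have h2 : (0 : ℝ) < n + 2 := by positivity
  rw [← Real.log_div h2.ne' h1.ne']
  have hq : (0 : ℝ) < (n + 2) / (n + 1) := by positivity
  refine ⟨Real.log_nonneg ?_, ?_, ?_⟩
  · rw [one_le_div h1]; linarith
  · refine (Real.log_le_sub_one_of_pos hq).trans (le_of_eq ?_)
    field_simp
    ring
  · have h3 := Real.one_sub_inv_le_log_of_pos hq
    have h4 : 1 / ((n : ℝ) + 1) - (1 - (((n : ℝ) + 2) / (n + 1))⁻¹) ≤ 1 / ((n : ℝ) + 1) ^ 2 := by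
      have : 1 / ((n : ℝ) + 1) - (1 - (((n : ℝ) + 2) / (n + 1))⁻¹) = 1 / (((n : ℝ) + 1) * (n + 2)) := by
        field_simp
        ring
      rw [this, pow_two]
      gcongr
      linarith
    linarith

theorem summable_one_div_succ_rpow {p : ℝ} (hp : 1 < p) :
    Summable fun n : ℕ => ((n : ℝ) + 1) ^ (-p) := by
  have := (summable_nat_add_iff 1).2 (Real.summable_nat_rpow.2 (by linarith : -p < -1))
  simpa using this

/-- The averaged momentum iterates stay within bounded distance of `log t • v + u`. -/
theorem momentum_residual_bounded {N : ℕ} (hN : 1 ≤ N) {φ : ℝ → ℝ} (hpos : ∀ s, 0 < φ s)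
    {s₀ κ K μ : ℝ} (hκ : 0 < κ) (hK : 0 < K) (hμ : 0 < μ)
    (hφ : ∀ s, s₀ ≤ s → κ ≤ φ s * Real.exp s ∧ φ s * Real.exp s ≤ K ∧
        |φ s * Real.exp s - 1| ≤ K * Real.exp (-μ * s))
    {x : Fin N → E} {v u : E} {a : Fin N → ℝ} (hv : v = ∑ i, a i • x i) {η : ℝ} (hη : 0 < η)
    (ha : ∀ i, (0 < a i ∧ ⟪v, x i⟫ = 1) ∨ (a i = 0 ∧ 1 < ⟪v, x i⟫))
    (hu : ∀ i, 0 < a i → η / N * Real.exp (-⟪u, x i⟫) = a i)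
    {R d g : ℕ → E} (hd : Summable fun n => ‖d n‖ ^ 2) (hg : Summable fun n => ‖g n‖ ^ 2)
    (hgdef : ∀ n, g n = (η / N) • ∑ i, φ ⟪R n + Real.log (n + 1) • v + u + d n, x i⟫ • x i)
    (hregion : ∀ n i, s₀ ≤ ⟪R n + Real.log (n + 1) • v + u + d n, x i⟫)
    (hR : ∀ n, R (n + 1) = R n + g n - (Real.log (n + 2) - Real.log (n + 1)) • v) :
    ∃ C, ∀ n, ‖R n‖ ≤ C := by
  have hN0 : (0 : ℝ) < N := by exact_mod_cast hN
  have hexp : ∀ n i, ⟪R n + Real.log (n + 1) • v + u + d n, x i⟫ =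
      ⟪R n, x i⟫ + ⟪v, x i⟫ * Real.log (n + 1) + ⟪u, x i⟫ + ⟪d n, x i⟫ := fun n i => by
    rw [inner_add_left, inner_add_left, inner_add_left, real_inner_smul_left]; ring
  obtain ⟨D₀, hD₀⟩ : ∃ D₀, ∀ n, ‖d n‖ ≤ D₀ :=
    ⟨Real.sqrt (∑' n, ‖d n‖ ^ 2), fun n =>
      Real.le_sqrt_of_sq_le (hd.le_tsum n fun k _ => sq_nonneg _)⟩
  have hεD : ∀ n i, |⟪d n, x i⟫| ≤ D₀ * ‖x i‖ := fun n i =>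
    (abs_real_inner_le_norm _ _).trans (mul_le_mul_of_nonneg_right (hD₀ n) (norm_nonneg _))
  have hone : ∀ n : ℕ, (1 : ℝ) ≤ n + 1 := fun n => by
    have : (0 : ℝ) ≤ n := n.cast_nonneg
    linarith
  have hterm : ∀ i, ∃ b : ℕ → ℝ, (∀ n, 0 ≤ b n) ∧ Summable b ∧ ∀ n,
      (η / N * φ ⟪R n + Real.log (n + 1) • v + u + d n, x i⟫ - a i / (n + 1)) * ⟪R n, x i⟫ ≤
        b n := by
    intro i
    rcases ha i with ⟨hai, hvi⟩ | ⟨hai, hvi⟩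
    · obtain ⟨C, hC0, hC⟩ := exists_margin_term_le hκ hK hφ hμ ⟪u, x i⟫ (D₀ * ‖x i‖)
      refine ⟨fun n => a i * (C * (‖d n‖ ^ 2 * ‖x i‖ ^ 2 + ((n : ℝ) + 1) ^ (-(1 + μ)))),
        fun n => by positivity, ?_, fun n => ?_⟩
      · exact (((hd.mul_right _).add (summable_one_div_succ_rpow (by linarith))).mul_left
          C).mul_left (a i)
      · have hr := hregion n i
        rw [hexp n i, hvi, one_mul] at hr ⊢
        have h1 := hC (n + 1) ⟪R n, x i⟫ ⟪d n, x i⟫ (hone n) (hεD n i) hr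
        set s := ⟪R n, x i⟫ + Real.log (n + 1) + ⟪u, x i⟫ + ⟪d n, x i⟫
        have h2 : η / N * φ s - a i / (n + 1) =
            a i * (φ s * Real.exp ⟪u, x i⟫ - 1 / (n + 1)) := by
          have h3 : η / N = a i * Real.exp ⟪u, x i⟫ := by
            rw [← hu i hai, mul_assoc, ← Real.exp_add, neg_add_cancel, Real.exp_zero, mul_one]
          rw [h3]; ring
        have h4 : ⟪d n, x i⟫ ^ 2 ≤ ‖d n‖ ^ 2 * ‖x i‖ ^ 2 := by
          rw [← mul_pow, ← sq_abs ⟪d n, x i⟫]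
          exact pow_le_pow_left₀ (abs_nonneg _) (abs_real_inner_le_norm _ _) 2
        rw [h2, mul_assoc]
        refine mul_le_mul_of_nonneg_left (h1.trans ?_) hai.le
        gcongr
    · refine ⟨fun n => η / N * (K * Real.exp (D₀ * ‖x i‖ - ⟪u, x i⟫) *
        ((n : ℝ) + 1) ^ (-⟪v, x i⟫)), fun n => by positivity, ?_, fun n => ?_⟩
      · exact ((summable_one_div_succ_rpow hvi).mul_left _).mul_left _
      · have hr := hregion n i
        rw [hexp n i] at hr ⊢
        rw [hai, zero_div, sub_zero, mul_assoc]
        exact mul_le_mul_of_nonneg_left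
          (nonmargin_term_le hK hpos (fun s hs => (hφ s hs).2.1) (hone n) (hεD n i) hr)
          (by positivity)
  choose b hb0 hbs hb using hterm
  set p : ℕ → ℝ := fun n => 1 / ((n : ℝ) + 1) ^ 2 with hp
  have hp0 : ∀ n, 0 ≤ p n := fun n => by positivity
  have hps : Summable p := by
    have := (summable_nat_add_iff 1).2 (Real.summable_one_div_nat_pow.2 (by norm_num : 1 < 2))
    simpa [hp] using this
  have hbound := bddAbove_of_le_one_add_mul_add (u := fun n => ‖R n‖ ^ 2)
    (p := fun n => 2 * ‖v‖ * p n)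
    (q := fun n => 2 * ∑ i, b i n + 2 * ‖v‖ * p n + (2 * ‖g n‖ ^ 2 + 2 * ‖v‖ ^ 2 * p n))
    (fun n => mul_nonneg (by positivity) (hp0 n))
    (fun n => by
      have h1 : 0 ≤ ∑ i, b i n := Finset.sum_nonneg fun i _ => hb0 i n
      have h2 := hp0 n
      positivity)
    (hps.mul_left _)
    ((((summable_sum fun i _ => hbs i).mul_left 2).add (hps.mul_left _)).add
      ((hg.mul_left 2).add (hps.mul_left _)))
    (fun n => sq_nonneg _)
    (fun n => by
      obtain ⟨hl0, hl1, hl2⟩ := log_succ_sub_log_bounds n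
      set l := Real.log (n + 2) - Real.log (n + 1)
      have hsq : ‖R (n + 1)‖ ^ 2 = ‖R n‖ ^ 2 + 2 * ⟪R n, g n - l • v⟫ + ‖g n - l • v‖ ^ 2 := by
        rw [hR n, add_sub_assoc, norm_add_sq_real]
      have hin : ⟪R n, g n - l • v⟫ ≤ ∑ i, b i n + p n * (‖R n‖ * ‖v‖) := by
        have h1 : ⟪R n, g n⟫ =
            ∑ i, η / N * φ ⟪R n + Real.log (n + 1) • v + u + d n, x i⟫ * ⟪R n, x i⟫ := by
          rw [hgdef n, inner_smul_right, inner_sum, Finset.mul_sum]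
          simp only [inner_smul_right, mul_assoc]
        have h2 : ⟪R n, v⟫ = ∑ i, a i * ⟪R n, x i⟫ := by
          rw [hv, inner_sum]
          simp only [inner_smul_right]
        have h3 : ⟪R n, g n - l • v⟫ =
            ∑ i, (η / N * φ ⟪R n + Real.log (n + 1) • v + u + d n, x i⟫ - a i / (n + 1)) *
              ⟪R n, x i⟫ + (1 / ((n : ℝ) + 1) - l) * ⟪R n, v⟫ := by
          rw [inner_sub_right, inner_smul_right, h1]
          simp only [sub_mul, Finset.sum_sub_distrib]
          have h4 : ∑ i, a i / ((n : ℝ) + 1) * ⟪R n, x i⟫ = 1 / ((n : ℝ) + 1) * ⟪R n, v⟫ := by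
            rw [h2, Finset.mul_sum]
            exact Finset.sum_congr rfl fun i _ => by ring
          rw [h4]; ring
        rw [h3]
        refine add_le_add (Finset.sum_le_sum fun i _ => hb i n) ?_
        calc (1 / ((n : ℝ) + 1) - l) * ⟪R n, v⟫ ≤ (1 / ((n : ℝ) + 1) - l) * (‖R n‖ * ‖v‖) :=
              mul_le_mul_of_nonneg_left (real_inner_le_norm _ _) (sub_nonneg.2 hl1)
          _ ≤ p n * (‖R n‖ * ‖v‖) := mul_le_mul_of_nonneg_right hl2 (by positivity)
      have hnorm : ‖g n - l • v‖ ^ 2 ≤ 2 * ‖g n‖ ^ 2 + 2 * ‖v‖ ^ 2 * p n := by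
        have h1 : ‖g n - l • v‖ ≤ ‖g n‖ + 1 / ((n : ℝ) + 1) * ‖v‖ := by
          refine (norm_sub_le _ _).trans ?_
          rw [norm_smul, Real.norm_of_nonneg hl0]
          gcongr
        have h2 : (1 / ((n : ℝ) + 1) * ‖v‖) ^ 2 = ‖v‖ ^ 2 * p n := by
          rw [hp, mul_pow, one_div_pow]; ring
        calc ‖g n - l • v‖ ^ 2 ≤ (‖g n‖ + 1 / ((n : ℝ) + 1) * ‖v‖) ^ 2 := by gcongr
          _ ≤ 2 * (‖g n‖ ^ 2 + (1 / ((n : ℝ) + 1) * ‖v‖) ^ 2) := add_sq_le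
          _ = _ := by rw [h2]; ring
      have hRle : ‖R n‖ ≤ 1 + ‖R n‖ ^ 2 := by nlinarith [sq_nonneg (‖R n‖ - 1)]
      have hpR : p n * (‖R n‖ * ‖v‖) ≤ p n * ((1 + ‖R n‖ ^ 2) * ‖v‖) := by
        have := hp0 n
        gcongr
      rw [hsq]
      linarith)
  obtain ⟨C, hC⟩ := hbound
  exact ⟨Real.sqrt C, fun n => Real.le_sqrt_of_sq_le (hC n)⟩

end Dynamics

theorem stmt1
    {d N : ℕ} (hN : 1 ≤ N)
    (ℓ ℓ' : ℝ → ℝ)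
    (hdiff : ∀ s : ℝ, HasDerivAt ℓ (ℓ' s) s)
    (hℓpos : ∀ s : ℝ, 0 < ℓ s) (hℓ'neg : ∀ s : ℝ, ℓ' s < 0)
    (hℓtop : Tendsto ℓ atTop (𝓝 0))
    (hℓ'top : Tendsto ℓ' atTop (𝓝 0))
    (hℓ'bot : Filter.limsup ℓ' atBot < 0)
    (μp μm xp xm : ℝ) (hμp : 0 < μp) (hμm : 0 < μm)
    (htailp : ∀ s : ℝ, xp < s → -ℓ' s ≤ (1 + Real.exp (-μp * s)) * Real.exp (-s))
    (htailm : ∀ s : ℝ, xm < s → (1 - Real.exp (-μm * s)) * Real.exp (-s) ≤ -ℓ' s)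
    (hloc : ∀ s : ℝ, ∃ H : ℝ, 0 < H ∧
      ∀ a b : ℝ, s ≤ a → s ≤ b → |ℓ' a - ℓ' b| ≤ H * |a - b|)
    :
    ∀ᵐ x : Fin N → EuclideanSpace ℝ (Fin d) ∂volume,
      ∀ L : EuclideanSpace ℝ (Fin d) → ℝ,
      (∀ w : EuclideanSpace ℝ (Fin d), L w = (1 / (N : ℝ)) * ∑ i, ℓ ⟪w, x i⟫) →
      ∀ gradL : EuclideanSpace ℝ (Fin d) → EuclideanSpace ℝ (Fin d),
      (∀ w : EuclideanSpace ℝ (Fin d),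
        gradL w = (1 / (N : ℝ)) • ∑ i, ℓ' ⟪w, x i⟫ • x i) →
      (∃ u : EuclideanSpace ℝ (Fin d), ∀ i, 0 < ⟪u, x i⟫) →
      ∀ σmax : ℝ, 0 < σmax →
      (∀ c : Fin N → ℝ, ‖∑ i, c i • x i‖ ≤ σmax * Real.sqrt (∑ i, (c i) ^ 2)) →
      ∀ wmax : EuclideanSpace ℝ (Fin d), (∀ i, 1 ≤ ⟪wmax, x i⟫) →
      (∀ v : EuclideanSpace ℝ (Fin d), (∀ i, 1 ≤ ⟪v, x i⟫) → ‖wmax‖ ≤ ‖v‖) →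
      ∀ η β : ℝ, 0 < η → 0 ≤ β → β < 1 →
      ∀ w m : ℕ → EuclideanSpace ℝ (Fin d),
        m 0 = 0 → w 0 = w 1 →
        (∀ t : ℕ, 1 ≤ t → m t = β • m (t - 1) + (1 - β) • gradL (w t)) →
        (∀ t : ℕ, 1 ≤ t → w (t + 1) = w t - η • m t) →
      ∀ s₀ H₀ : ℝ, ℓ s₀ = N * L (w 1) → 0 < H₀ →
        (∀ a b : ℝ, s₀ ≤ a → s₀ ≤ b → |ℓ' a - ℓ' b| ≤ H₀ * |a - b|) →
        η < 2 * N / (σmax ^ 2 * H₀) →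
      ∃ C : ℝ, 0 < C ∧ ∀ t : ℕ, 1 ≤ t → ‖w t - Real.log t • wmax‖ ≤ C := by
  have hφc : Continuous ℓ' := by
    refine continuous_iff_continuousAt.2 fun s => ?_
    obtain ⟨H, hH0, hH⟩ := hloc (s - 1)
    have hlip : LipschitzOnWith (Real.toNNReal H) ℓ' (Set.Ici (s - 1)) :=
      LipschitzOnWith.of_dist_le_mul fun a ha b hb => by
        rw [Real.coe_toNNReal H hH0.le, Real.dist_eq, Real.dist_eq]
        exact hH a b ha hb
    exact hlip.continuousOn.continuousAt (Ici_mem_nhds (by linarith))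
  filter_upwards [ae_max_margin_nondegenerate hN] with x hx
  intro L hL gradL hgrad hsep σmax hσ0 hσ wmax hwmax hmin η β hη hβ0 hβ1 w m hm0 hw01 hm hw
    s₀ H₀ hs₀ hH₀ hH hηH
  obtain ⟨a, hsum, ha, hdual⟩ := hx wmax hwmax hmin
  have hN0 : (0 : ℝ) < N := by exact_mod_cast hN
  have h1β : 0 < 1 - β := sub_pos.2 hβ1
  obtain ⟨u, hu⟩ := hdual fun i => -Real.log (a i * N / η)
  have hηm : ∀ n, η • m n = -(w (n + 1) - w n) := by
    intro n
    rcases n.eq_zero_or_pos with rfl | hn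
    · simp [hm0, hw01]
    · rw [hw n hn]; abel
  have hrec : ∀ n, w (n + 2) - w (n + 1) = β • (w (n + 1) - w n) -
      (η * (1 - β)) • ((1 / (N : ℝ)) • ∑ i, ℓ' ⟪w (n + 1), x i⟫ • x i) := by
    intro n
    rw [hw (n + 1) (by omega), hm (n + 1) (by omega), ← hgrad, Nat.add_sub_cancel, smul_add,
      smul_comm η β, hηm n, smul_smul]
    module
  have hs₀' : ℓ s₀ = ∑ i, ℓ ⟪w 1, x i⟫ := by
    rw [hs₀, hL, ← mul_assoc, mul_one_div_cancel hN0.ne', one_mul]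
  obtain ⟨hregion, hsq⟩ := momentum_energy hN hdiff hℓpos hℓ'neg hH₀ hH hσ0 hσ hη hβ0 hβ1 hηH hw01
    hrec hs₀'
  obtain ⟨κ, K, μ, hκ, hK, hμ, hφ⟩ := exists_exp_tail_bounds (φ := fun s => -ℓ' s) hφc.neg
    (fun s => neg_pos.2 (hℓ'neg s)) hμp hμm htailp htailm s₀
  set γ := β / (1 - β) with hγ
  set R : ℕ → EuclideanSpace ℝ (Fin d) := fun n =>
    w (n + 1) + γ • (w (n + 1) - w n) - Real.log (n + 1) • wmax - u with hR
  set e : ℕ → EuclideanSpace ℝ (Fin d) := fun n => -(γ • (w (n + 1) - w n)) with he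
  set g : ℕ → EuclideanSpace ℝ (Fin d) := fun n =>
    (1 - β)⁻¹ • ((w (n + 2) - w (n + 1)) - β • (w (n + 1) - w n)) with hg
  have hRe : ∀ n : ℕ, R n + Real.log (n + 1) • wmax + u + e n = w (n + 1) := fun n => by
    simp only [hR, he]; abel
  have hes : Summable fun n => ‖e n‖ ^ 2 := by
    simpa only [he, norm_neg, norm_smul, mul_pow] using hsq.mul_left (‖γ‖ ^ 2)
  have hgs : Summable fun n => ‖g n‖ ^ 2 := by
    have hsq' := (summable_nat_add_iff 1).2 hsq
    refine Summable.of_nonneg_of_le (fun n => sq_nonneg _) (fun n => ?_)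
      (((hsq'.add (hsq.mul_left (β ^ 2))).mul_left 2).mul_left (‖(1 - β)⁻¹‖ ^ 2))
    simp only [hg, norm_smul, mul_pow]
    gcongr
    have h1 := norm_sub_le (w (n + 2) - w (n + 1)) (β • (w (n + 1) - w n))
    rw [norm_smul, Real.norm_of_nonneg hβ0] at h1
    calc _ ≤ (‖w (n + 2) - w (n + 1)‖ + β * ‖w (n + 1) - w n‖) ^ 2 := by gcongr
      _ ≤ 2 * (‖w (n + 2) - w (n + 1)‖ ^ 2 + (β * ‖w (n + 1) - w n‖) ^ 2) := add_sq_le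
      _ = _ := by rw [mul_pow]
  obtain ⟨C, hC⟩ := momentum_residual_bounded hN (φ := fun s => -ℓ' s)
    (fun s => neg_pos.2 (hℓ'neg s)) hκ hK hμ hφ (x := x) (v := wmax) (u := u) hsum hη ha
    (fun i hi => by
      have h1 : 0 < a i * N / η := by positivity
      rw [hu i hi, neg_neg, Real.exp_log h1]
      field_simp)
    (R := R) (d := e) (g := g) hes hgs
    (fun n => by
      rw [hRe n]
      simp only [hg]
      rw [hrec n, sub_sub_cancel_left, smul_neg, smul_smul, smul_smul]
      simp only [neg_smul, Finset.sum_neg_distrib, smul_neg]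
      congr 2
      field_simp)
    (fun n i => by rw [hRe n]; exact hregion n i)
    (fun n => by
      simp only [hR, hg, hγ]
      push_cast
      rw [show (n : ℝ) + 1 + 1 = n + 2 by ring]
      match_scalars <;> field_simp <;> ring)
  obtain ⟨D, hD⟩ : ∃ D, ∀ n, ‖e n‖ ≤ D :=
    ⟨Real.sqrt (∑' n, ‖e n‖ ^ 2), fun n =>
      Real.le_sqrt_of_sq_le (hes.le_tsum n fun k _ => sq_nonneg _)⟩
  have hC0 : 0 ≤ C := (norm_nonneg _).trans (hC 0)
  have hD0 : 0 ≤ D := (norm_nonneg _).trans (hD 0)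
  refine ⟨C + ‖u‖ + D + 1, by positivity, fun t ht => ?_⟩
  obtain ⟨n, rfl⟩ := Nat.exists_eq_add_of_le' ht
  have heq : w (n + 1) - Real.log ((n + 1 : ℕ) : ℝ) • wmax = R n + u + e n := by
    push_cast
    nth_rewrite 1 [← hRe n]
    abel
  rw [heq]
  have h1 := norm_add₃_le (a := R n) (b := u) (c := e n)
  have h2 := hC n
  have h3 := hD n
  linarith
end

section
/- Under the stated conditions (linearly separable data, exponential-tailed loss, locally smooth loss, Adam momentum parameters 0 < β₁ < 1 and β₂ = (c·β₁)⁴ with c > 1 and c·β₁ < 1, and the Adam learning-rate condition), the deterministic Adam iterates converge in direction to the L² max-margin solution: ‖w(t)‖ → ∞ as t → ∞ and lim_{t→∞} w(t)/‖w(t)‖ = ŵ/‖ŵ‖. -/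
open Filter Topology RealInnerProductSpace MeasureTheory

set_option linter.unusedVariables false

theorem tendsto_zero_of_contraction {r : ℕ → ℝ} {a : ℝ} (hr : ∀ t, 0 ≤ r t) (ha0 : 0 ≤ a)
    (ha1 : a < 1) (h : ∀ δ > 0, ∀ᶠ t in atTop, r (t + 1) ≤ a * r t + δ) :
    Tendsto r atTop (𝓝 0) := by
  rw [Metric.tendsto_atTop]
  intro e he
  obtain ⟨T, hT⟩ := eventually_atTop.1 (h ((1 - a) * (e / 2)) (mul_pos (by linarith) (by linarith)))
  have key : ∀ k, r (T + k) ≤ a ^ k * r T + e / 2 := by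
    intro k
    induction k with
    | zero => simp; linarith
    | succ k ih =>
      have h1 := hT (T + k) (by omega)
      have h2 := mul_le_mul_of_nonneg_left ih ha0
      calc r (T + (k + 1)) ≤ a * r (T + k) + (1 - a) * (e / 2) := h1
        _ ≤ a ^ (k + 1) * r T + e / 2 := by rw [pow_succ]; nlinarith
  have hlim : Tendsto (fun k => a ^ k * r T) atTop (𝓝 0) := by
    simpa using (tendsto_pow_atTop_nhds_zero_of_lt_one ha0 ha1).mul_const (r T)
  obtain ⟨K, hK⟩ := eventually_atTop.1 (hlim.eventually (gt_mem_nhds (half_pos he)))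
  refine ⟨T + K, fun n hn => ?_⟩
  obtain ⟨k, rfl⟩ := Nat.exists_eq_add_of_le (le_trans (Nat.le_add_right T K) hn)
  rw [Real.dist_eq, sub_zero, abs_of_nonneg (hr _)]
  linarith [key k, hK k (by omega)]

theorem le_quadratic_of_deriv_le_of_le {f f' : ℝ → ℝ} {C M : ℝ} (hC : 0 ≤ C)
    (hf : ∀ s, HasDerivAt f (f' s) s)
    (hbound : ∀ s, 0 ≤ s → f s ≤ M → f' s ≤ f' 0 + C * s)
    (h0 : f 0 < M) (h1 : f 0 + f' 0 + C / 2 < M) :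
    f 1 ≤ f 0 + f' 0 + C / 2 := by
  have key : ∀ δ, 0 < δ → f 0 + f' 0 + C / 2 + δ < M → f 0 + δ < M →
      f 1 ≤ f 0 + f' 0 + C / 2 + δ := by
    intro δ hδ hM1 hM0
    have hB : ∀ s, HasDerivAt (fun s : ℝ => f 0 + s * f' 0 + C / 2 * s ^ 2 + δ * s)
        (f' 0 + C * s + δ) s := by
      intro s
      have := ((((hasDerivAt_id s).mul_const (f' 0)).const_add (f 0)).add
        (((hasDerivAt_id s).pow 2).const_mul (C / 2))).add ((hasDerivAt_id s).const_mul δ)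
      refine this.congr_deriv ?_
      simp
      ring
    have := image_le_of_deriv_right_lt_deriv_boundary (f := f) (f' := f') (a := 0) (b := 1)
      (fun s _ => (hf s).continuousAt.continuousWithinAt) (fun s _ => (hf s).hasDerivWithinAt)
      (B := fun s : ℝ => f 0 + s * f' 0 + C / 2 * s ^ 2 + δ * s)
      (B' := fun s => f' 0 + C * s + δ) (by simp) hB ?_ (x := 1) (by simp)
    · simpa using this
    · intro s hs hfs
      have hle : f s ≤ M := by
        rw [hfs]
        have hs2 : s ^ 2 ≤ s := by nlinarith [hs.1, hs.2]
        have := mul_le_mul_of_nonneg_left hs2 (half_pos hδ).le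
        have h3 := mul_le_mul_of_nonneg_left hs2 (show 0 ≤ C / 2 by linarith)
        nlinarith [hs.1, hs.2, mul_nonneg hs.1 (sub_nonneg.2 hM1.le),
          mul_nonneg (sub_nonneg.2 hs.2.le) (sub_nonneg.2 hM0.le)]
      linarith [hbound s hs.1 hle]
  refine le_of_forall_pos_le_add fun e he => ?_
  set g := min e (min ((M - (f 0 + f' 0 + C / 2)) / 2) ((M - f 0) / 2)) with hg
  have hg0 : 0 < g := by
    refine lt_min he (lt_min ?_ ?_) <;> linarith
  have hg1 : g ≤ e := min_le_left _ _
  have hg2 : g ≤ (M - (f 0 + f' 0 + C / 2)) / 2 := (min_le_right _ _).trans (min_le_left _ _)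
  have hg3 : g ≤ (M - f 0) / 2 := (min_le_right _ _).trans (min_le_right _ _)
  linarith [key g hg0 (by linarith) (by linarith)]

theorem exists_abs_sub_exp_neg_le {ℓ ℓ' : ℝ → ℝ} (hdiff : ∀ s : ℝ, HasDerivAt ℓ (ℓ' s) s)
    (hℓtop : Tendsto ℓ atTop (𝓝 0)) {μp μm xp xm : ℝ} (hμp : 0 < μp) (hμm : 0 < μm)
    (htailp : ∀ s : ℝ, xp < s → -ℓ' s ≤ (1 + Real.exp (-μp * s)) * Real.exp (-s))
    (htailm : ∀ s : ℝ, xm < s → (1 - Real.exp (-μm * s)) * Real.exp (-s) ≤ -ℓ' s)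
    {δ : ℝ} (hδ : 0 < δ) :
    ∃ S, ∀ s, S ≤ s → |-ℓ' s - Real.exp (-s)| ≤ δ * Real.exp (-s) ∧
      |ℓ s - Real.exp (-s)| ≤ δ * Real.exp (-s) := by
  have hexp : ∀ μ : ℝ, 0 < μ → ∀ᶠ s in atTop, Real.exp (-μ * s) < δ := by
    intro μ hμ
    have : Tendsto (fun s : ℝ => Real.exp (-μ * s)) atTop (𝓝 0) :=
      Real.tendsto_exp_atBot.comp (tendsto_id.const_mul_atTop_of_neg (by linarith))
    exact this.eventually (gt_mem_nhds hδ)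
  obtain ⟨S, hS⟩ := eventually_atTop.1 ((hexp μp hμp).and ((hexp μm hμm).and
    ((eventually_gt_atTop xp).and (eventually_gt_atTop xm))))
  have hder : ∀ s, S ≤ s → -ℓ' s ≤ (1 + δ) * Real.exp (-s) ∧ (1 - δ) * Real.exp (-s) ≤ -ℓ' s := by
    intro s hs
    obtain ⟨h1, h2, h3, h4⟩ := hS s hs
    refine ⟨(htailp s h3).trans ?_, le_trans ?_ (htailm s h4)⟩
    · gcongr
    · gcongr
  have hexpder : ∀ κ s : ℝ, HasDerivAt (fun s => ℓ s - κ * Real.exp (-s))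
      (ℓ' s + κ * Real.exp (-s)) s := by
    intro κ s
    have := (hdiff s).sub (((hasDerivAt_neg s).exp).const_mul κ)
    refine this.congr_deriv ?_
    ring
  have hlim : ∀ κ : ℝ, Tendsto (fun s => ℓ s - κ * Real.exp (-s)) atTop (𝓝 0) := by
    intro κ
    simpa using hℓtop.sub ((Real.tendsto_exp_neg_atTop_nhds_zero).const_mul κ)
  refine ⟨S, fun s hs => ⟨?_, ?_⟩⟩
  · obtain ⟨h1, h2⟩ := hder s hs
    rw [abs_le]
    constructor <;> nlinarith
  · have hup : ℓ s - (1 + δ) * Real.exp (-s) ≤ 0 := by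
      refine ge_of_tendsto (hlim (1 + δ)) ?_
      have hm : MonotoneOn (fun s => ℓ s - (1 + δ) * Real.exp (-s)) (Set.Ici S) := by
        refine monotoneOn_of_deriv_nonneg (convex_Ici S)
          (fun s _ => (hexpder _ s).continuousAt.continuousWithinAt)
          (fun s _ => (hexpder _ s).differentiableAt.differentiableWithinAt) ?_
        intro s hs
        rw [(hexpder _ s).deriv]
        rw [interior_Ici] at hs
        linarith [(hder s (le_of_lt hs)).1]
      filter_upwards [eventually_ge_atTop s] with r hr
      exact hm hs (le_trans hs hr) hr
    have hlo : 0 ≤ ℓ s - (1 - δ) * Real.exp (-s) := by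
      refine le_of_tendsto (hlim (1 - δ)) ?_
      have hm : AntitoneOn (fun s => ℓ s - (1 - δ) * Real.exp (-s)) (Set.Ici S) := by
        refine antitoneOn_of_deriv_nonpos (convex_Ici S)
          (fun s _ => (hexpder _ s).continuousAt.continuousWithinAt)
          (fun s _ => (hexpder _ s).differentiableAt.differentiableWithinAt) ?_
        intro s hs
        rw [(hexpder _ s).deriv]
        rw [interior_Ici] at hs
        linarith [(hder s (le_of_lt hs)).2]
      filter_upwards [eventually_ge_atTop s] with r hr
      exact hm hs (le_trans hs hr) hr
    rw [abs_le]
    constructor <;> nlinarith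

theorem exists_abs_sub_le_mul_of_abs_sub_exp_neg_le {g : ℝ → ℝ}
    (htail : ∀ δ > 0, ∃ S, ∀ s, S ≤ s → |-g s - Real.exp (-s)| ≤ δ * Real.exp (-s))
    {δ : ℝ} (hδ : 0 < δ) :
    ∃ S, ∃ h > 0, ∀ a b, S ≤ a → S ≤ b → |a - b| ≤ h → |g a - g b| ≤ δ * (-g a) := by
  set θ := min (1 / 2) (δ / 8) with hθ
  have hθ0 : 0 < θ := lt_min (by norm_num) (by linarith)
  have hθ1 : θ ≤ 1 / 2 := min_le_left _ _
  have hθ2 : θ ≤ δ / 8 := min_le_right _ _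
  obtain ⟨S, hS⟩ := htail θ hθ0
  refine ⟨S, θ / 2, by linarith, fun a b ha hb hab => ?_⟩
  have h1 := abs_le.1 (hS a ha)
  have h2 := abs_le.1 (hS b hb)
  have h3 := Real.abs_exp_sub_one_le (x := a - b) (by linarith)
  have h4 : |Real.exp (a - b) - 1| ≤ θ := by linarith
  have h5 := abs_le.1 h4
  have hbexp : Real.exp (-b) = Real.exp (-a) * Real.exp (a - b) := by
    rw [← Real.exp_add]; congr 1; ring
  have ha0 := Real.exp_pos (-a)
  have h6 : Real.exp (-b) ≤ (1 + θ) * Real.exp (-a) := by rw [hbexp]; nlinarith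
  have h7 : (1 - θ) * Real.exp (-a) ≤ Real.exp (-b) := by rw [hbexp]; nlinarith
  have h8 : 0 ≤ θ * Real.exp (-a) := by positivity
  have h9 : θ * Real.exp (-b) ≤ 2 * (θ * Real.exp (-a)) := by nlinarith
  have h10 : Real.exp (-a) ≤ 2 * (-g a) := by nlinarith
  have h11 : 4 * (θ * Real.exp (-a)) ≤ δ * (-g a) := by nlinarith
  rw [abs_le]
  constructor <;> nlinarith

theorem exists_neg_bound_of_limsup_atBot {f : ℝ → ℝ} (h : Filter.limsup f atBot < 0) :
    ∃ a < 0, ∃ s₀, ∀ s ≤ s₀, f s ≤ a := by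
  rw [Filter.limsup_eq] at h
  have hne : {a | ∀ᶠ n in atBot, f n ≤ a}.Nonempty := by
    by_contra hne
    rw [Set.not_nonempty_iff_eq_empty.1 hne, Real.sInf_empty] at h
    exact lt_irrefl _ h
  obtain ⟨a, ha, ha0⟩ := exists_lt_of_csInf_lt hne h
  obtain ⟨s₀, hs₀⟩ := eventually_atBot.1 ha
  exact ⟨a, ha0, s₀, hs₀⟩

theorem exists_lower_bound_of_le {ℓ ℓ' : ℝ → ℝ} (hdiff : ∀ s : ℝ, HasDerivAt ℓ (ℓ' s) s)
    (hℓpos : ∀ s, 0 < ℓ s) (hbot : Filter.limsup ℓ' atBot < 0) (K : ℝ) :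
    ∃ s₀, ∀ s, ℓ s ≤ K → s₀ ≤ s := by
  obtain ⟨a, ha, s₁, hs₁⟩ := exists_neg_bound_of_limsup_atBot hbot
  refine ⟨min s₁ (s₁ - K / (-a)), fun s hs => ?_⟩
  by_contra! hlt
  obtain ⟨hlt1, hlt2⟩ := lt_min_iff.1 hlt
  obtain ⟨c, hc, hceq⟩ := exists_hasDerivAt_eq_slope ℓ ℓ' hlt1
    (fun s _ => (hdiff s).continuousAt.continuousWithinAt) (fun s _ => hdiff s)
  rw [eq_div_iff (by linarith)] at hceq
  have h1 := hs₁ c hc.2.le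
  have h2 : K / (-a) < s₁ - s := by linarith
  rw [div_lt_iff₀ (by linarith)] at h2
  nlinarith [hℓpos s₁]

theorem tendsto_atTop_of_neg_continuous {f : ℝ → ℝ} (hcont : Continuous f) (hneg : ∀ s, f s < 0)
    (hbot : Filter.limsup f atBot < 0) {y : ℕ → ℝ}
    (hy : Tendsto (fun t => f (y t)) atTop (𝓝 0)) : Tendsto y atTop atTop := by
  obtain ⟨a, ha, s₁, hs₁⟩ := exists_neg_bound_of_limsup_atBot hbot
  rw [tendsto_atTop]
  intro S
  obtain ⟨b, hb, hbS⟩ : ∃ b < 0, ∀ s ≤ S, f s ≤ b := by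
    obtain ⟨c, hc, hcmax⟩ := (isCompact_Icc (a := min s₁ S) (b := S)).exists_isMaxOn
      ⟨S, by simp⟩ hcont.continuousOn
    refine ⟨max a (f c), max_lt ha (hneg c), fun s hs => ?_⟩
    rcases le_total s s₁ with h | h
    · exact (hs₁ s h).trans (le_max_left _ _)
    · exact (hcmax ⟨(min_le_left _ _).trans h, hs⟩).trans (le_max_right _ _)
  filter_upwards [hy.eventually (lt_mem_nhds hb)] with t ht
  by_contra! hlt
  linarith [hbS (y t) hlt.le]

theorem exists_abs_le_of_tendsto_zero {f : ℝ → ℝ} (hcont : Continuous f)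
    (htop : Tendsto f atTop (𝓝 0)) (s₀ : ℝ) : ∃ B, 0 ≤ B ∧ ∀ s, s₀ ≤ s → |f s| ≤ B := by
  obtain ⟨S, hS⟩ := eventually_atTop.1 (Metric.tendsto_nhds.1 htop 1 one_pos)
  obtain ⟨C, hC⟩ := (isCompact_Icc (a := s₀) (b := S)).exists_bound_of_continuousOn
    hcont.continuousOn
  refine ⟨max 1 C, le_max_of_le_left zero_le_one, fun s hs => ?_⟩
  rcases le_total s S with h | h
  · exact (hC s ⟨hs, h⟩).trans (le_max_right _ _)
  · have := hS s h
    rw [Real.dist_eq, sub_zero] at this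
    exact this.le.trans (le_max_left _ _)

theorem continuous_of_locally_smooth {f : ℝ → ℝ}
    (hloc : ∀ s : ℝ, ∃ H : ℝ, 0 < H ∧ ∀ a b : ℝ, s ≤ a → s ≤ b → |f a - f b| ≤ H * |a - b|) :
    Continuous f := by
  rw [continuous_iff_continuousAt]
  intro y
  obtain ⟨H, hH, h⟩ := hloc (y - 1)
  have hlip : LipschitzOnWith ⟨H, hH.le⟩ f (Set.Ici (y - 1)) :=
    LipschitzOnWith.of_dist_le_mul fun a ha b hb => by
      rw [Real.dist_eq, Real.dist_eq]; exact h a b ha hb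
  exact hlip.continuousOn.continuousAt (Ici_mem_nhds (by linarith))

theorem norm_le_one_add_sum {E : Type*} [NormedAddCommGroup E] {N : ℕ} (x : Fin N → E) (i : Fin N) : ‖x i‖ ≤ 1 + ∑ j, ‖x j‖ := by
  have := Finset.single_le_sum (f := fun j => ‖x j‖) (fun j _ => norm_nonneg _) (Finset.mem_univ i)
  linarith

section
variable {E : Type*} [NormedAddCommGroup E] [InnerProductSpace ℝ E] {N : ℕ}

theorem hasDerivAt_loss_line {x : Fin N → E} {ℓ ℓ' : ℝ → ℝ}
    (hdiff : ∀ s : ℝ, HasDerivAt ℓ (ℓ' s) s) {L : E → ℝ} {gradL : E → E}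
    (hLdef : ∀ w, L w = (1 / (N : ℝ)) * ∑ i, ℓ ⟪w, x i⟫)
    (hgraddef : ∀ w, gradL w = (1 / (N : ℝ)) • ∑ i, ℓ' ⟪w, x i⟫ • x i) (u v : E) (s : ℝ) :
    HasDerivAt (fun s : ℝ => L (u + s • v)) ⟪gradL (u + s • v), v⟫ s := by
  have hi : ∀ i ∈ Finset.univ, HasDerivAt (fun s : ℝ => ℓ ⟪u + s • v, x i⟫)
      (ℓ' ⟪u + s • v, x i⟫ * ⟪v, x i⟫) s := by
    intro i _
    have hlin : HasDerivAt (fun s : ℝ => ⟪u + s • v, x i⟫) ⟪v, x i⟫ s := by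
      have := ((hasDerivAt_id s).mul_const ⟪v, x i⟫).const_add ⟪u, x i⟫
      simpa [inner_add_left, real_inner_smul_left] using this
    exact (hdiff _).comp s hlin
  have := (HasDerivAt.fun_sum hi).const_mul (1 / (N : ℝ))
  have hfun : (fun s : ℝ => L (u + s • v)) =
      fun s : ℝ => (1 / (N : ℝ)) * ∑ i, ℓ ⟪u + s • v, x i⟫ := funext fun s => hLdef _
  rw [hfun]
  refine this.congr_deriv ?_
  rw [hgraddef, real_inner_smul_left, sum_inner]
  congr 1
  refine Finset.sum_congr rfl fun i _ => ?_
  rw [real_inner_smul_left, real_inner_comm v (x i)]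

theorem mean_neg_deriv_le_norm_grad {x : Fin N → E} {ℓ' : ℝ → ℝ} {gradL : E → E} {wmax : E}
    (hgraddef : ∀ w, gradL w = (1 / (N : ℝ)) • ∑ i, ℓ' ⟪w, x i⟫ • x i)
    (hwmax : ∀ i, 1 ≤ ⟪wmax, x i⟫) (hℓ'neg : ∀ s : ℝ, ℓ' s < 0) (w : E) :
    (1 / (N : ℝ)) * ∑ i, -ℓ' ⟪w, x i⟫ ≤ ‖wmax‖ * ‖gradL w‖ := by
  have h1 : (1 / (N : ℝ)) * ∑ i, -ℓ' ⟪w, x i⟫ ≤ ⟪wmax, -gradL w⟫ := by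
    rw [hgraddef, inner_neg_right, real_inner_smul_right, inner_sum, ← mul_neg,
      ← Finset.sum_neg_distrib]
    gcongr with i _
    rw [real_inner_smul_right]
    nlinarith [hwmax i, hℓ'neg ⟪w, x i⟫]
  refine h1.trans ((real_inner_le_norm _ _).trans ?_)
  rw [norm_neg]

theorem norm_mean_smul_le {x : Fin N → E} (hN : 1 ≤ N) {X B : ℝ} (hX : ∀ i, ‖x i‖ ≤ X) (hB : 0 ≤ B)
    {c : Fin N → ℝ} (hc : ∀ i, |c i| ≤ B) : ‖(1 / (N : ℝ)) • ∑ i, c i • x i‖ ≤ B * X := by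
  have hN0 : (0 : ℝ) < N := by exact_mod_cast hN
  rw [norm_smul, Real.norm_of_nonneg (by positivity), one_div, inv_mul_le_iff₀ hN0]
  calc ‖∑ i, c i • x i‖ ≤ ∑ i, ‖c i • x i‖ := norm_sum_le _ _
    _ ≤ ∑ _i : Fin N, B * X := by
        gcongr with i _
        rw [norm_smul, Real.norm_eq_abs]
        exact mul_le_mul (hc i) (hX i) (norm_nonneg _) hB
    _ = N * (B * X) := by simp

theorem exists_norm_grad_sub_le {x : Fin N → E} {ℓ' : ℝ → ℝ} {gradL : E → E} {wmax : E}
    (hgraddef : ∀ w, gradL w = (1 / (N : ℝ)) • ∑ i, ℓ' ⟪w, x i⟫ • x i)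
    (hwmax : ∀ i, 1 ≤ ⟪wmax, x i⟫) (hℓ'neg : ∀ s : ℝ, ℓ' s < 0)
    (hrel : ∀ δ > 0, ∃ S, ∃ h > 0, ∀ a b, S ≤ a → S ≤ b → |a - b| ≤ h →
      |ℓ' a - ℓ' b| ≤ δ * (-ℓ' a)) {δ : ℝ} (hδ : 0 < δ) :
    ∃ S, ∃ h > 0, ∀ u v : E, (∀ i, S ≤ ⟪u, x i⟫) → (∀ i, S ≤ ⟪v, x i⟫) → ‖u - v‖ ≤ h →
      ‖gradL u - gradL v‖ ≤ δ * ‖gradL u‖ := by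
  set X := 1 + ∑ j, ‖x j‖ with hXdef
  have hX0 : 0 < X := by positivity
  have hX : ∀ i, ‖x i‖ ≤ X := norm_le_one_add_sum x
  have hc : 0 < X * (‖wmax‖ + 1) := by positivity
  obtain ⟨S, h, hh, hS⟩ := hrel (δ / (X * (‖wmax‖ + 1))) (div_pos hδ hc)
  refine ⟨S, h / X, div_pos hh hX0, fun u v hu hv huv => ?_⟩
  set θ := δ / (X * (‖wmax‖ + 1)) with hθ
  have hθ0 : 0 < θ := div_pos hδ hc
  have hi : ∀ i, ‖(ℓ' ⟪u, x i⟫ - ℓ' ⟪v, x i⟫) • x i‖ ≤ θ * X * (-ℓ' ⟪u, x i⟫) := by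
    intro i
    have h1 : |⟪u, x i⟫ - ⟪v, x i⟫| ≤ h := by
      rw [← inner_sub_left]
      refine (abs_real_inner_le_norm _ _).trans ?_
      rw [le_div_iff₀ hX0] at huv
      exact (mul_le_mul_of_nonneg_left (hX i) (norm_nonneg _)).trans huv
    have h2 := hS _ _ (hu i) (hv i) h1
    rw [norm_smul, Real.norm_eq_abs]
    calc _ ≤ (θ * (-ℓ' ⟪u, x i⟫)) * X :=
          mul_le_mul h2 (hX i) (norm_nonneg _) (mul_nonneg hθ0.le (by linarith [hℓ'neg ⟪u, x i⟫]))
      _ = _ := by ring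
  have heq : gradL u - gradL v =
      (1 / (N : ℝ)) • ∑ i, (ℓ' ⟪u, x i⟫ - ℓ' ⟪v, x i⟫) • x i := by
    rw [hgraddef, hgraddef, ← smul_sub, ← Finset.sum_sub_distrib]
    simp only [sub_smul]
  calc ‖gradL u - gradL v‖ = (1 / (N : ℝ)) * ‖∑ i, (ℓ' ⟪u, x i⟫ - ℓ' ⟪v, x i⟫) • x i‖ := by
        rw [heq, norm_smul, Real.norm_of_nonneg (by positivity)]
    _ ≤ (1 / (N : ℝ)) * ∑ i, θ * X * (-ℓ' ⟪u, x i⟫) := by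
        gcongr
        exact (norm_sum_le _ _).trans (Finset.sum_le_sum fun i _ => hi i)
    _ = θ * X * ((1 / (N : ℝ)) * ∑ i, -ℓ' ⟪u, x i⟫) := by
        rw [← Finset.mul_sum]; ring
    _ ≤ θ * X * (‖wmax‖ * ‖gradL u‖) := by
        exact mul_le_mul_of_nonneg_left (mean_neg_deriv_le_norm_grad hgraddef hwmax hℓ'neg u)
          (by positivity)
    _ ≤ θ * X * ((‖wmax‖ + 1) * ‖gradL u‖) := by
        gcongr
        linarith
    _ = δ * ‖gradL u‖ := by
        rw [hθ]; field_simp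

theorem loss_sub_le_of_norm_grad_sub_le {L : E → ℝ} {gradL : E → E}
    (hline : ∀ (u v : E) (s : ℝ), HasDerivAt (fun s : ℝ => L (u + s • v)) ⟪gradL (u + s • v), v⟫ s)
    {u v : E} {B : ℝ} (hB : ∀ s ∈ Set.Ioo (0 : ℝ) 1, ‖gradL (u + s • v) - gradL u‖ ≤ B) :
    L (u + v) - L u ≤ ⟪gradL u, v⟫ + B * ‖v‖ := by
  obtain ⟨c, hc, hceq⟩ := exists_hasDerivAt_eq_slope (fun s : ℝ => L (u + s • v))
    (fun s => ⟪gradL (u + s • v), v⟫) zero_lt_one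
    (fun s _ => (hline u v s).continuousAt.continuousWithinAt) (fun s _ => hline u v s)
  simp only [one_smul, zero_smul, add_zero, sub_zero, div_one] at hceq
  have h1 : ⟪gradL (u + c • v), v⟫ = ⟪gradL u, v⟫ + ⟪gradL (u + c • v) - gradL u, v⟫ := by
    rw [inner_sub_left]; ring
  have h2 := real_inner_le_norm (gradL (u + c • v) - gradL u) v
  have h3 := mul_le_mul_of_nonneg_right (hB c hc) (norm_nonneg v)
  linarith

theorem loss_add_le_of_lipschitz_sublevel {L : E → ℝ} {gradL : E → E}
    (hline : ∀ (u v : E) (s : ℝ), HasDerivAt (fun s : ℝ => L (u + s • v)) ⟪gradL (u + s • v), v⟫ s)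
    {M H : ℝ} (hH : 0 ≤ H)
    (hlip : ∀ u v : E, L u ≤ M → L v ≤ M → ‖gradL u - gradL v‖ ≤ H * ‖u - v‖)
    {u v : E} (hu : L u < M) (huv : L u + ⟪gradL u, v⟫ + H * ‖v‖ ^ 2 / 2 < M) :
    L (u + v) ≤ L u + ⟪gradL u, v⟫ + H * ‖v‖ ^ 2 / 2 := by
  have := le_quadratic_of_deriv_le_of_le (f := fun s : ℝ => L (u + s • v))
    (f' := fun s => ⟪gradL (u + s • v), v⟫) (C := H * ‖v‖ ^ 2) (M := M) (by positivity)
    (hline u v) ?_ (by simpa using hu) (by simpa using huv)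
  · simpa using this
  · intro s hs hle
    have h1 := hlip (u + s • v) u hle hu.le
    rw [add_sub_cancel_left, norm_smul, Real.norm_of_nonneg hs] at h1
    have h2 := real_inner_le_norm (gradL (u + s • v) - gradL u) v
    have h3 := mul_le_mul_of_nonneg_right h1 (norm_nonneg v)
    rw [inner_sub_left] at h2
    simp only [zero_smul, add_zero]
    nlinarith

theorem inner_maxMargin_ge {x : Fin N → E} {wmax : E} (hwmax : ∀ i, 1 ≤ ⟪wmax, x i⟫)
    (hwmaxmin : ∀ v : E, (∀ i, 1 ≤ ⟪v, x i⟫) → ‖wmax‖ ≤ ‖v‖) {v : E} (hv : ∀ i, 1 ≤ ⟪v, x i⟫) :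
    ‖wmax‖ ^ 2 ≤ ⟪wmax, v⟫ := by
  have key : ∀ s : ℝ, 0 < s → s ≤ 1 → 0 ≤ 2 * ⟪wmax, v - wmax⟫ + s * ‖v - wmax‖ ^ 2 := by
    intro s hs0 hs1
    have h1 : ‖wmax‖ ≤ ‖wmax + s • (v - wmax)‖ := by
      refine hwmaxmin _ fun i => ?_
      rw [inner_add_left, real_inner_smul_left, inner_sub_left]
      nlinarith [hwmax i, hv i]
    have h2 := pow_le_pow_left₀ (norm_nonneg _) h1 2
    rw [norm_add_sq_real, real_inner_smul_right, norm_smul, Real.norm_of_nonneg hs0.le] at h2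
    have h3 : 0 ≤ s * (2 * ⟪wmax, v - wmax⟫ + s * ‖v - wmax‖ ^ 2) := by nlinarith
    exact nonneg_of_mul_nonneg_right h3 hs0
  have h4 : 0 ≤ 2 * ⟪wmax, v - wmax⟫ := by
    have hlim : Tendsto (fun s : ℝ => 2 * ⟪wmax, v - wmax⟫ + s * ‖v - wmax‖ ^ 2) (𝓝[>] 0)
        (𝓝 (2 * ⟪wmax, v - wmax⟫ + 0 * ‖v - wmax‖ ^ 2)) :=
      ((continuous_const.add (continuous_id.mul continuous_const)).tendsto 0).mono_left
        nhdsWithin_le_nhds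
    rw [zero_mul, add_zero] at hlim
    refine ge_of_tendsto hlim ?_
    filter_upwards [Ioo_mem_nhdsGT (zero_lt_one' ℝ)] with s hs
    exact key s hs.1 hs.2.le
  rw [inner_sub_right, real_inner_self_eq_norm_sq] at h4
  linarith

theorem tendsto_direction_of_margin_s15 {x : Fin N → E} {wmax : E} (hpos : 0 < ‖wmax‖)
    (hwmax : ∀ i, 1 ≤ ⟪wmax, x i⟫)
    (hwmaxmin : ∀ v : E, (∀ i, 1 ≤ ⟪v, x i⟫) → ‖wmax‖ ≤ ‖v‖)
    {w : ℕ → E} (hnorm : Tendsto (fun t => ‖w t‖) atTop atTop)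
    (hmargin : ∀ δ > 0, δ < 1 → ∀ᶠ t in atTop, ∀ i, (1 - δ) * ‖w t‖ ≤ ‖wmax‖ * ⟪w t, x i⟫) :
    Tendsto (fun t => ‖w t‖⁻¹ • w t) atTop (𝓝 (‖wmax‖⁻¹ • wmax)) := by
  rw [Metric.tendsto_nhds]
  intro e he
  set δ := min (1 / 2) (e ^ 2 / 4) with hδdef
  have hδ0 : 0 < δ := lt_min (by norm_num) (by positivity)
  have hδ1 : δ ≤ 1 / 2 := min_le_left _ _
  have hδ2 : δ ≤ e ^ 2 / 4 := min_le_right _ _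
  filter_upwards [hmargin δ hδ0 (by linarith), hnorm.eventually_gt_atTop 0] with t ht hwt
  have h1δ : 0 < 1 - δ := by linarith
  set k := ‖wmax‖ / ((1 - δ) * ‖w t‖) with hk
  have hk0 : 0 < k := by positivity
  have h1 : ‖wmax‖ ^ 2 ≤ ⟪wmax, k • w t⟫ := by
    refine inner_maxMargin_ge hwmax hwmaxmin fun i => ?_
    rw [real_inner_smul_left, hk, div_mul_eq_mul_div, le_div_iff₀ (by positivity), one_mul]
    exact ht i
  rw [real_inner_smul_right, hk, div_mul_eq_mul_div, le_div_iff₀ (by positivity)] at h1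
  have h2 : (1 - δ) * (‖wmax‖ * ‖w t‖) ≤ ⟪wmax, w t⟫ := by
    refine le_of_mul_le_mul_left ?_ hpos
    nlinarith
  rw [dist_eq_norm]
  refine lt_of_pow_lt_pow_left₀ 2 he.le ?_
  rw [norm_sub_sq_real, norm_smul, norm_smul, norm_inv, norm_inv, norm_norm, norm_norm,
    inv_mul_cancel₀ hwt.ne', inv_mul_cancel₀ hpos.ne', real_inner_smul_left,
    real_inner_smul_right, real_inner_comm]
  have h3 : 1 - δ ≤ ‖w t‖⁻¹ * (‖wmax‖⁻¹ * ⟪wmax, w t⟫) := by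
    rw [← mul_assoc, ← mul_inv, inv_mul_eq_div, le_div_iff₀ (by positivity)]
    linarith
  nlinarith [sq_pos_of_pos he]

end

theorem one_sub_pow_succ_div_le {q : ℝ} (hq0 : 0 < q) (hq1 : q < 1) (n : ℕ) :
    (1 - q ^ (n + 1)) / (1 - q ^ n) ≤ 1 / (1 - q) := by
  rcases Nat.eq_zero_or_pos n with rfl | hn
  · simp [hq1.le]
  · have h1 : q ^ n ≤ q := by simpa using pow_le_pow_of_le_one hq0.le hq1.le hn
    exact div_le_div₀ zero_le_one (by linarith [pow_pos hq0 (n + 1)]) (by linarith) (by linarith)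

theorem learning_rate_le {η β c ε H : ℝ} (hH : 0 < H) (hβ0 : 0 < β) (hβ1 : β < 1) (hc : 1 < c)
    (hcβ : c * β < 1)
    (hηle : η ≤ (Real.sqrt ε / H) *
      sInf {y : ℝ | ∃ t : ℕ, 2 ≤ t ∧
        y = (1 - β ^ t) / (1 - β) -
          ((1 - β ^ (t - 1)) / (c * (1 - β))) *
            ((1 - (c * β) ^ t) / (1 - (c * β) ^ (t - 1)))}) (n : ℕ) :
    η * (1 - β) * H ≤ Real.sqrt ε * ((1 - β ^ (n + 1)) -
      (1 - β ^ n) * (((1 - (c * β) ^ (n + 1)) / (1 - (c * β) ^ n)) / c)) := by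
  have hq0 : 0 < c * β := by positivity
  have h1β : 0 < 1 - β := by linarith
  have hpow : ∀ k, 0 ≤ 1 - β ^ k := fun k => sub_nonneg.2 (pow_le_one₀ hβ0.le hβ1.le)
  have hbdd : BddBelow {y : ℝ | ∃ t : ℕ, 2 ≤ t ∧
        y = (1 - β ^ t) / (1 - β) -
          ((1 - β ^ (t - 1)) / (c * (1 - β))) *
            ((1 - (c * β) ^ t) / (1 - (c * β) ^ (t - 1)))} := by
    refine ⟨-(1 / (c * (1 - β)) * (1 / (1 - c * β))), ?_⟩
    rintro y ⟨t, ht, rfl⟩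
    obtain ⟨k, rfl⟩ : ∃ k, t = k + 1 := ⟨t - 1, by omega⟩
    rw [Nat.add_sub_cancel]
    have h1 : 0 ≤ (1 - β ^ (k + 1)) / (1 - β) := div_nonneg (hpow _) h1β.le
    have h2 : (1 - β ^ k) / (c * (1 - β)) ≤ 1 / (c * (1 - β)) := by
      gcongr
      linarith [pow_pos hβ0 k]
    have h3 := mul_le_mul_of_nonneg_right h2
      (show 0 ≤ 1 / (1 - c * β) by exact (one_div_pos.2 (by linarith)).le)
    have h4 := mul_le_mul_of_nonneg_left (one_sub_pow_succ_div_le hq0 hcβ k)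
      (show 0 ≤ (1 - β ^ k) / (c * (1 - β)) from div_nonneg (hpow _) (by positivity))
    linarith
  have hmem : ∀ k : ℕ, 1 ≤ k → η * (1 - β) * H ≤ Real.sqrt ε * ((1 - β ^ (k + 1)) -
      (1 - β ^ k) * (((1 - (c * β) ^ (k + 1)) / (1 - (c * β) ^ k)) / c)) := by
    intro k hk
    have h1 := csInf_le hbdd ⟨k + 1, by omega, rfl⟩
    have h2 := hηle.trans (mul_le_mul_of_nonneg_left h1 (by positivity))
    rw [Nat.add_sub_cancel] at h2
    have h3 := mul_le_mul_of_nonneg_right h2 (mul_pos h1β hH).le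
    calc η * (1 - β) * H = η * ((1 - β) * H) := by ring
      _ ≤ _ := h3
      _ = _ := by
        generalize (1 - (c * β) ^ (k + 1)) / (1 - (c * β) ^ k) = R
        field_simp
  rcases Nat.eq_zero_or_pos n with rfl | hn
  · refine (hmem 1 le_rfl).trans (mul_le_mul_of_nonneg_left ?_ (Real.sqrt_nonneg _))
    have h1 : (1 - (c * β) ^ (1 + 1)) / (1 - (c * β) ^ 1) = 1 + c * β := by
      rw [div_eq_iff (by rw [pow_one]; linarith)]; ring
    rw [h1]
    have h2 : (1 + c * β) / c = 1 / c + β := by field_simp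
    rw [h2]
    have h3 : 0 < (1 - β) * c⁻¹ := by positivity
    simp only [one_div, zero_add, pow_one, pow_zero, sub_self, zero_mul, sub_zero]
    nlinarith
  · exact hmem n hn

theorem preconditioner_ratio {q ε v v' : ℝ} (hq0 : 0 < q) (hq1 : q < 1) (hε : 0 < ε)
    (hv' : 0 ≤ v') (hv : q ^ 4 * v' ≤ v) {n : ℕ} (hn : 1 ≤ n) :
    q ^ 2 * Real.sqrt (v' / (1 - (q ^ 4) ^ n) + ε) ≤
      ((1 - q ^ (n + 1)) / (1 - q ^ n)) ^ 2 *
        Real.sqrt (v / (1 - (q ^ 4) ^ (n + 1)) + ε) := by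
  set y := q ^ n with hy
  have hy0 : 0 < y := pow_pos hq0 n
  have hy1 : y < 1 := pow_lt_one₀ hq0.le hq1 (by omega)
  have hz : q ^ (n + 1) = q * y := by rw [pow_succ, mul_comm]
  have hy4 : (q ^ 4) ^ n = y ^ 4 := by rw [hy, ← pow_mul, ← pow_mul, mul_comm]
  have hz4 : (q ^ 4) ^ (n + 1) = (q * y) ^ 4 := by rw [← hz, ← pow_mul, ← pow_mul, mul_comm]
  rw [hz, hy4, hz4]
  have hzy : q * y < y := by nlinarith
  have hz0 : 0 < q * y := by positivity
  generalize q * y = z at *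
  have ha : 0 < 1 - y ^ 4 := by linarith [pow_lt_one₀ hy0.le hy1 (show 4 ≠ 0 by norm_num)]
  have hb : 0 < 1 - z ^ 4 := by
    linarith [pow_lt_one₀ hz0.le (hzy.trans hy1) (show 4 ≠ 0 by norm_num)]
  have h1y : 0 < 1 - y := by linarith
  set R := (1 - z) / (1 - y) with hR
  have hR1 : 1 ≤ R := by rw [hR, le_div_iff₀ h1y]; linarith
  have hR4 : R ≤ R ^ 4 := le_self_pow₀ hR1 (by norm_num)
  have hba : (1 - z ^ 4) / (1 - y ^ 4) ≤ R := by
    rw [hR, div_le_div_iff₀ ha h1y]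
    have h1 : (1 + z) * (1 + z ^ 2) ≤ (1 + y) * (1 + y ^ 2) := by gcongr
    have h2 := mul_le_mul_of_nonneg_left h1 (show 0 ≤ (1 - z) * (1 - y) from
      mul_nonneg (by linarith) h1y.le)
    nlinarith
  have hq4 : q ^ 4 ≤ 1 := pow_le_one₀ hq0.le hq1.le
  have hmain : q ^ 4 * (v' / (1 - y ^ 4) + ε) ≤ R ^ 4 * (v / (1 - z ^ 4) + ε) := by
    have hv0 : 0 ≤ v := le_trans (by positivity) hv
    have h1 : q ^ 4 * (v' / (1 - y ^ 4)) ≤ R ^ 4 * (v / (1 - z ^ 4)) := by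
      calc q ^ 4 * (v' / (1 - y ^ 4)) = q ^ 4 * v' / (1 - y ^ 4) := by ring
        _ ≤ v / (1 - y ^ 4) := by gcongr
        _ = (1 - z ^ 4) / (1 - y ^ 4) * (v / (1 - z ^ 4)) := by field_simp
        _ ≤ R ^ 4 * (v / (1 - z ^ 4)) := by
          gcongr
          exact hba.trans hR4
    nlinarith
  have hl : q ^ 2 * Real.sqrt (v' / (1 - y ^ 4) + ε) =
      Real.sqrt (q ^ 4 * (v' / (1 - y ^ 4) + ε)) := by
    rw [Real.sqrt_mul (by positivity), show q ^ 4 = (q ^ 2) ^ 2 by ring,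
      Real.sqrt_sq (by positivity)]
  have hr : R ^ 2 * Real.sqrt (v / (1 - z ^ 4) + ε) =
      Real.sqrt (R ^ 4 * (v / (1 - z ^ 4) + ε)) := by
    rw [Real.sqrt_mul (by positivity), show R ^ 4 = (R ^ 2) ^ 2 by ring,
      Real.sqrt_sq (by positivity)]
  rw [hl, hr]
  exact Real.sqrt_le_sqrt hmain

theorem coordinate_energy_step {η β c H e p p₁ R D D' g a b m m' : ℝ} (hη : 0 < η) (hβ1 : β < 1)
    (hc : 1 < c) (hH : 0 ≤ H) (he : 0 < e) (hp : 0 ≤ p)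
    (hD : e ≤ D) (hD' : 0 ≤ D')
    (hratio : p = 0 ∨ (0 < R ∧ (c * β) ^ 2 * D' ≤ R ^ 2 * D))
    (hm : m = β * m' + (1 - β) * g) (hmb : η * m = -(p₁ * (D * b)))
    (hma : η * m' = -(p * (D' * a)))
    (hrate : η * (1 - β) * H ≤ e * (p₁ - p * (R / c))) :
    g * b + H * b ^ 2 / 2 ≤
      R / c * (p / (2 * η * (1 - β)) * (D' * a ^ 2)) - p₁ / (2 * η * (1 - β)) * (D * b ^ 2) := by
  have h1β : 0 < 1 - β := by linarith
  have hc0 : 0 < c := by linarith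
  have hcross : 2 * (β * p * (D' * a * b)) ≤ p * (R / c) * (D' * a ^ 2 + D * b ^ 2) := by
    rcases hratio with rfl | ⟨hR, hr⟩
    · simp
    · have h1 : 2 * (c * β * (D' * a * b)) ≤ R * (D' * a ^ 2 + D * b ^ 2) := by
        have h2 := mul_le_mul_of_nonneg_right hr (sq_nonneg b)
        have h3 := mul_nonneg hD' (sq_nonneg (R * a - c * β * b))
        refine le_of_mul_le_mul_left ?_ hR
        nlinarith
      have h4 := mul_le_mul_of_nonneg_left h1 (div_nonneg hp hc0.le)
      calc 2 * (β * p * (D' * a * b)) = p / c * (2 * (c * β * (D' * a * b))) := by field_simp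
        _ ≤ _ := h4
        _ = _ := by ring
  have hrate2 : η * (1 - β) * H * b ^ 2 ≤ (p₁ - p * (R / c)) * (D * b ^ 2) := by
    have h0 : 0 ≤ p₁ - p * (R / c) := by
      have : 0 ≤ e * (p₁ - p * (R / c)) := le_trans (by positivity) hrate
      exact nonneg_of_mul_nonneg_right this he
    calc η * (1 - β) * H * b ^ 2 ≤ e * (p₁ - p * (R / c)) * b ^ 2 := by gcongr
      _ ≤ D * (p₁ - p * (R / c)) * b ^ 2 := by gcongr
      _ = _ := by ring
  have hg : η * (1 - β) * g = -(p₁ * (D * b)) + β * (p * (D' * a)) := by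
    have : η * m = β * (η * m') + η * (1 - β) * g := by rw [hm]; ring
    rw [hmb, hma] at this
    linarith
  have hK : 0 < 2 * η * (1 - β) := by positivity
  refine le_of_mul_le_mul_left ?_ hK
  have hrhs : 2 * η * (1 - β) * (R / c * (p / (2 * η * (1 - β)) * (D' * a ^ 2)) -
      p₁ / (2 * η * (1 - β)) * (D * b ^ 2)) = p * (R / c) * (D' * a ^ 2) - p₁ * (D * b ^ 2) := by
    field_simp
  rw [hrhs]
  have hgb : 2 * (η * (1 - β) * g) * b =
      2 * (-(p₁ * (D * b)) + β * (p * (D' * a))) * b := by rw [hg]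
  nlinarith

theorem energy_bound_and_tendsto {l e : ℕ → ℝ} {q c : ℝ} (hq0 : 0 < q) (hq1 : q < 1) (hc : 1 < c)
    (hl : ∀ n, 0 < l n) (he : ∀ n, 0 ≤ e n) (he0 : e 0 = 0)
    (hstep : ∀ n, l n < l 0 / (1 - q) →
      l n + (1 - q ^ (n + 1)) / (1 - q ^ n) / c * e n - e (n + 1) < l 0 / (1 - q) →
      l (n + 1) + e (n + 1) ≤ l n + (1 - q ^ (n + 1)) / (1 - q ^ n) / c * e n) :
    (∀ n, l n < l 0 / (1 - q)) ∧ Tendsto e atTop (𝓝 0) := by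
  set M := l 0 / (1 - q) with hM
  have h1q : 0 < 1 - q := by linarith
  have hM0 : 0 < M := div_pos (hl 0) h1q
  have hMq : M * (1 - q) = l 0 := by rw [hM]; field_simp
  have hl0 : l 0 < M := by nlinarith
  have hpow : ∀ n : ℕ, 0 < 1 - q ^ (n + 1) := fun n =>
    sub_pos.2 (pow_lt_one₀ hq0.le hq1 (by omega))
  have hinv : ∀ n, l (n + 1) + e (n + 1) ≤ M * (1 - q ^ (n + 1)) ∧
      l (n + 1) + e (n + 1) ≤ l n + (1 - q ^ (n + 1)) / (1 - q ^ n) / c * e n := by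
    intro n
    induction n with
    | zero =>
      have h := hstep 0 hl0 (by rw [he0]; linarith [he (0 + 1)])
      refine ⟨?_, h⟩
      rw [he0, mul_zero, add_zero] at h
      rw [zero_add, pow_one, hMq]
      exact h
    | succ n ih =>
      have hq' : 0 < q ^ (n + 1) := pow_pos hq0 _
      have hlM : l (n + 1) < M := by nlinarith [he (n + 1), ih.1]
      have hR1 : 1 ≤ (1 - q ^ (n + 1 + 1)) / (1 - q ^ (n + 1)) := by
        rw [le_div_iff₀ (hpow n), pow_succ q (n + 1)]
        nlinarith
      have hbd : l (n + 1) + (1 - q ^ (n + 1 + 1)) / (1 - q ^ (n + 1)) / c * e (n + 1) ≤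
          M * (1 - q ^ (n + 1 + 1)) := by
        have h3 : (1 - q ^ (n + 1 + 1)) / (1 - q ^ (n + 1)) / c ≤
            (1 - q ^ (n + 1 + 1)) / (1 - q ^ (n + 1)) := div_le_self (by linarith) hc.le
        have h4 : (1 - q ^ (n + 1 + 1)) / (1 - q ^ (n + 1)) * (M * (1 - q ^ (n + 1))) =
            M * (1 - q ^ (n + 1 + 1)) := by
          have := (hpow n).ne'
          field_simp
        rw [← h4]
        calc _ ≤ (1 - q ^ (n + 1 + 1)) / (1 - q ^ (n + 1)) * l (n + 1) +
              (1 - q ^ (n + 1 + 1)) / (1 - q ^ (n + 1)) * e (n + 1) :=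
            add_le_add (le_mul_of_one_le_left (hl _).le hR1)
              (mul_le_mul_of_nonneg_right h3 (he _))
          _ = (1 - q ^ (n + 1 + 1)) / (1 - q ^ (n + 1)) * (l (n + 1) + e (n + 1)) := by ring
          _ ≤ _ := mul_le_mul_of_nonneg_left ih.1 (by linarith)
      have h := hstep (n + 1) hlM (by nlinarith [he (n + 1 + 1), pow_pos hq0 (n + 1 + 1)])
      exact ⟨h.trans hbd, h⟩
  refine ⟨fun n => ?_, ?_⟩
  · cases n with
    | zero => exact hl0
    | succ n => nlinarith [he (n + 1), (hinv n).1, pow_pos hq0 (n + 1)]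
  · have hR : Tendsto (fun n : ℕ => (1 - q ^ (n + 1)) / (1 - q ^ n) / c) atTop
        (𝓝 ((1 - 0) / (1 - 0) / c)) := by
      have h1 := tendsto_pow_atTop_nhds_zero_of_lt_one hq0.le hq1
      exact (((h1.comp (tendsto_add_atTop_nat 1)).const_sub 1).div (h1.const_sub 1)
        (by norm_num)).div_const c
    have hc1 : 1 / c < 1 := by rw [div_lt_one (by linarith)]; exact hc
    set θ := (1 + 1 / c) / 2 with hθ
    have hθ1 : θ < 1 := by linarith
    have hRlt : ((1 : ℝ) - 0) / (1 - 0) / c < θ := by norm_num at hθ hc1 ⊢; linarith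
    obtain ⟨T, hT⟩ := eventually_atTop.1 (hR.eventually (gt_mem_nhds hRlt))
    have hdec : ∀ n, T ≤ n → l (n + 1) + e (n + 1) + (1 - θ) * e n ≤ l n + e n := by
      intro n hn
      have h1 := mul_le_mul_of_nonneg_right (hT n hn).le (he n)
      linarith [(hinv n).2]
    have hanti : Antitone (fun k => l (T + k) + e (T + k)) := by
      refine antitone_nat_of_succ_le fun k => ?_
      have := hdec (T + k) (by omega)
      have h2 := mul_nonneg (sub_nonneg.2 hθ1.le) (he (T + k))
      rw [← add_assoc]
      linarith
    have hlim := tendsto_atTop_ciInf hanti ⟨0, by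
      rintro _ ⟨k, rfl⟩
      exact add_nonneg (hl _).le (he _)⟩
    have hdiff := (hlim.sub (hlim.comp (tendsto_add_atTop_nat 1))).div_const (1 - θ)
    rw [sub_self, zero_div] at hdiff
    have hsh : Tendsto (fun k => e (k + T)) atTop (𝓝 0) := by
      refine squeeze_zero (fun k => he _) (fun k => ?_) hdiff
      rw [le_div_iff₀ (by linarith)]
      have := hdec (T + k) (by omega)
      simp only [Function.comp]
      rw [← add_assoc, add_comm k T]
      linarith
    exact (tendsto_add_atTop_iff_nat T).1 hsh

theorem EuclideanSpace.tendsto_zero_of_forall_apply {d : ℕ} {α : Type*} {F : Filter α}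
    {f : α → EuclideanSpace ℝ (Fin d)} (h : ∀ j, Tendsto (fun t => f t j) F (𝓝 0)) :
    Tendsto f F (𝓝 0) := by
  rw [tendsto_zero_iff_norm_tendsto_zero]
  have h1 : Tendsto (fun t => Real.sqrt (∑ j, (f t j) ^ 2)) F (𝓝 (Real.sqrt (∑ _j : Fin d, 0 ^ 2))) :=
    (tendsto_finsetSum _ fun j _ => (h j).pow 2).sqrt
  simpa [EuclideanSpace.norm_eq] using h1

theorem EuclideanSpace.tendsto_apply_zero {d : ℕ} {α : Type*} {F : Filter α}
    {f : α → EuclideanSpace ℝ (Fin d)} (h : Tendsto f F (𝓝 0)) (j : Fin d) :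
    Tendsto (fun t => f t j) F (𝓝 0) :=
  squeeze_zero_norm (fun t => PiLp.norm_apply_le (f t) j) (tendsto_zero_iff_norm_tendsto_zero.1 h)

theorem EuclideanSpace.inner_eq_sum {d : ℕ} (u v : EuclideanSpace ℝ (Fin d)) :
    ⟪u, v⟫ = ∑ j, u j * v j := by
  rw [PiLp.inner_apply]
  exact Finset.sum_congr rfl fun j _ => by simp [mul_comm]

theorem adam_second_moment_nonneg {d : ℕ} {G ν : ℕ → EuclideanSpace ℝ (Fin d)} {β₂ : ℝ}
    (hβ0 : 0 < β₂) (hβ1 : β₂ < 1) (hν0 : ν 0 = 0)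
    (hνrec : ∀ t : ℕ, 1 ≤ t → ∀ j, ν t j = β₂ * ν (t - 1) j + (1 - β₂) * (G t j) ^ 2)
    (t : ℕ) (j : Fin d) : 0 ≤ ν t j := by
  induction t with
  | zero => simp [hν0]
  | succ t ih =>
    rw [hνrec (t + 1) (by omega), Nat.add_sub_cancel]
    exact add_nonneg (mul_nonneg hβ0.le ih) (mul_nonneg (by linarith) (sq_nonneg _))

theorem adam_second_moment_le {d : ℕ} {G ν : ℕ → EuclideanSpace ℝ (Fin d)} {β₂ B : ℝ}
    (hβ0 : 0 < β₂) (hβ1 : β₂ < 1) (hν0 : ν 0 = 0)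
    (hνrec : ∀ t : ℕ, 1 ≤ t → ∀ j, ν t j = β₂ * ν (t - 1) j + (1 - β₂) * (G t j) ^ 2)
    (hG : ∀ t, 1 ≤ t → ‖G t‖ ≤ B) (t : ℕ) (j : Fin d) : ν t j ≤ B ^ 2 := by
  induction t with
  | zero => simp [hν0, sq_nonneg]
  | succ t ih =>
    rw [hνrec (t + 1) (by omega), Nat.add_sub_cancel]
    have h1 : (G (t + 1) j) ^ 2 ≤ B ^ 2 := by
      have h0 := (PiLp.norm_apply_le (G (t + 1)) j).trans (hG (t + 1) (by omega))
      rw [Real.norm_eq_abs] at h0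
      exact sq_le_sq' (abs_le.1 h0).1 (abs_le.1 h0).2
    have h2 := mul_le_mul_of_nonneg_left ih hβ0.le
    have h3 := mul_le_mul_of_nonneg_left h1 (show 0 ≤ 1 - β₂ by linarith)
    linarith

theorem adam_step_and_grad_tendsto {d : ℕ}
    {L : EuclideanSpace ℝ (Fin d) → ℝ}
    {gradL : EuclideanSpace ℝ (Fin d) → EuclideanSpace ℝ (Fin d)}
    (hLpos : ∀ u, 0 < L u)
    (hline : ∀ (u v : EuclideanSpace ℝ (Fin d)) (s : ℝ),
      HasDerivAt (fun s : ℝ => L (u + s • v)) ⟪gradL (u + s • v), v⟫ s)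
    {η β₁ ε cA : ℝ} (hη : 0 < η) (hε : 0 < ε)
    (hβ₁pos : 0 < β₁) (hβ₁lt : β₁ < 1) (hcA : 1 < cA) (hcβ : cA * β₁ < 1)
    {w m ν : ℕ → EuclideanSpace ℝ (Fin d)}
    (hm0 : m 0 = 0) (hν0 : ν 0 = 0)
    (hmrec : ∀ t : ℕ, 1 ≤ t → ∀ j, m t j = β₁ * m (t - 1) j + (1 - β₁) * gradL (w t) j)
    (hνrec : ∀ t : ℕ, 1 ≤ t → ∀ j,
      ν t j = (cA * β₁) ^ 4 * ν (t - 1) j + (1 - (cA * β₁) ^ 4) * (gradL (w t) j) ^ 2)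
    (hwrec : ∀ t : ℕ, 1 ≤ t → ∀ j, w (t + 1) j = w t j -
      η * (m t j / (1 - β₁ ^ t)) / Real.sqrt (ν t j / (1 - ((cA * β₁) ^ 4) ^ t) + ε))
    {H B : ℝ} (hH : 0 < H)
    (hlip : ∀ u v : EuclideanSpace ℝ (Fin d),
      L u ≤ L (w 1) / (1 - cA * β₁) → L v ≤ L (w 1) / (1 - cA * β₁) →
      ‖gradL u - gradL v‖ ≤ H * ‖u - v‖)
    (hB : ∀ u, L u ≤ L (w 1) / (1 - cA * β₁) → ‖gradL u‖ ≤ B)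
    (hrate : ∀ n : ℕ, η * (1 - β₁) * H ≤ Real.sqrt ε * ((1 - β₁ ^ (n + 1)) -
      (1 - β₁ ^ n) * (((1 - (cA * β₁) ^ (n + 1)) / (1 - (cA * β₁) ^ n)) / cA))) :
    Tendsto (fun t => w (t + 1) - w t) atTop (𝓝 0) ∧
      Tendsto (fun t => gradL (w t)) atTop (𝓝 0) := by
  have hq0 : 0 < cA * β₁ := by positivity
  have hq40 : 0 < (cA * β₁) ^ 4 := by positivity
  have hq41 : (cA * β₁) ^ 4 < 1 := pow_lt_one₀ hq0.le hcβ (by norm_num)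
  have h1β : 0 < 1 - β₁ := by linarith
  have hνnn := adam_second_moment_nonneg (G := fun t => gradL (w t)) hq40 hq41 hν0 hνrec
  have hpow : ∀ n : ℕ, 0 ≤ 1 - β₁ ^ n := fun n => sub_nonneg.2 (pow_le_one₀ hβ₁pos.le hβ₁lt.le)
  have hpow1 : ∀ n : ℕ, 1 ≤ n → 1 - β₁ ≤ 1 - β₁ ^ n := by
    intro n hn
    have : β₁ ^ n ≤ β₁ := by simpa using pow_le_pow_of_le_one hβ₁pos.le hβ₁lt.le hn
    linarith
  have hpow2 : ∀ n : ℕ, 1 ≤ n → 1 - (cA * β₁) ^ 4 ≤ 1 - ((cA * β₁) ^ 4) ^ n := by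
    intro n hn
    have : ((cA * β₁) ^ 4) ^ n ≤ (cA * β₁) ^ 4 := by
      simpa using pow_le_pow_of_le_one hq40.le hq41.le hn
    linarith
  set D : ℕ → Fin d → ℝ := fun t j =>
    Real.sqrt (ν t j / (1 - ((cA * β₁) ^ 4) ^ t) + ε) with hD
  have hνhat : ∀ t j, 0 ≤ ν t j / (1 - ((cA * β₁) ^ 4) ^ t) := fun t j =>
    div_nonneg (hνnn t j) (sub_nonneg.2 (pow_le_one₀ hq40.le hq41.le))
  have hDε : ∀ t j, Real.sqrt ε ≤ D t j := fun t j =>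
    Real.sqrt_le_sqrt (by linarith [hνhat t j])
  have hsε : 0 < Real.sqrt ε := Real.sqrt_pos.2 hε
  have hD0 : ∀ t j, 0 < D t j := fun t j => hsε.trans_le (hDε t j)
  have hmD : ∀ t j, η * m t j = -((1 - β₁ ^ t) * (D t j * (w (t + 1) - w t) j)) := by
    intro t j
    rcases Nat.eq_zero_or_pos t with rfl | ht
    · simp [hm0]
    · rw [PiLp.sub_apply, hwrec t ht j]
      change _ = -((1 - β₁ ^ t) * (D t j * (w t j - η * (m t j / (1 - β₁ ^ t)) / D t j - w t j)))
      have h1 := (hD0 t j).ne'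
      have h2 : 1 - β₁ ^ t ≠ 0 := by linarith [hpow1 t ht]
      field_simp
      ring
  set e : ℕ → ℝ := fun n =>
    ∑ j, (1 - β₁ ^ n) / (2 * η * (1 - β₁)) * (D n j * ((w (n + 1) - w n) j) ^ 2) with he
  have he0 : ∀ n, 0 ≤ e n := fun n => Finset.sum_nonneg fun j _ =>
    mul_nonneg (div_nonneg (hpow n) (by positivity)) (mul_nonneg (hD0 n j).le (sq_nonneg _))
  have hquad : ∀ n, ⟪gradL (w (n + 1)), w (n + 1 + 1) - w (n + 1)⟫ +
      H * ‖w (n + 1 + 1) - w (n + 1)‖ ^ 2 / 2 ≤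
      (1 - (cA * β₁) ^ (n + 1)) / (1 - (cA * β₁) ^ n) / cA * e n - e (n + 1) := by
    intro n
    rw [EuclideanSpace.inner_eq_sum, EuclideanSpace.real_norm_sq_eq, Finset.mul_sum,
      Finset.sum_div, ← Finset.sum_add_distrib, he]
    simp only
    rw [Finset.mul_sum, ← Finset.sum_sub_distrib]
    refine Finset.sum_le_sum fun j _ => ?_
    refine coordinate_energy_step hη hβ₁lt hcA hH.le hsε (hpow n) (hDε (n + 1) j) (hD0 n j).le ?_
      (by simpa using hmrec (n + 1) (by omega) j) (hmD (n + 1) j) (hmD n j) (hrate n)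
    rcases Nat.eq_zero_or_pos n with rfl | hn
    · left; simp
    · right
      refine ⟨div_pos (sub_pos.2 (pow_lt_one₀ hq0.le hcβ (by omega)))
        (sub_pos.2 (pow_lt_one₀ hq0.le hcβ (by omega))), ?_⟩
      refine preconditioner_ratio hq0 hcβ hε (hνnn n j) ?_ hn
      rw [hνrec (n + 1) (by omega), Nat.add_sub_cancel]
      exact le_add_of_nonneg_right (mul_nonneg (by linarith) (sq_nonneg _))
  obtain ⟨hsub, hetend⟩ := energy_bound_and_tendsto (l := fun n => L (w (n + 1))) (e := e)
    hq0 hcβ hcA (fun n => hLpos _) he0 (by simp [he]) (by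
      intro n h1 h2
      have hq := hquad n
      have h3 := loss_add_le_of_lipschitz_sublevel hline hH.le hlip
        (u := w (n + 1)) (v := w (n + 1 + 1) - w (n + 1)) h1 (lt_of_le_of_lt (by linarith) h2)
      rw [add_sub_cancel] at h3
      linarith)
  have hstep : Tendsto (fun t => w (t + 1) - w t) atTop (𝓝 0) := by
    have hlim := (hetend.const_mul (2 * η / Real.sqrt ε)).sqrt
    rw [mul_zero, Real.sqrt_zero] at hlim
    rw [tendsto_zero_iff_norm_tendsto_zero]
    refine squeeze_zero' (Eventually.of_forall fun _ => norm_nonneg _) ?_ hlim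
    filter_upwards [eventually_ge_atTop 1] with n hn
    refine Real.le_sqrt_of_sq_le ?_
    rw [EuclideanSpace.real_norm_sq_eq, he]
    simp only
    rw [Finset.mul_sum]
    refine Finset.sum_le_sum fun j _ => ?_
    have h1 : (1 : ℝ) ≤ (1 - β₁ ^ n) / (1 - β₁) := by
      rw [le_div_iff₀ h1β]; linarith [hpow1 n hn]
    have h2 : (1 : ℝ) ≤ D n j / Real.sqrt ε := by
      rw [le_div_iff₀ hsε]; linarith [hDε n j]
    have h3 := one_le_mul_of_one_le_of_one_le h1 h2
    calc ((w (n + 1) - w n) j) ^ 2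
        ≤ (1 - β₁ ^ n) / (1 - β₁) * (D n j / Real.sqrt ε) * ((w (n + 1) - w n) j) ^ 2 :=
          le_mul_of_one_le_left (sq_nonneg _) h3
      _ = _ := by field_simp
  refine ⟨hstep, ?_⟩
  have hGB : ∀ t, 1 ≤ t → ‖gradL (w t)‖ ≤ B := by
    intro t ht
    obtain ⟨k, rfl⟩ : ∃ k, t = k + 1 := ⟨t - 1, by omega⟩
    exact hB _ (hsub k).le
  have hνB := adam_second_moment_le (G := fun t => gradL (w t)) hq40 hq41 hν0 hνrec hGB
  have hDB : ∀ t, 1 ≤ t → ∀ j, D t j ≤ Real.sqrt (B ^ 2 / (1 - (cA * β₁) ^ 4) + ε) := by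
    intro t ht j
    refine Real.sqrt_le_sqrt (add_le_add_left ?_ _)
    exact div_le_div₀ (sq_nonneg _) (hνB t j) (by linarith) (hpow2 t ht)
  have hmtend : ∀ j, Tendsto (fun t => m t j) atTop (𝓝 0) := by
    intro j
    have hlim := ((EuclideanSpace.tendsto_apply_zero hstep j).abs).const_mul
      (Real.sqrt (B ^ 2 / (1 - (cA * β₁) ^ 4) + ε) / η)
    rw [abs_zero, mul_zero] at hlim
    refine squeeze_zero_norm' ?_ hlim
    filter_upwards [eventually_ge_atTop 1] with t ht
    rw [Real.norm_eq_abs, div_mul_eq_mul_div, le_div_iff₀ hη, mul_comm |m t j|]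
    nth_rewrite 1 [← abs_of_pos hη]
    rw [← abs_mul, hmD, abs_neg, abs_mul, abs_mul, abs_of_nonneg (hpow t),
      abs_of_pos (hD0 t j)]
    have h1 : 1 - β₁ ^ t ≤ 1 := by linarith [pow_pos hβ₁pos t]
    calc (1 - β₁ ^ t) * (D t j * |(w (t + 1) - w t) j|)
        ≤ 1 * (D t j * |(w (t + 1) - w t) j|) :=
          mul_le_mul_of_nonneg_right h1 (mul_nonneg (hD0 t j).le (abs_nonneg _))
      _ ≤ _ := by
          rw [one_mul]
          exact mul_le_mul_of_nonneg_right (hDB t ht j) (abs_nonneg _)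
  refine EuclideanSpace.tendsto_zero_of_forall_apply fun j => ?_
  have hlim := ((hmtend j).comp (tendsto_add_atTop_nat 1)).sub ((hmtend j).const_mul β₁)
  have hlim2 := hlim.div_const (1 - β₁)
  rw [mul_zero, sub_zero, zero_div] at hlim2
  refine (tendsto_add_atTop_iff_nat 1).1 (hlim2.congr fun t => ?_)
  rw [Function.comp, hmrec (t + 1) (by omega), Nat.add_sub_cancel]
  field_simp
  ring

/-- Adam steps are asymptotically aligned with the negative gradient once gradients vary slowly
relative to their size. -/
theorem adam_step_aligned {d : ℕ} {G Δ m ν : ℕ → EuclideanSpace ℝ (Fin d)}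
    {η β₁ β₂ ε : ℝ} (hε : 0 < ε) (hβ₁pos : 0 < β₁) (hβ₁lt : β₁ < 1)
    (hβ₂pos : 0 < β₂) (hβ₂lt : β₂ < 1) (hν0 : ν 0 = 0)
    (hmrec : ∀ t : ℕ, 1 ≤ t → ∀ j, m t j = β₁ * m (t - 1) j + (1 - β₁) * G t j)
    (hνrec : ∀ t : ℕ, 1 ≤ t → ∀ j, ν t j = β₂ * ν (t - 1) j + (1 - β₂) * (G t j) ^ 2)
    (hΔ : ∀ t : ℕ, 1 ≤ t → ∀ j,
      Δ t j = -(η * (m t j / (1 - β₁ ^ t)) / Real.sqrt (ν t j / (1 - β₂ ^ t) + ε)))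
    (hGtend : Tendsto G atTop (𝓝 0)) (hGpos : ∀ t, 0 < ‖G t‖)
    (hslow : ∀ δ > 0, ∀ᶠ t in atTop, ‖G (t + 1) - G t‖ ≤ δ * ‖G (t + 1)‖) :
    Tendsto (fun t => ‖G t‖⁻¹ • (Δ t + (η / Real.sqrt ε) • G t)) atTop (𝓝 0) := by
  have h1β : 0 < 1 - β₁ := by linarith
  have hsε : 0 < Real.sqrt ε := Real.sqrt_pos.2 hε
  have hr : Tendsto (fun t => ‖m t - G t‖ / ‖G t‖) atTop (𝓝 0) := by
    refine tendsto_zero_of_contraction (a := (1 + β₁) / 2) (fun t => by positivity)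
      (by linarith) (by linarith) fun δ hδ => ?_
    have hθ : 0 < min δ ((1 - β₁) / 2) := lt_min hδ (by linarith)
    filter_upwards [hslow _ hθ] with t ht
    set θ := min δ ((1 - β₁) / 2) with hθdef
    have hθ1 : θ ≤ δ := min_le_left _ _
    have hθ2 : θ ≤ (1 - β₁) / 2 := min_le_right _ _
    have hrec : m (t + 1) - G (t + 1) = β₁ • ((m t - G t) - (G (t + 1) - G t)) := by
      ext j
      have := hmrec (t + 1) (by omega) j
      rw [Nat.add_sub_cancel] at this
      simp only [PiLp.sub_apply, PiLp.smul_apply, smul_eq_mul]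
      rw [this]; ring
    have h1 : ‖m (t + 1) - G (t + 1)‖ ≤ β₁ * (‖m t - G t‖ + θ * ‖G (t + 1)‖) := by
      rw [hrec, norm_smul, Real.norm_of_nonneg hβ₁pos.le]
      gcongr
      exact (norm_sub_le _ _).trans (by linarith)
    have h2 : ‖G t‖ ≤ (1 + θ) * ‖G (t + 1)‖ := by
      have : ‖G t‖ ≤ ‖G (t + 1)‖ + ‖G (t + 1) - G t‖ := by
        have := norm_sub_le (G (t + 1)) (G (t + 1) - G t)
        rwa [sub_sub_cancel] at this
      linarith
    have hg := hGpos t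
    have hg1 := hGpos (t + 1)
    set r := ‖m t - G t‖ / ‖G t‖ with hrdef
    have hr0 : 0 ≤ r := by positivity
    have h3 : ‖m t - G t‖ = r * ‖G t‖ := by rw [hrdef]; field_simp
    rw [div_le_iff₀ hg1]
    have h4 : r * ‖G t‖ ≤ r * ((1 + θ) * ‖G (t + 1)‖) := by gcongr
    have h5 : β₁ * (1 + θ) ≤ (1 + β₁) / 2 := by nlinarith
    have h6 : β₁ * θ ≤ δ := by nlinarith
    calc ‖m (t + 1) - G (t + 1)‖ ≤ β₁ * (r * ((1 + θ) * ‖G (t + 1)‖) + θ * ‖G (t + 1)‖) := by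
          refine h1.trans (mul_le_mul_of_nonneg_left ?_ hβ₁pos.le)
          linarith
      _ = (β₁ * (1 + θ) * r + β₁ * θ) * ‖G (t + 1)‖ := by ring
      _ ≤ ((1 + β₁) / 2 * r + δ) * ‖G (t + 1)‖ := by gcongr
  have hνtend : ∀ j, Tendsto (fun t => ν t j) atTop (𝓝 0) := by
    intro j
    refine tendsto_zero_of_contraction (a := β₂)
      (fun t => adam_second_moment_nonneg hβ₂pos hβ₂lt hν0 hνrec t j) hβ₂pos.le hβ₂lt
      fun δ hδ => ?_
    have hlim := (((EuclideanSpace.tendsto_apply_zero hGtend j).comp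
      (tendsto_add_atTop_nat 1)).pow 2).const_mul (1 - β₂)
    rw [zero_pow two_ne_zero, mul_zero] at hlim
    filter_upwards [hlim.eventually (gt_mem_nhds hδ)] with t ht
    rw [hνrec (t + 1) (by omega), Nat.add_sub_cancel]
    simp only [Function.comp] at ht
    linarith
  have hβpow : ∀ {b : ℝ}, 0 < b → b < 1 → Tendsto (fun t : ℕ => 1 - b ^ t) atTop (𝓝 1) := by
    intro b h0 h1
    simpa using (tendsto_pow_atTop_nhds_zero_of_lt_one h0.le h1).const_sub 1
  have hk : ∀ j, Tendsto
      (fun t => η / ((1 - β₁ ^ t) * Real.sqrt (ν t j / (1 - β₂ ^ t) + ε))) atTop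
      (𝓝 (η / Real.sqrt ε)) := by
    intro j
    have h1 := (((hνtend j).div (hβpow hβ₂pos hβ₂lt) one_ne_zero).add_const ε).sqrt
    have h2 := (tendsto_const_nhds (x := η)).div ((hβpow hβ₁pos hβ₁lt).mul h1) (by
      rw [zero_div, zero_add, one_mul]; exact hsε.ne')
    rw [zero_div, zero_add, one_mul] at h2
    exact h2
  refine EuclideanSpace.tendsto_zero_of_forall_apply fun j => ?_
  have hmj : Tendsto (fun t => ‖G t‖⁻¹ * (m t - G t) j) atTop (𝓝 0) := by
    refine squeeze_zero_norm (fun t => ?_) hr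
    rw [norm_mul, norm_inv, norm_norm, inv_mul_eq_div]
    gcongr
    exact PiLp.norm_apply_le _ j
  have hGj : Tendsto (fun t => (η / ((1 - β₁ ^ t) * Real.sqrt (ν t j / (1 - β₂ ^ t) + ε)) -
      η / Real.sqrt ε) * (‖G t‖⁻¹ * G t j)) atTop (𝓝 0) := by
    have h0 := ((hk j).sub_const (η / Real.sqrt ε)).abs
    rw [sub_self, abs_zero] at h0
    refine squeeze_zero_norm (fun t => ?_) h0
    rw [norm_mul, Real.norm_eq_abs]
    refine mul_le_of_le_one_right (abs_nonneg _) ?_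
    rw [norm_mul, norm_inv, norm_norm, inv_mul_le_iff₀ (hGpos t), mul_one]
    exact PiLp.norm_apply_le _ j
  have hsum := (((hk j).mul hmj).add hGj).neg
  rw [mul_zero, add_zero, neg_zero] at hsum
  refine hsum.congr' ?_
  filter_upwards [eventually_ge_atTop 1] with t ht
  simp only [PiLp.smul_apply, PiLp.add_apply, PiLp.sub_apply, smul_eq_mul]
  rw [hΔ t ht j]
  have e1 : η * (m t j / (1 - β₁ ^ t)) / Real.sqrt (ν t j / (1 - β₂ ^ t) + ε) =
      η / ((1 - β₁ ^ t) * Real.sqrt (ν t j / (1 - β₂ ^ t) + ε)) * m t j := by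
    rw [← mul_div_assoc, div_div, div_mul_eq_mul_div]
  rw [e1]
  ring

theorem le_norm_sub_of_step {E : Type*} [NormedAddCommGroup E] {w : ℕ → E} {φ : ℕ → ℝ} {a : ℝ} (ha : 0 ≤ a) {T : ℕ}
    (h : ∀ t, T ≤ t → φ (t + 1) + a * ‖w (t + 1) - w t‖ ≤ φ t) (t : ℕ) (ht : T ≤ t) :
    φ t + a * ‖w t - w T‖ ≤ φ T := by
  induction t, ht using Nat.le_induction with
  | base => simp
  | succ t ht ih =>
    have h1 := mul_le_mul_of_nonneg_left
      (norm_sub_le_norm_sub_add_norm_sub (w (t + 1)) (w t) (w T)) ha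
    linarith [h t ht]

section
variable {E : Type*} [NormedAddCommGroup E] [InnerProductSpace ℝ E] {N : ℕ}

theorem log_loss_decrease {W κ θ L₀ L₁ : ℝ} {G Δ : E} (hW : 0 < W) (hκ : 0 < κ) (hθ0 : 0 < θ)
    (hθ1 : θ ≤ 1 / 5) (hL₀ : 0 < L₀) (hL₁ : 0 < L₁)
    (hal : ‖Δ + κ • G‖ ≤ θ * κ * ‖G‖) (hdesc : L₁ - L₀ ≤ ⟪G, Δ⟫ + θ * ‖G‖ * ‖Δ‖)
    (hGL : (1 - 2 * θ) * L₀ ≤ W * ‖G‖) :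
    W * Real.log L₁ + (1 - 5 * θ) * ‖Δ‖ ≤ W * Real.log L₀ := by
  have h1 : ⟪G, Δ⟫ ≤ -((1 - θ) * κ * ‖G‖ ^ 2) := by
    have h2 := (real_inner_le_norm G (Δ + κ • G)).trans
      (mul_le_mul_of_nonneg_left hal (norm_nonneg G))
    rw [inner_add_right, real_inner_smul_right, real_inner_self_eq_norm_sq] at h2
    nlinarith
  have h3 : ‖Δ‖ ≤ (1 + θ) * (κ * ‖G‖) := by
    have h4 := norm_sub_le (Δ + κ • G) (κ • G)
    rw [add_sub_cancel_right, norm_smul κ G, Real.norm_of_nonneg hκ.le] at h4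
    linarith
  have h5 : (1 - 2 * θ) * ‖Δ‖ ≤ (1 - θ) * (κ * ‖G‖) := by
    have hk : 0 ≤ κ * ‖G‖ := by positivity
    have := mul_le_mul_of_nonneg_left h3 (show 0 ≤ 1 - 2 * θ by linarith)
    nlinarith [mul_nonneg (sq_nonneg θ) hk]
  have h6 : L₁ - L₀ ≤ -((1 - 3 * θ) * (‖G‖ * ‖Δ‖)) := by
    have := mul_le_mul_of_nonneg_left h5 (norm_nonneg G)
    nlinarith
  have h7 : W * (L₁ - L₀) ≤ -((1 - 5 * θ) * ‖Δ‖) * L₀ := by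
    have h8 := mul_le_mul_of_nonneg_left h6 hW.le
    have h9 := mul_le_mul_of_nonneg_left hGL
      (show 0 ≤ (1 - 3 * θ) * ‖Δ‖ from mul_nonneg (by linarith) (norm_nonneg _))
    have h10 : 0 ≤ θ ^ 2 * (‖Δ‖ * L₀) := by positivity
    nlinarith
  have h11 : Real.log L₁ - Real.log L₀ ≤ (L₁ - L₀) / L₀ := by
    rw [← Real.log_div hL₁.ne' hL₀.ne', sub_div, div_self hL₀.ne']
    exact Real.log_le_sub_one_of_pos (div_pos hL₁ hL₀)
  have h12 := mul_le_mul_of_nonneg_left h11 hW.le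
  rw [← mul_div_assoc] at h12
  have h13 : W * (L₁ - L₀) / L₀ ≤ -((1 - 5 * θ) * ‖Δ‖) := by
    rwa [div_le_iff₀ hL₀]
  linarith

theorem loss_apply_le {x : Fin N → E} {ℓ : ℝ → ℝ} (hN : 1 ≤ N) {L : E → ℝ}
    (hLdef : ∀ w, L w = (1 / (N : ℝ)) * ∑ i, ℓ ⟪w, x i⟫) (hℓpos : ∀ s : ℝ, 0 < ℓ s) (u : E)
    (i : Fin N) : ℓ ⟪u, x i⟫ ≤ N * L u := by
  have hN0 : (0 : ℝ) < N := by exact_mod_cast hN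
  rw [hLdef, ← mul_assoc, mul_one_div_cancel hN0.ne', one_mul]
  exact Finset.single_le_sum (f := fun i => ℓ ⟪u, x i⟫) (fun j _ => (hℓpos _).le)
    (Finset.mem_univ i)

theorem eventually_margin_ge {x : Fin N → E} (hN : 1 ≤ N) {ℓ ℓ' : ℝ → ℝ} {L : E → ℝ}
    {gradL : E → E} {wmax : E}
    (hLdef : ∀ w, L w = (1 / (N : ℝ)) * ∑ i, ℓ ⟪w, x i⟫)
    (hgraddef : ∀ w, gradL w = (1 / (N : ℝ)) • ∑ i, ℓ' ⟪w, x i⟫ • x i)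
    (hline : ∀ (u v : E) (s : ℝ), HasDerivAt (fun s : ℝ => L (u + s • v)) ⟪gradL (u + s • v), v⟫ s)
    (hpos : 0 < ‖wmax‖) (hwmax : ∀ i, 1 ≤ ⟪wmax, x i⟫)
    (hℓpos : ∀ s : ℝ, 0 < ℓ s) (hℓ'neg : ∀ s : ℝ, ℓ' s < 0) (hLpos : ∀ u, 0 < L u)
    (htail : ∀ δ > 0, ∃ S, ∀ s, S ≤ s → |-ℓ' s - Real.exp (-s)| ≤ δ * Real.exp (-s) ∧
      |ℓ s - Real.exp (-s)| ≤ δ * Real.exp (-s))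
    (hrel : ∀ δ > 0, ∃ S, ∃ h > 0, ∀ u v : E, (∀ i, S ≤ ⟪u, x i⟫) → (∀ i, S ≤ ⟪v, x i⟫) →
      ‖u - v‖ ≤ h → ‖gradL u - gradL v‖ ≤ δ * ‖gradL u‖)
    {w : ℕ → E} {κ : ℝ} (hκ : 0 < κ) (hstep : Tendsto (fun t => w (t + 1) - w t) atTop (𝓝 0))
    (hmargin : ∀ i, Tendsto (fun t => ⟪w t, x i⟫) atTop atTop)
    (hnorm : Tendsto (fun t => ‖w t‖) atTop atTop)
    (halign : ∀ δ > 0, ∀ᶠ t in atTop,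
      ‖(w (t + 1) - w t) + κ • gradL (w t)‖ ≤ δ * ‖gradL (w t)‖)
    {δ : ℝ} (hδ0 : 0 < δ) (hδ1 : δ < 1) :
    ∀ᶠ t in atTop, ∀ i, (1 - δ) * ‖w t‖ ≤ ‖wmax‖ * ⟪w t, x i⟫ := by
  have hN0 : (0 : ℝ) < N := by exact_mod_cast hN
  set θ := δ / 10 with hθ
  have hθ0 : 0 < θ := by positivity
  obtain ⟨S₁, hS₁⟩ := htail (θ / 2) (by positivity)
  obtain ⟨S₂, h, hh, hS₂⟩ := hrel θ hθ0
  have hSev : ∀ S : ℝ, ∀ᶠ t in atTop, ∀ i, S ≤ ⟪w t, x i⟫ := fun S =>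
    eventually_all.2 fun i => (hmargin i).eventually_ge_atTop S
  have hsmall : ∀ᶠ t in atTop, ‖w (t + 1) - w t‖ ≤ h := by
    filter_upwards [(tendsto_zero_iff_norm_tendsto_zero.1 hstep).eventually (gt_mem_nhds hh)]
      with t ht using ht.le
  have hdec : ∀ᶠ t in atTop, ‖wmax‖ * Real.log (L (w (t + 1))) +
      (1 - 5 * θ) * ‖w (t + 1) - w t‖ ≤ ‖wmax‖ * Real.log (L (w t)) := by
    have hS2ev := hSev S₂
    filter_upwards [hSev S₁, hS2ev, (tendsto_add_atTop_nat 1).eventually hS2ev, hsmall,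
      halign (θ * κ) (by positivity)] with t h1 h2 h2' h3 h4
    refine log_loss_decrease hpos hκ hθ0 (by rw [hθ]; linarith) (hLpos _) (hLpos _) h4 ?_ ?_
    · have := loss_sub_le_of_norm_grad_sub_le hline (u := w t) (v := w (t + 1) - w t)
        (B := θ * ‖gradL (w t)‖) ?_
      · rwa [add_sub_cancel] at this
      · intro s hs
        rw [norm_sub_rev]
        refine hS₂ _ _ h2 (fun i => ?_) ?_
        · rw [inner_add_left, real_inner_smul_left, inner_sub_left]
          nlinarith [h2 i, h2' i, hs.1, hs.2]
        · rw [sub_add_cancel_left, norm_neg, norm_smul, Real.norm_of_nonneg hs.1.le]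
          exact (mul_le_of_le_one_left (norm_nonneg _) hs.2.le).trans h3
    · refine le_trans ?_ (mean_neg_deriv_le_norm_grad hgraddef hwmax hℓ'neg (w t))
      rw [hLdef, mul_left_comm, Finset.mul_sum]
      gcongr with i _
      obtain ⟨h5, h6⟩ := hS₁ _ (h1 i)
      have h7 := (abs_le.1 h5).1
      have h8 := (abs_le.1 h6).2
      have h9 := Real.exp_pos (-⟪w t, x i⟫)
      have h10 : θ ≤ 1 / 10 := by rw [hθ]; linarith
      have h11 : ℓ ⟪w t, x i⟫ ≤ (1 + θ / 2) * Real.exp (-⟪w t, x i⟫) := by linarith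
      have h12 := mul_le_mul_of_nonneg_left h11 (show 0 ≤ 1 - 2 * θ by linarith)
      nlinarith [mul_pos hθ0 h9, mul_pos (mul_pos hθ0 hθ0) h9]
  obtain ⟨T, hT⟩ := eventually_atTop.1 hdec
  have h5θ : 0 ≤ 1 - 5 * θ := by rw [hθ]; linarith
  have hsum := le_norm_sub_of_step (φ := fun t => ‖wmax‖ * Real.log (L (w t))) h5θ hT
  set C := ‖wmax‖ * Real.log (2 * N) + ‖wmax‖ * Real.log (L (w T)) + ‖w T‖ with hC
  filter_upwards [eventually_ge_atTop T, hSev S₁, hnorm.eventually_ge_atTop (C / (5 * θ))]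
    with t ht h1 h2 i
  have h3 := (abs_le.1 (hS₁ _ (h1 i)).2).1
  have h4 := loss_apply_le hN hLdef hℓpos (w t) i
  have h9 := Real.exp_pos (-⟪w t, x i⟫)
  have h5 : Real.exp (-⟪w t, x i⟫) ≤ 2 * N * L (w t) := by
    have h10 : θ / 2 ≤ 1 / 2 := by rw [hθ]; linarith
    nlinarith
  have h6 : -⟪w t, x i⟫ ≤ Real.log (2 * N) + Real.log (L (w t)) := by
    rw [← Real.log_mul (by positivity) (hLpos _).ne']
    exact (Real.le_log_iff_exp_le (mul_pos (by positivity) (hLpos _))).2 h5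
  have h7 := mul_le_mul_of_nonneg_left h6 hpos.le
  have h8 := hsum t ht
  have h10 : ‖w t‖ - ‖w T‖ ≤ ‖w t - w T‖ := norm_sub_norm_le _ _
  have h11 := mul_le_mul_of_nonneg_left h10 h5θ
  rw [div_le_iff₀ (by positivity)] at h2
  have h12 : δ = 10 * θ := by rw [hθ]; ring
  rw [h12]
  nlinarith [mul_nonneg hθ0.le (norm_nonneg (w T))]

theorem eventually_norm_grad_succ_sub_le {x : Fin N → E} {gradL : E → E} {w : ℕ → E}
    (hrel : ∀ δ > 0, ∃ S, ∃ h > 0, ∀ u v : E, (∀ i, S ≤ ⟪u, x i⟫) → (∀ i, S ≤ ⟪v, x i⟫) →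
      ‖u - v‖ ≤ h → ‖gradL u - gradL v‖ ≤ δ * ‖gradL u‖)
    (hstep : Tendsto (fun t => w (t + 1) - w t) atTop (𝓝 0))
    (hmargin : ∀ i, Tendsto (fun t => ⟪w t, x i⟫) atTop atTop) (δ : ℝ) (hδ : 0 < δ) :
    ∀ᶠ t in atTop, ‖gradL (w (t + 1)) - gradL (w t)‖ ≤ δ * ‖gradL (w (t + 1))‖ := by
  obtain ⟨S, h, hh, hS⟩ := hrel δ hδ
  have hSev : ∀ᶠ t in atTop, ∀ i, S ≤ ⟪w t, x i⟫ :=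
    eventually_all.2 fun i => (hmargin i).eventually_ge_atTop S
  filter_upwards [hSev, (tendsto_add_atTop_nat 1).eventually hSev,
    (tendsto_zero_iff_norm_tendsto_zero.1 hstep).eventually (gt_mem_nhds hh)] with t h1 h2 h3
  exact hS _ _ h2 h1 h3.le

end

theorem stmt15
    {d N : ℕ} (hN : 1 ≤ N)
    (x : Fin N → EuclideanSpace ℝ (Fin d))
    (ℓ ℓ' : ℝ → ℝ)
    (hdiff : ∀ s : ℝ, HasDerivAt ℓ (ℓ' s) s)
    (L : EuclideanSpace ℝ (Fin d) → ℝ)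
    (hLdef : ∀ w : EuclideanSpace ℝ (Fin d), L w = (1 / (N : ℝ)) * ∑ i, ℓ ⟪w, x i⟫)
    (gradL : EuclideanSpace ℝ (Fin d) → EuclideanSpace ℝ (Fin d))
    (hgraddef : ∀ w : EuclideanSpace ℝ (Fin d),
      gradL w = (1 / (N : ℝ)) • ∑ i, ℓ' ⟪w, x i⟫ • x i)
    (hsep : ∃ u : EuclideanSpace ℝ (Fin d), ∀ i, 0 < ⟪u, x i⟫)
    (σmax : ℝ) (hσpos : 0 < σmax)
    (hσ : ∀ c : Fin N → ℝ, ‖∑ i, c i • x i‖ ≤ σmax * Real.sqrt (∑ i, (c i) ^ 2))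
    (wmax : EuclideanSpace ℝ (Fin d))
    (hwmax : ∀ i, 1 ≤ ⟪wmax, x i⟫)
    (hwmaxmin : ∀ v : EuclideanSpace ℝ (Fin d), (∀ i, 1 ≤ ⟪v, x i⟫) → ‖wmax‖ ≤ ‖v‖)
    (hℓpos : ∀ s : ℝ, 0 < ℓ s) (hℓ'neg : ∀ s : ℝ, ℓ' s < 0)
    (hℓtop : Tendsto ℓ atTop (𝓝 0))
    (hℓ'top : Tendsto ℓ' atTop (𝓝 0))
    (hℓ'bot : Filter.limsup ℓ' atBot < 0)
    (μp μm xp xm : ℝ) (hμp : 0 < μp) (hμm : 0 < μm)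
    (htailp : ∀ s : ℝ, xp < s → -ℓ' s ≤ (1 + Real.exp (-μp * s)) * Real.exp (-s))
    (htailm : ∀ s : ℝ, xm < s → (1 - Real.exp (-μm * s)) * Real.exp (-s) ≤ -ℓ' s)
    (hloc : ∀ s : ℝ, ∃ H : ℝ, 0 < H ∧
      ∀ a b : ℝ, s ≤ a → s ≤ b → |ℓ' a - ℓ' b| ≤ H * |a - b|)
    (η β₁ β₂ ε cA : ℝ) (hη : 0 < η) (hε : 0 < ε)
    (hβ₁pos : 0 < β₁) (hβ₁lt : β₁ < 1) (hcA : 1 < cA) (hcβ : cA * β₁ < 1)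
    (hβ₂ : β₂ = (cA * β₁) ^ 4)
    (w m ν : ℕ → EuclideanSpace ℝ (Fin d))
    (hm0 : m 0 = 0) (hν0 : ν 0 = 0) (hw0 : w 0 = w 1)
    (hmrec : ∀ t : ℕ, 1 ≤ t → ∀ j, m t j = β₁ * m (t - 1) j + (1 - β₁) * gradL (w t) j)
    (hνrec : ∀ t : ℕ, 1 ≤ t → ∀ j, ν t j = β₂ * ν (t - 1) j + (1 - β₂) * (gradL (w t) j) ^ 2)
    (hwrec : ∀ t : ℕ, 1 ≤ t → ∀ j,
      w (t + 1) j = w t j - η * (m t j / (1 - β₁ ^ t)) / Real.sqrt (ν t j / (1 - β₂ ^ t) + ε))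
    (H_L : ℝ) (hH_Lpos : 0 < H_L)
    (hH_L : ∀ u v : EuclideanSpace ℝ (Fin d),
      L u ≤ L (w 1) / (1 - cA * β₁) → L v ≤ L (w 1) / (1 - cA * β₁) →
      ‖gradL u - gradL v‖ ≤ H_L * ‖u - v‖)
    (hηle : η ≤ (Real.sqrt ε / H_L) *
      sInf {y : ℝ | ∃ t : ℕ, 2 ≤ t ∧
        y = (1 - β₁ ^ t) / (1 - β₁) -
          ((1 - β₁ ^ (t - 1)) / (cA * (1 - β₁))) *
            ((1 - (cA * β₁) ^ t) / (1 - (cA * β₁) ^ (t - 1)))})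
    :
    Tendsto (fun t : ℕ => ‖w t‖) atTop atTop ∧
    Tendsto (fun t : ℕ => ‖w t‖⁻¹ • w t) atTop (𝓝 (‖wmax‖⁻¹ • wmax)) := by
  subst hβ₂
  have hN0 : (0 : ℝ) < N := by exact_mod_cast hN
  have hne : (Finset.univ : Finset (Fin N)).Nonempty := ⟨⟨0, hN⟩, Finset.mem_univ _⟩
  have hq0 : 0 < cA * β₁ := by positivity
  have hline := hasDerivAt_loss_line hdiff hLdef hgraddef
  have hLpos : ∀ u, 0 < L u := fun u => by
    rw [hLdef]
    exact mul_pos (by positivity) (Finset.sum_pos (fun i _ => hℓpos _) hne)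
  have hcont := continuous_of_locally_smooth hloc
  obtain ⟨s₀, hs₀⟩ := exists_lower_bound_of_le hdiff hℓpos hℓ'bot
    (N * (L (w 1) / (1 - cA * β₁)))
  obtain ⟨B, hB0, hB⟩ := exists_abs_le_of_tendsto_zero hcont hℓ'top s₀
  have hgradB : ∀ u, L u ≤ L (w 1) / (1 - cA * β₁) → ‖gradL u‖ ≤ B * (1 + ∑ j, ‖x j‖) := by
    intro u hu
    rw [hgraddef]
    refine norm_mean_smul_le hN (norm_le_one_add_sum x) hB0 fun i => hB _ (hs₀ _ ?_)
    exact (loss_apply_le hN hLdef hℓpos u i).trans (mul_le_mul_of_nonneg_left hu hN0.le)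
  have hrate := learning_rate_le hH_Lpos hβ₁pos hβ₁lt hcA hcβ hηle
  obtain ⟨hstep, hgrad⟩ := adam_step_and_grad_tendsto hLpos hline hη hε hβ₁pos hβ₁lt hcA hcβ
    hm0 hν0 hmrec hνrec hwrec hH_Lpos hH_L hgradB hrate
  have hPG := mean_neg_deriv_le_norm_grad hgraddef hwmax hℓ'neg
  have hPpos : ∀ u, 0 < (1 / (N : ℝ)) * ∑ i, -ℓ' ⟪u, x i⟫ := fun u =>
    mul_pos (by positivity) (Finset.sum_pos (fun i _ => neg_pos.2 (hℓ'neg _)) hne)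
  have hGpos : ∀ u, 0 < ‖gradL u‖ := fun u =>
    pos_of_mul_pos_right ((hPpos u).trans_le (hPG u)) (norm_nonneg _)
  have hWpos : 0 < ‖wmax‖ := by
    refine norm_pos_iff.2 fun h0 => ?_
    have := hwmax ⟨0, hN⟩
    rw [h0, inner_zero_left] at this
    linarith
  have hmargin : ∀ i, Tendsto (fun t => ⟪w t, x i⟫) atTop atTop := by
    intro i
    refine tendsto_atTop_of_neg_continuous hcont hℓ'neg hℓ'bot ?_
    have hlim := (tendsto_zero_iff_norm_tendsto_zero.1 hgrad).const_mul (N * ‖wmax‖)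
    rw [mul_zero] at hlim
    refine squeeze_zero_norm (fun t => ?_) hlim
    rw [Real.norm_of_nonpos (hℓ'neg _).le, mul_assoc]
    have h1 := hPG (w t)
    rw [one_div, inv_mul_le_iff₀ hN0] at h1
    exact (Finset.single_le_sum (f := fun i => -ℓ' ⟪w t, x i⟫)
      (fun j _ => (neg_pos.2 (hℓ'neg _)).le) (Finset.mem_univ i)).trans h1
  have hnorm : Tendsto (fun t : ℕ => ‖w t‖) atTop atTop := by
    have hx : 0 < 1 + ∑ j, ‖x j‖ :=
      add_pos_of_pos_of_nonneg one_pos (Finset.sum_nonneg fun j _ => norm_nonneg _)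
    refine tendsto_atTop_mono (fun t => ?_) ((hmargin ⟨0, hN⟩).atTop_div_const hx)
    rw [div_le_iff₀ hx]
    exact (real_inner_le_norm _ _).trans
      (mul_le_mul_of_nonneg_left (norm_le_one_add_sum x _) (norm_nonneg _))
  have htail : ∀ δ > 0, ∃ S, ∀ s, S ≤ s → |-ℓ' s - Real.exp (-s)| ≤ δ * Real.exp (-s) ∧
      |ℓ s - Real.exp (-s)| ≤ δ * Real.exp (-s) := fun δ hδ =>
    exists_abs_sub_exp_neg_le hdiff hℓtop hμp hμm htailp htailm hδ
  have hrel : ∀ δ > 0, ∃ S, ∃ h > 0, ∀ u v : EuclideanSpace ℝ (Fin d),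
      (∀ i, S ≤ ⟪u, x i⟫) → (∀ i, S ≤ ⟪v, x i⟫) →
      ‖u - v‖ ≤ h → ‖gradL u - gradL v‖ ≤ δ * ‖gradL u‖ := fun δ hδ =>
    exists_norm_grad_sub_le hgraddef hwmax hℓ'neg (fun θ hθ =>
      exists_abs_sub_le_mul_of_abs_sub_exp_neg_le (fun ρ hρ =>
        (htail ρ hρ).imp fun S hS s hs => (hS s hs).1) hθ) hδ
  have hslow : ∀ δ > 0, ∀ᶠ t in atTop,
      ‖gradL (w (t + 1)) - gradL (w t)‖ ≤ δ * ‖gradL (w (t + 1))‖ :=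
    eventually_norm_grad_succ_sub_le hrel hstep hmargin
  have halign := adam_step_aligned (Δ := fun t => w (t + 1) - w t) (G := fun t => gradL (w t))
    hε hβ₁pos hβ₁lt (by positivity) (pow_lt_one₀ hq0.le hcβ (by norm_num)) hν0 hmrec hνrec
    (fun t ht j => by rw [PiLp.sub_apply, hwrec t ht j, sub_sub_cancel_left]) hgrad
    (fun t => hGpos _) hslow
  have halign' : ∀ δ > 0, ∀ᶠ t in atTop,
      ‖(w (t + 1) - w t) + (η / Real.sqrt ε) • gradL (w t)‖ ≤ δ * ‖gradL (w t)‖ := by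
    intro δ hδ
    filter_upwards [(tendsto_zero_iff_norm_tendsto_zero.1 halign).eventually (gt_mem_nhds hδ)]
      with t ht
    rw [norm_smul, norm_inv, norm_norm, inv_mul_lt_iff₀ (hGpos _)] at ht
    linarith
  refine ⟨hnorm, tendsto_direction_of_margin_s15 hWpos hwmax hwmaxmin hnorm fun δ hδ0 hδ1 => ?_⟩
  exact eventually_margin_ge hN hLdef hgraddef hline hWpos hwmax hℓpos hℓ'neg hLpos htail hrel
    (div_pos hη (Real.sqrt_pos.2 hε)) hstep hmargin hnorm halign' hδ0 hδ1
end
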